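/- There exist universal constants c > 0 and C > 0 such that for every n ∈ ℕ, every H_n-invariant, isotropic, log-concave probability measure μ on ℝ^n, and every degree-3 homogeneous polynomial f : ℝ^n → ℝ with coeff_3(f) = 1: Var_μ(f) ≥ c, and |∫_{ℝ^n} e^{itf(x)} dμ(x)| ≤ C |t|^{−1/3} for every t ≠ 0. -/

import Mathlib

open MeasureTheory

noncomputable section

/-- Variance of a real function with respect to a measure. -/
def mVar {α : Type*} [MeasurableSpace α] (μ : Measure α) (f : α → ℝ) : ℝ :=
  (∫ x, f x ^ 2 ∂μ) - (∫ x, f x ∂μ) ^ 2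

/-- `coeffNorm d f` is `coeff_d(f)`, the ℓ² norm of the coefficients of the degree-`d`
homogeneous part of `f`. -/
def coeffNorm {n : ℕ} (d : ℕ) (f : MvPolynomial (Fin n) ℝ) : ℝ :=
  Real.sqrt (∑ I ∈ f.support.filter (fun I => (I.sum fun _ e => e) = d),
    (MvPolynomial.coeff I f) ^ 2)

/-- A measure on ℝ^n is log-concave if it has a log-concave density w.r.t. Lebesgue measure. -/
def IsLogConcave {n : ℕ} (μ : Measure (Fin n → ℝ)) : Prop :=
  ∃ ρ : (Fin n → ℝ) → ℝ, (∀ x, 0 ≤ ρ x) ∧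
    μ = volume.withDensity (fun x => ENNReal.ofReal (ρ x)) ∧
    ∀ x y : Fin n → ℝ, ∀ l : ℝ, 0 ≤ l → l ≤ 1 →
      ρ x ^ l * ρ y ^ (1 - l) ≤ ρ (l • x + (1 - l) • y)

/-- A measure on ℝ^n is `H_n`-invariant if it is invariant under all coordinate permutations
and all sign changes of the coordinates. -/
def IsHnInvariant {n : ℕ} (μ : Measure (Fin n → ℝ)) : Prop :=
  (∀ σ : Equiv.Perm (Fin n), Measure.map (fun x => x ∘ σ) μ = μ) ∧
  (∀ ε : Fin n → ℝ, (∀ i, ε i = 1 ∨ ε i = -1) →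
    Measure.map (fun x i => ε i * x i) μ = μ)

/-- A measure on ℝ^n is isotropic if it is centered with identity covariance. -/
def IsIsotropic {n : ℕ} (μ : Measure (Fin n → ℝ)) : Prop :=
  (∀ i, ∫ x, x i ∂μ = 0) ∧
  (∀ i j, ∫ x, x i * x j ∂μ = if i = j then (1 : ℝ) else 0)

/-- One-dimensional Brunn-Minkowski inequality for compact sets. -/
theorem volume_add_le_of_isCompact {A B C : Set ℝ} (hA : IsCompact A) (hB : IsCompact B)
    (hA0 : A.Nonempty) (hB0 : B.Nonempty) (hC : ∀ a ∈ A, ∀ b ∈ B, a + b ∈ C) :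
    volume A + volume B ≤ volume C := by
  obtain ⟨p, hpA, hp⟩ := hA.exists_isGreatest hA0
  obtain ⟨q, hqB, hq⟩ := hB.exists_isLeast hB0
  have h1 : volume ((fun x => x + q) '' A) = volume A := by
    simp [Set.image_add_right]
  have h2 : volume ((fun x => p + x) '' B) = volume B := by
    simp [Set.image_add_left]
  have hm : MeasurableSet ((fun x => p + x) '' B) :=
    (hB.image (by fun_prop)).measurableSet
  have hd : AEDisjoint volume ((fun x => x + q) '' A) ((fun x => p + x) '' B) := by
    refine measure_mono_null (t := {p + q}) ?_ (by simp)
    rintro _ ⟨⟨a, ha, rfl⟩, ⟨b, hb, hab⟩⟩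
    have := hp ha
    have := hq hb
    simp only [Set.mem_singleton_iff]
    simp only at hab
    linarith
  rw [← h1, ← h2, ← measure_union₀ hm.nullMeasurableSet hd]
  apply measure_mono
  rintro _ (⟨a, ha, rfl⟩ | ⟨b, hb, rfl⟩)
  · exact hC a ha q hqB
  · exact hC p hpA b hb

/-- One-dimensional Brunn-Minkowski inequality for measurable sets. -/
theorem volume_add_le_of_measurableSet {A B C : Set ℝ} (hA : MeasurableSet A)
    (hB : MeasurableSet B) (hA0 : A.Nonempty) (hB0 : B.Nonempty)
    (hC : ∀ a ∈ A, ∀ b ∈ B, a + b ∈ C) :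
    volume A + volume B ≤ volume C := by
  obtain ⟨a, ha⟩ := hA0
  obtain ⟨b, hb⟩ := hB0
  have key : ∀ r < volume A, ∀ s < volume B, r + s ≤ volume C := by
    intro r hr s hs
    obtain ⟨K, hKA, hK, hrK⟩ := hA.exists_lt_isCompact hr
    obtain ⟨L, hLB, hL, hsL⟩ := hB.exists_lt_isCompact hs
    have hK0 : K.Nonempty := by
      by_contra h
      rw [Set.not_nonempty_iff_eq_empty] at h
      simp [h] at hrK
    have hL0 : L.Nonempty := by
      by_contra h
      rw [Set.not_nonempty_iff_eq_empty] at h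
      simp [h] at hsL
    exact (add_le_add hrK.le hsL.le).trans (volume_add_le_of_isCompact hK hL hK0 hL0
      fun x hx y hy => hC x (hKA hx) y (hLB hy))
  rcases eq_or_ne (volume A) 0 with hA0 | hA0
  · rw [hA0, zero_add]
    calc volume B = volume ((fun x => a + x) '' B) := by simp [Set.image_add_left]
      _ ≤ volume C := by
        apply measure_mono
        rintro _ ⟨y, hy, rfl⟩
        exact hC a ha y hy
  rcases eq_or_ne (volume B) 0 with hB0 | hB0
  · rw [hB0, add_zero]
    calc volume A = volume ((fun x => x + b) '' A) := by simp [Set.image_add_right]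
      _ ≤ volume C := by
        apply measure_mono
        rintro _ ⟨y, hy, rfl⟩
        exact hC y hy b hb
  refine le_of_forall_lt fun c hc => ?_
  obtain ⟨r, hr, s, hs, hrs⟩ := ENNReal.exists_lt_add_of_lt_add hc hA0 hB0
  exact hrs.trans_le (key r hr s hs)


/-- Prékopa-Leindler on the line for functions normalized to have supremum one, in its
arithmetic mean form. -/
theorem lintegral_add_le_of_level_sets {f g h : ℝ → ℝ} (hf : Measurable f) (hg : Measurable g)
    (hh : Measurable h) (f0 : ∀ x, 0 ≤ f x) (g0 : ∀ x, 0 ≤ g x) (h0 : ∀ x, 0 ≤ h x)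
    (f1 : ∀ x, f x ≤ 1) (g1 : ∀ x, g x ≤ 1)
    (fs : ∀ u < 1, ∃ x, u < f x) (gs : ∀ u < 1, ∃ x, u < g x) {l : ℝ} (l0 : 0 < l) (l1 : l < 1)
    (H : ∀ u, 0 < u → ∀ x y, u < f x → u < g y → u < h (l * x + (1 - l) * y)) :
    ENNReal.ofReal l * (∫⁻ x, ENNReal.ofReal (f x)) +
      ENNReal.ofReal (1 - l) * (∫⁻ x, ENNReal.ofReal (g x)) ≤ ∫⁻ x, ENNReal.ofReal (h x) := by
  rw [lintegral_eq_lintegral_meas_lt volume (Filter.Eventually.of_forall f0) hf.aemeasurable,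
    lintegral_eq_lintegral_meas_lt volume (Filter.Eventually.of_forall g0) hg.aemeasurable,
    lintegral_eq_lintegral_meas_lt volume (Filter.Eventually.of_forall h0) hh.aemeasurable,
    ← lintegral_const_mul' _ _ ENNReal.ofReal_ne_top,
    ← lintegral_const_mul' _ _ ENNReal.ofReal_ne_top, ← lintegral_add_left]
  swap
  · apply Measurable.const_mul
    apply Antitone.measurable
    intro s t hst
    exact measure_mono fun x (hx : t < f x) => lt_of_le_of_lt hst hx
  apply setLIntegral_mono' measurableSet_Ioi
  intro u (hu : 0 < u)
  rcases le_or_gt 1 u with hu1 | hu1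
  · have e1 : {a | u < f a} = ∅ := by
      ext x; simpa using (f1 x).trans hu1
    have e2 : {a | u < g a} = ∅ := by
      ext x; simpa using (g1 x).trans hu1
    simp [e1, e2]
  have l1' : 0 < 1 - l := by linarith
  have sc : ∀ c : ℝ, 0 < c → ∀ A : Set ℝ,
      ENNReal.ofReal c * volume A = volume ((fun x => c * x) '' A) := by
    intro c hc A
    have := Measure.addHaar_smul (volume : Measure ℝ) c A
    simp only [Module.finrank_self, pow_one, abs_of_pos hc] at this
    rw [← this]
    rfl
  have ms : ∀ c : ℝ, 0 < c → ∀ A : Set ℝ, MeasurableSet A →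
      MeasurableSet ((fun x => c * x) '' A) := by
    intro c hc A hA
    exact ((MeasurableEquiv.mulLeft₀ c hc.ne').measurableSet_image).2 hA
  rw [sc l l0, sc (1 - l) l1']
  refine volume_add_le_of_measurableSet
    (ms l l0 _ (measurableSet_lt measurable_const hf))
    (ms _ l1' _ (measurableSet_lt measurable_const hg)) ((show Set.Nonempty _ from fs u hu1).image _)
    ((show Set.Nonempty _ from gs u hu1).image _) ?_
  · rintro _ ⟨x, hx, rfl⟩ _ ⟨y, hy, rfl⟩
    exact H u hu x y hx hy

theorem ENNReal.geom_mean_le_arith_mean_two (a b : ENNReal) {l : ℝ} (l0 : 0 < l) (l1 : l < 1) :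
    a ^ l * b ^ (1 - l) ≤ ENNReal.ofReal l * a + ENNReal.ofReal (1 - l) * b := by
  have l1' : 0 < 1 - l := by linarith
  rcases eq_or_ne a ⊤ with rfl | ha
  · simp [ENNReal.mul_top, l0]
  rcases eq_or_ne b ⊤ with rfl | hb
  · simp [ENNReal.mul_top, l1]
  rw [← ENNReal.ofReal_toReal ha, ← ENNReal.ofReal_toReal hb,
    ENNReal.ofReal_rpow_of_nonneg ENNReal.toReal_nonneg l0.le,
    ENNReal.ofReal_rpow_of_nonneg ENNReal.toReal_nonneg l1'.le, ← ENNReal.ofReal_mul (by positivity),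
    ← ENNReal.ofReal_mul l0.le, ← ENNReal.ofReal_mul l1'.le,
    ← ENNReal.ofReal_add (by positivity) (by positivity)]
  exact ENNReal.ofReal_le_ofReal (Real.geom_mean_le_arith_mean2_weighted l0.le l1'.le
    ENNReal.toReal_nonneg ENNReal.toReal_nonneg (by ring))

/-- Prékopa-Leindler on the line for bounded functions. -/
theorem prekopa_leindler_real_of_bounded {f g h : ℝ → ENNReal} (hf : Measurable f)
    (hg : Measurable g) (hh : Measurable h) {N : ENNReal} (hN : N ≠ ⊤) (fN : ∀ x, f x ≤ N)
    (gN : ∀ x, g x ≤ N) {l : ℝ} (l0 : 0 < l) (l1 : l < 1)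
    (H : ∀ x y, f x ^ l * g y ^ (1 - l) ≤ h (l * x + (1 - l) * y)) :
    (∫⁻ x, f x) ^ l * (∫⁻ x, g x) ^ (1 - l) ≤ ∫⁻ x, h x := by
  have l1' : 0 < 1 - l := by linarith
  set M := ⨆ x, f x with hM
  set M' := ⨆ x, g x with hM'
  have fM : ∀ x, f x ≤ M := le_iSup f
  have gM : ∀ x, g x ≤ M' := le_iSup g
  have Mt : M ≠ ⊤ := ne_top_of_le_ne_top hN (iSup_le fN)
  have Mt' : M' ≠ ⊤ := ne_top_of_le_ne_top hN (iSup_le gN)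
  rcases eq_or_ne M 0 with M0 | M0
  · have : ∀ x, f x = 0 := fun x => le_antisymm ((fM x).trans_eq M0) bot_le
    simp [this, l0]
  rcases eq_or_ne M' 0 with M0' | M0'
  · have : ∀ x, g x = 0 := fun x => le_antisymm ((gM x).trans_eq M0') bot_le
    simp [this, l1]
  set D := M ^ l * M' ^ (1 - l) with hD
  have Dt : D ≠ ⊤ := ENNReal.mul_ne_top (ENNReal.rpow_ne_top_of_nonneg l0.le Mt)
    (ENNReal.rpow_ne_top_of_nonneg l1'.le Mt')
  have D0 : D ≠ 0 := by
    simp only [hD, ne_eq, mul_eq_zero, ENNReal.rpow_eq_zero_iff, not_or]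
    refine ⟨⟨?_, ?_⟩, ?_, ?_⟩ <;> simp [M0, M0', Mt, Mt']
  have fle : ∀ x, f x / M ≤ 1 := fun x => ENNReal.div_le_of_le_mul (by simpa using fM x)
  have gle : ∀ x, g x / M' ≤ 1 := fun x => ENNReal.div_le_of_le_mul (by simpa using gM x)
  have ft : ∀ x, f x / M ≠ ⊤ := fun x => ne_top_of_le_ne_top ENNReal.one_ne_top (fle x)
  have gt : ∀ x, g x / M' ≠ ⊤ := fun x => ne_top_of_le_ne_top ENNReal.one_ne_top (gle x)
  have ht : ∀ x, min 1 (h x / D) ≠ ⊤ := fun x =>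
    ne_top_of_le_ne_top ENNReal.one_ne_top (min_le_left _ _)
  have key := lintegral_add_le_of_level_sets (f := fun x => (f x / M).toReal)
    (g := fun x => (g x / M').toReal) (h := fun x => (min 1 (h x / D)).toReal)
    (hf.div_const M).ennreal_toReal (hg.div_const M').ennreal_toReal
    (measurable_const.min (hh.div_const D)).ennreal_toReal
    (fun _ => ENNReal.toReal_nonneg) (fun _ => ENNReal.toReal_nonneg)
    (fun _ => ENNReal.toReal_nonneg)
    (fun x => ENNReal.toReal_le_of_le_ofReal zero_le_one (by simpa using fle x))
    (fun x => ENNReal.toReal_le_of_le_ofReal zero_le_one (by simpa using gle x))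
    ?_ ?_ l0 l1 ?_
  · simp only [ENNReal.ofReal_toReal (ft _), ENNReal.ofReal_toReal (gt _),
      ENNReal.ofReal_toReal (ht _)] at key
    have k2 := (ENNReal.geom_mean_le_arith_mean_two (∫⁻ x, f x / M) (∫⁻ x, g x / M') l0 l1).trans
      (key.trans (lintegral_mono fun x => min_le_right _ _))
    simp only [div_eq_mul_inv] at k2
    rw [lintegral_mul_const _ hf, lintegral_mul_const _ hg, lintegral_mul_const _ hh,
      ENNReal.mul_rpow_of_nonneg _ _ l0.le, ENNReal.mul_rpow_of_nonneg _ _ l1'.le,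
      mul_mul_mul_comm, ENNReal.inv_rpow, ENNReal.inv_rpow, ← ENNReal.mul_inv, ← hD] at k2
    · have := mul_le_mul_left k2 D
      rw [mul_assoc, ENNReal.inv_mul_cancel D0 Dt, mul_one, mul_assoc, ENNReal.inv_mul_cancel D0 Dt,
        mul_one] at this
      exact this
    · left; simp [M0, Mt]
    · left; simp [M0, Mt]
  · intro u hu
    rcases lt_or_ge u 0 with hu0 | hu0
    · exact ⟨0, hu0.trans_le ENNReal.toReal_nonneg⟩
    have : ENNReal.ofReal u * M < M := by
      conv_rhs => rw [← one_mul M]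
      exact ENNReal.mul_lt_mul_left M0 Mt (by simpa using hu)
    obtain ⟨x, hx⟩ := lt_iSup_iff.1 (hM ▸ this)
    refine ⟨x, (ENNReal.ofReal_lt_iff_lt_toReal hu0 (ft x)).1 ?_⟩
    exact (ENNReal.lt_div_iff_mul_lt (Or.inl M0) (Or.inl Mt)).2 hx
  · intro u hu
    rcases lt_or_ge u 0 with hu0 | hu0
    · exact ⟨0, hu0.trans_le ENNReal.toReal_nonneg⟩
    have : ENNReal.ofReal u * M' < M' := by
      conv_rhs => rw [← one_mul M']
      exact ENNReal.mul_lt_mul_left M0' Mt' (by simpa using hu)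
    obtain ⟨x, hx⟩ := lt_iSup_iff.1 (hM' ▸ this)
    refine ⟨x, (ENNReal.ofReal_lt_iff_lt_toReal hu0 (gt x)).1 ?_⟩
    exact (ENNReal.lt_div_iff_mul_lt (Or.inl M0') (Or.inl Mt')).2 hx
  · intro u hu x y hx hy
    rw [← ENNReal.ofReal_lt_iff_lt_toReal hu.le (ft x)] at hx
    rw [← ENNReal.ofReal_lt_iff_lt_toReal hu.le (gt y)] at hy
    rw [← ENNReal.ofReal_lt_iff_lt_toReal hu.le (ht _), lt_min_iff]
    refine ⟨hx.trans_le (fle x), ?_⟩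
    have e : ENNReal.ofReal u = ENNReal.ofReal u ^ l * ENNReal.ofReal u ^ (1 - l) := by
      rw [← ENNReal.rpow_add_of_nonneg _ _ l0.le l1'.le]; simp
    calc ENNReal.ofReal u = ENNReal.ofReal u ^ l * ENNReal.ofReal u ^ (1 - l) := e
      _ < (f x / M) ^ l * (g y / M') ^ (1 - l) :=
        ENNReal.mul_lt_mul (ENNReal.rpow_lt_rpow hx l0) (ENNReal.rpow_lt_rpow hy l1')
      _ = f x ^ l * g y ^ (1 - l) / D := by
        rw [div_eq_mul_inv, div_eq_mul_inv, div_eq_mul_inv, ENNReal.mul_rpow_of_nonneg _ _ l0.le,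
          ENNReal.mul_rpow_of_nonneg _ _ l1'.le, mul_mul_mul_comm, ENNReal.inv_rpow,
          ENNReal.inv_rpow, ← ENNReal.mul_inv, ← hD]
        · left; simp [M0, Mt]
        · left; simp [M0, Mt]
      _ ≤ h (l * x + (1 - l) * y) / D := ENNReal.div_le_div_right (H x y) D

/-- Prékopa-Leindler on the line. -/
theorem prekopa_leindler_real {f g h : ℝ → ENNReal} (hf : Measurable f)
    (hg : Measurable g) (hh : Measurable h) {l : ℝ} (l0 : 0 < l) (l1 : l < 1)
    (H : ∀ x y, f x ^ l * g y ^ (1 - l) ≤ h (l * x + (1 - l) * y)) :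
    (∫⁻ x, f x) ^ l * (∫⁻ x, g x) ^ (1 - l) ≤ ∫⁻ x, h x := by
  have l1' : 0 < 1 - l := by linarith
  rcases eq_or_ne (∫⁻ x, f x) 0 with h1 | h1
  · simp [h1, l0]
  rcases eq_or_ne (∫⁻ x, g x) 0 with h2 | h2
  · simp [h2, l1]
  have tr : ∀ f : ℝ → ENNReal, Measurable f →
      Filter.Tendsto (fun N : ℕ => ∫⁻ x, min (f x) N) Filter.atTop (nhds (∫⁻ x, f x)) := by
    intro f hf
    apply lintegral_tendsto_of_tendsto_of_monotone
    · exact fun N => (hf.min measurable_const).aemeasurable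
    · refine Filter.Eventually.of_forall fun x N N' hN => ?_
      exact min_le_min le_rfl (by exact_mod_cast hN)
    · refine Filter.Eventually.of_forall fun x => ?_
      have := (tendsto_const_nhds (x := f x)).min ENNReal.tendsto_nat_nhds_top
      simpa using this
  have t1 := ((ENNReal.continuous_rpow_const (y := l)).tendsto _).comp (tr f hf)
  have t2 := ((ENNReal.continuous_rpow_const (y := 1 - l)).tendsto _).comp (tr g hg)
  have t3 := ENNReal.Tendsto.mul t1 (Or.inl (by simp [h1, l0.not_gt])) t2
    (Or.inl (by simp [h2, l1'.not_gt]))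
  refine le_of_tendsto' t3 fun N => ?_
  refine prekopa_leindler_real_of_bounded (N := N) (hf.min measurable_const)
    (hg.min measurable_const) hh (by simp) (fun x => min_le_right _ _) (fun x => min_le_right _ _)
    l0 l1 fun x y => ?_
  refine le_trans ?_ (H x y)
  gcongr <;> exact min_le_left _ _

/-- Log-concavity for functions with values in `ℝ≥0∞`. -/
def LogConcave {E : Type*} [AddCommGroup E] [Module ℝ E] (f : E → ENNReal) : Prop :=
  ∀ x y : E, ∀ l : ℝ, 0 < l → l < 1 → f x ^ l * f y ^ (1 - l) ≤ f (l • x + (1 - l) • y)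

theorem LogConcave.convex_lt {E : Type*} [AddCommGroup E] [Module ℝ E] {f : E → ENNReal}
    (hf : LogConcave f) (u : ENNReal) : Convex ℝ {x | u < f x} := by
  rw [convex_iff_forall_pos]
  intro x hx y hy a b ha hb hab
  obtain rfl : b = 1 - a := by linarith
  refine lt_of_lt_of_le ?_ (hf x y a ha (by linarith))
  calc u = u ^ a * u ^ (1 - a) := by
        rw [← ENNReal.rpow_add_of_nonneg _ _ ha.le hb.le]; simp
    _ < f x ^ a * f y ^ (1 - a) :=
        ENNReal.mul_lt_mul (ENNReal.rpow_lt_rpow hx ha) (ENNReal.rpow_lt_rpow hy hb)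

theorem LogConcave.aemeasurable {n : ℕ} {f : (Fin n → ℝ) → ENNReal} (hf : LogConcave f) :
    AEMeasurable f volume := by
  have : NullMeasurable f volume := by
    have : @Measurable (NullMeasurableSpace (Fin n → ℝ) volume) _ _ _ f := by
      apply measurable_of_Ioi
      intro u
      have h : NullMeasurableSet {x : Fin n → ℝ | u < f x} volume :=
        Convex.nullMeasurableSet volume (hf.convex_lt u)
      exact h
    exact fun s hs => this hs
  exact this.aemeasurable

theorem LogConcave.measurable_real {f : ℝ → ENNReal} (hf : LogConcave f) : Measurable f := by
  apply measurable_of_Ioi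
  intro u
  exact (hf.convex_lt u).ordConnected.measurableSet

theorem LogConcave.mul {E : Type*} [AddCommGroup E] [Module ℝ E] {f g : E → ENNReal}
    (hf : LogConcave f) (hg : LogConcave g) : LogConcave (fun x => f x * g x) := by
  intro x y l l0 l1
  rw [ENNReal.mul_rpow_of_nonneg _ _ l0.le, ENNReal.mul_rpow_of_nonneg _ _ (by linarith),
    mul_mul_mul_comm]
  exact mul_le_mul' (hf x y l l0 l1) (hg x y l l0 l1)

theorem LogConcave.section_cons {n : ℕ} {f : (Fin (n + 1) → ℝ) → ENNReal} (hf : LogConcave f)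
    (y : Fin n → ℝ) : LogConcave (fun x : ℝ => f (Fin.cons x y)) := by
  intro x x' l l0 l1
  convert hf (Fin.cons x y) (Fin.cons x' y) l l0 l1 using 2
  ext i
  refine Fin.cases ?_ (fun j => ?_) i
  · simp
  · simp; ring

theorem prekopa_leindler_section {n : ℕ} {f g h : (Fin (n + 1) → ℝ) → ENNReal}
    (hf : LogConcave f) (hg : LogConcave g) (hh : LogConcave h) {l : ℝ} (l0 : 0 < l) (l1 : l < 1)
    (H : ∀ x y, f x ^ l * g y ^ (1 - l) ≤ h (l • x + (1 - l) • y)) (y y' : Fin n → ℝ) :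
    (∫⁻ x : ℝ, f (Fin.cons x y)) ^ l * (∫⁻ x : ℝ, g (Fin.cons x y')) ^ (1 - l) ≤
      ∫⁻ x : ℝ, h (Fin.cons x (l • y + (1 - l) • y')) := by
  refine prekopa_leindler_real (hf.section_cons y).measurable_real
    (hg.section_cons y').measurable_real (hh.section_cons _).measurable_real l0 l1 fun x x' => ?_
  convert H (Fin.cons x y) (Fin.cons x' y') using 2
  ext i
  refine Fin.cases ?_ (fun j => ?_) i
  · simp
  · simp

theorem lintegral_fin_cons {n : ℕ} {f : (Fin (n + 1) → ℝ) → ENNReal} (hf : AEMeasurable f volume) :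
    ∫⁻ x, f x = ∫⁻ y : Fin n → ℝ, ∫⁻ x : ℝ, f (Fin.cons x y) := by
  have mp := (volume_preserving_piFinSuccAbove (fun _ : Fin (n + 1) => ℝ) 0).symm
  rw [← mp.lintegral_comp_emb (MeasurableEquiv.measurableEmbedding _),
    Measure.volume_eq_prod, lintegral_prod_symm]
  · simp only [MeasurableEquiv.piFinSuccAbove_symm_apply, Fin.insertNthEquiv, Fin.insertNth_zero]
    rfl
  · exact hf.comp_quasiMeasurePreserving mp.quasiMeasurePreserving

/-- The Prékopa-Leindler inequality for log-concave functions. -/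
theorem prekopa_leindler {n : ℕ} {f g h : (Fin n → ℝ) → ENNReal}
    (hf : LogConcave f) (hg : LogConcave g) (hh : LogConcave h) {l : ℝ} (l0 : 0 < l) (l1 : l < 1)
    (H : ∀ x y, f x ^ l * g y ^ (1 - l) ≤ h (l • x + (1 - l) • y)) :
    (∫⁻ x, f x) ^ l * (∫⁻ x, g x) ^ (1 - l) ≤ ∫⁻ x, h x := by
  induction n with
  | zero =>
    have e : ∀ k : (Fin 0 → ℝ) → ENNReal, ∫⁻ x, k x = k 0 := by
      intro k
      rw [volume_pi, Measure.pi_of_empty (fun _ : Fin 0 => (volume : Measure ℝ)) 0,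
        lintegral_dirac' _ (measurable_of_finite _)]
    rw [e, e, e]
    simpa using H 0 0
  | succ n ih =>
    rw [lintegral_fin_cons hf.aemeasurable, lintegral_fin_cons hg.aemeasurable,
      lintegral_fin_cons hh.aemeasurable]
    have key : ∀ {f : (Fin (n + 1) → ℝ) → ENNReal}, LogConcave f →
        LogConcave (fun y : Fin n → ℝ => ∫⁻ x : ℝ, f (Fin.cons x y)) := by
      intro f hf y y' l l0 l1
      exact prekopa_leindler_section hf hf hf l0 l1 (fun x y => hf x y l l0 l1) y y'
    exact ih (key hf) (key hg) (key hh) (prekopa_leindler_section hf hg hh l0 l1 H)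

/-- Continuous, convex and nonnegative functions. -/
structure ConvexPotential {E : Type*} [AddCommGroup E] [Module ℝ E] [TopologicalSpace E]
    (φ : E → ℝ) : Prop where
  continuous : Continuous φ
  nonneg : ∀ x, 0 ≤ φ x
  convex : ∀ x y : E, ∀ l : ℝ, 0 < l → l < 1 →
    φ (l • x + (1 - l) • y) ≤ l * φ x + (1 - l) * φ y

/-- The Prékopa-Leindler property of a measure, tested against exponentials of convex potentials. -/
def IsPL {E : Type*} [AddCommGroup E] [Module ℝ E] [TopologicalSpace E] [MeasurableSpace E]
    (ν : Measure E) : Prop :=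
  ∀ l : ℝ, 0 < l → l < 1 → ∀ φ ψ χ : E → ℝ,
    ConvexPotential φ → ConvexPotential ψ → ConvexPotential χ →
    (∀ x y, χ (l • x + (1 - l) • y) ≤ l * φ x + (1 - l) * ψ y) →
    (∫⁻ x, ENNReal.ofReal (Real.exp (-φ x)) ∂ν) ^ l *
      (∫⁻ x, ENNReal.ofReal (Real.exp (-ψ x)) ∂ν) ^ (1 - l) ≤
      ∫⁻ x, ENNReal.ofReal (Real.exp (-χ x)) ∂ν

theorem ofReal_exp_neg_rpow_mul (a b l : ℝ) :
    ENNReal.ofReal (Real.exp (-a)) ^ l * ENNReal.ofReal (Real.exp (-b)) ^ (1 - l) =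
      ENNReal.ofReal (Real.exp (-(l * a + (1 - l) * b))) := by
  rw [ENNReal.ofReal_rpow_of_pos (Real.exp_pos _), ENNReal.ofReal_rpow_of_pos (Real.exp_pos _),
    ← ENNReal.ofReal_mul (by positivity), ← Real.exp_mul, ← Real.exp_mul, ← Real.exp_add]
  ring_nf

theorem ConvexPotential.logConcave {E : Type*} [AddCommGroup E] [Module ℝ E] [TopologicalSpace E]
    {φ : E → ℝ} (h : ConvexPotential φ) :
    LogConcave fun x => ENNReal.ofReal (Real.exp (-φ x)) := by
  intro x y l l0 l1
  rw [ofReal_exp_neg_rpow_mul]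
  exact ENNReal.ofReal_le_ofReal (Real.exp_le_exp.2 (neg_le_neg (h.convex x y l l0 l1)))

theorem ConvexPotential.measurable {E : Type*} [AddCommGroup E] [Module ℝ E] [TopologicalSpace E]
    [MeasurableSpace E] [BorelSpace E] {φ : E → ℝ} (h : ConvexPotential φ) :
    Measurable fun x => ENNReal.ofReal (Real.exp (-φ x)) := by
  have := h.continuous
  exact (by fun_prop : Continuous fun x => Real.exp (-φ x)).measurable.ennreal_ofReal

/-- Maps which preserve convex combinations. -/
def IsAffine {E F : Type*} [AddCommGroup E] [Module ℝ E] [AddCommGroup F] [Module ℝ F]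
    (T : E → F) : Prop :=
  ∀ x y : E, ∀ l : ℝ, T (l • x + (1 - l) • y) = l • T x + (1 - l) • T y

theorem ConvexPotential.comp {E F : Type*} [AddCommGroup E] [Module ℝ E] [AddCommGroup F]
    [Module ℝ F] [TopologicalSpace E] [TopologicalSpace F] {T : E → F} (hT : IsAffine T)
    (hc : Continuous T) {φ : F → ℝ} (h : ConvexPotential φ) :
    ConvexPotential fun x => φ (T x) where
  continuous := h.continuous.comp hc
  nonneg x := h.nonneg _
  convex x y l l0 l1 := by
    rw [hT]
    exact h.convex _ _ l l0 l1

theorem IsPL.map {E F : Type*} [AddCommGroup E] [Module ℝ E] [AddCommGroup F]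
    [Module ℝ F] [TopologicalSpace E] [TopologicalSpace F] [MeasurableSpace E] [BorelSpace E]
    [MeasurableSpace F] [BorelSpace F] {ν : Measure E} (hν : IsPL ν) {T : E → F}
    (hT : IsAffine T) (hc : Continuous T) : IsPL (ν.map T) := by
  intro l l0 l1 φ ψ χ hφ hψ hχ H
  rw [lintegral_map hφ.measurable hc.measurable, lintegral_map hψ.measurable hc.measurable,
    lintegral_map hχ.measurable hc.measurable]
  exact hν l l0 l1 _ _ _ (hφ.comp hT hc) (hψ.comp hT hc) (hχ.comp hT hc)
    fun x y => by rw [hT]; exact H _ _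

theorem IsPL.smul {E : Type*} [AddCommGroup E] [Module ℝ E] [TopologicalSpace E]
    [MeasurableSpace E] {ν : Measure E} (hν : IsPL ν) (c : ENNReal) : IsPL (c • ν) := by
  intro l l0 l1 φ ψ χ hφ hψ hχ H
  have l1' : 0 < 1 - l := by linarith
  simp only [lintegral_smul_measure, smul_eq_mul]
  rw [ENNReal.mul_rpow_of_nonneg _ _ l0.le, ENNReal.mul_rpow_of_nonneg _ _ l1'.le,
    mul_mul_mul_comm, ← ENNReal.rpow_add_of_nonneg _ _ l0.le l1'.le]
  simpa using mul_le_mul_right (hν l l0 l1 φ ψ χ hφ hψ hχ H) c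

theorem LogConcave.isPL {n : ℕ} {f : (Fin n → ℝ) → ENNReal} (hf : LogConcave f) :
    IsPL (volume.withDensity f) := by
  intro l l0 l1 φ ψ χ hφ hψ hχ H
  rw [lintegral_withDensity_eq_lintegral_mul₀ hf.aemeasurable hφ.measurable.aemeasurable,
    lintegral_withDensity_eq_lintegral_mul₀ hf.aemeasurable hψ.measurable.aemeasurable,
    lintegral_withDensity_eq_lintegral_mul₀ hf.aemeasurable hχ.measurable.aemeasurable]
  refine prekopa_leindler (hf.mul hφ.logConcave) (hf.mul hψ.logConcave) (hf.mul hχ.logConcave)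
    l0 l1 fun x y => ?_
  rw [ENNReal.mul_rpow_of_nonneg _ _ l0.le, ENNReal.mul_rpow_of_nonneg _ _ (by linarith),
    mul_mul_mul_comm, ofReal_exp_neg_rpow_mul]
  exact mul_le_mul' (hf x y l l0 l1)
    (ENNReal.ofReal_le_ofReal (Real.exp_le_exp.2 (neg_le_neg (H x y))))

theorem LogConcave.indicator {E : Type*} [AddCommGroup E] [Module ℝ E] {f : E → ENNReal}
    (hf : LogConcave f) {K : Set E} (hK : Convex ℝ K) : LogConcave (K.indicator f) := by
  intro x y l l0 l1
  have l1' : 0 < 1 - l := by linarith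
  by_cases hx : x ∈ K
  · by_cases hy : y ∈ K
    · rw [Set.indicator_of_mem hx, Set.indicator_of_mem hy,
        Set.indicator_of_mem (hK hx hy l0.le l1'.le (by ring))]
      exact hf x y l l0 l1
    · simp [hy, l1]
  · simp [hx, l0]

theorem LogConcave.isPL_restrict {n : ℕ} {f : (Fin n → ℝ) → ENNReal} (hf : LogConcave f)
    {K : Set (Fin n → ℝ)} (hK : Convex ℝ K) (hm : MeasurableSet K) :
    IsPL ((volume.withDensity f).restrict K) := by
  rw [restrict_withDensity hm, ← withDensity_indicator hm]
  exact (hf.indicator hK).isPL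

theorem IsPL.restrict_halfspace {E : Type*} [AddCommGroup E] [Module ℝ E] [TopologicalSpace E]
    [MeasurableSpace E] [BorelSpace E] {ν : Measure E} [IsFiniteMeasure ν] (hν : IsPL ν)
    {T : E → ℝ} (hT : IsAffine T) (hc : Continuous T) : IsPL (ν.restrict {x | 0 ≤ T x}) := by
  intro l l0 l1 φ ψ χ hφ hψ hχ H
  have l1' : 0 < 1 - l := by linarith
  have hm : MeasurableSet {x | 0 ≤ T x} := measurableSet_le measurable_const hc.measurable
  have pot : ∀ {φ : E → ℝ}, ConvexPotential φ → ∀ k : ℕ,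
      ConvexPotential fun x => φ x + k * max (-T x) 0 := by
    intro φ hφ k
    have := hφ.continuous
    refine ⟨by fun_prop, fun x => add_nonneg (hφ.nonneg x) (by positivity), ?_⟩
    intro x y l l0 l1
    have l1' : 0 < 1 - l := by linarith
    have h1 := hφ.convex x y l l0 l1
    have h2 : max (-T (l • x + (1 - l) • y)) 0 ≤ l * max (-T x) 0 + (1 - l) * max (-T y) 0 := by
      rw [hT]
      simp only [smul_eq_mul]
      apply max_le
      · nlinarith [mul_le_mul_of_nonneg_left (le_max_left (-T x) 0) l0.le,
          mul_le_mul_of_nonneg_left (le_max_left (-T y) 0) l1'.le]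
      · positivity
    nlinarith [mul_le_mul_of_nonneg_left h2 (Nat.cast_nonneg (α := ℝ) k)]
  have lim : ∀ {φ : E → ℝ}, ConvexPotential φ → Filter.Tendsto
      (fun k : ℕ => ∫⁻ x, ENNReal.ofReal (Real.exp (-(φ x + k * max (-T x) 0))) ∂ν) Filter.atTop
      (nhds (∫⁻ x in {x | 0 ≤ T x}, ENNReal.ofReal (Real.exp (-φ x)) ∂ν)) := by
    intro φ hφ
    rw [← lintegral_indicator hm]
    refine tendsto_lintegral_of_dominated_convergence (fun _ => 1)
      (fun k => (pot hφ k).measurable) (fun k => ?_) (by simp) ?_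
    · refine Filter.Eventually.of_forall fun x => ?_
      rw [← ENNReal.ofReal_one]
      apply ENNReal.ofReal_le_ofReal
      exact Real.exp_le_one_iff.2 (neg_nonpos.2 ((pot hφ k).nonneg x))
    · refine Filter.Eventually.of_forall fun x => ?_
      by_cases hx : 0 ≤ T x
      · have : max (-T x) 0 = 0 := max_eq_right (by linarith)
        rw [Set.indicator_of_mem (by exact hx)]
        simp only [this, mul_zero, add_zero]
        exact tendsto_const_nhds
      · have h2 : 0 < max (-T x) 0 := lt_max_of_lt_left (by linarith)
        rw [Set.indicator_of_notMem (by simpa using hx), ← ENNReal.ofReal_zero]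
        refine (ENNReal.continuous_ofReal.tendsto _).comp ?_
        refine Real.tendsto_exp_neg_atTop_nhds_zero.comp ?_
        exact Filter.tendsto_atTop_add_const_left _ _
          (tendsto_natCast_atTop_atTop.atTop_mul_const h2)
  have ft : ∀ {φ : E → ℝ}, ConvexPotential φ →
      ∫⁻ x in {x | 0 ≤ T x}, ENNReal.ofReal (Real.exp (-φ x)) ∂ν ≠ ⊤ := by
    intro φ hφ
    refine ((lintegral_mono (g := fun _ => 1) fun x => ?_).trans_lt (by simp)).ne
    rw [← ENNReal.ofReal_one]
    apply ENNReal.ofReal_le_ofReal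
    simpa using hφ.nonneg x
  have t1 := ((ENNReal.continuous_rpow_const (y := l)).tendsto _).comp (lim hφ)
  have t2 := ((ENNReal.continuous_rpow_const (y := 1 - l)).tendsto _).comp (lim hψ)
  have t3 := ENNReal.Tendsto.mul t1 (Or.inr (ENNReal.rpow_ne_top_of_nonneg l1'.le (ft hψ))) t2
    (Or.inr (ENNReal.rpow_ne_top_of_nonneg l0.le (ft hφ)))
  refine le_of_tendsto_of_tendsto' t3 (lim hχ) fun k => ?_
  refine hν l l0 l1 _ _ _ (pot hφ k) (pot hψ k) (pot hχ k) fun x y => ?_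
  have h1 := H x y
  have h2 : max (-T (l • x + (1 - l) • y)) 0 ≤ l * max (-T x) 0 + (1 - l) * max (-T y) 0 := by
    rw [hT]
    simp only [smul_eq_mul]
    apply max_le
    · nlinarith [mul_le_mul_of_nonneg_left (le_max_left (-T x) 0) l0.le,
        mul_le_mul_of_nonneg_left (le_max_left (-T y) 0) l1'.le]
    · positivity
  nlinarith [mul_le_mul_of_nonneg_left h2 (Nat.cast_nonneg (α := ℝ) k)]

theorem isClosed_setOf_isPL {X E : Type*} [TopologicalSpace X] [MeasurableSpace X]
    [BorelSpace X] [AddCommGroup E] [Module ℝ E] [TopologicalSpace E]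
    [MeasurableSpace E] [BorelSpace E] {T : X → E} (hT : Continuous T) :
    IsClosed {ν : ProbabilityMeasure X | IsPL ((ν : Measure X).map T)} := by
  simp only [IsPL, Set.ofPred_forall]
  refine isClosed_iInter fun l => isClosed_iInter fun l0 => isClosed_iInter fun l1 =>
    isClosed_iInter fun φ => isClosed_iInter fun ψ => isClosed_iInter fun χ =>
    isClosed_iInter fun hφ => isClosed_iInter fun hψ => isClosed_iInter fun hχ =>
    isClosed_iInter fun H => ?_
  have l1' : 0 < 1 - l := by linarith
  have key : ∀ φ : E → ℝ, ConvexPotential φ → ∃ F : ProbabilityMeasure X → NNReal,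
      Continuous F ∧ ∀ ν : ProbabilityMeasure X,
      ∫⁻ x, ENNReal.ofReal (Real.exp (-φ x)) ∂((ν : Measure X).map T) = F ν := by
    intro φ hφ
    have := hφ.continuous
    let f : BoundedContinuousFunction X NNReal :=
      BoundedContinuousFunction.mkOfBound ⟨fun x => Real.toNNReal (Real.exp (-φ (T x))),
        continuous_real_toNNReal.comp (by fun_prop)⟩ 1 (fun x y => by
          have h1 := Real.exp_le_one_iff.2 (neg_nonpos.2 (hφ.nonneg (T x)))
          have h2 := Real.exp_le_one_iff.2 (neg_nonpos.2 (hφ.nonneg (T y)))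
          have h3 := Real.exp_pos (-φ (T x))
          have h4 := Real.exp_pos (-φ (T y))
          rw [NNReal.dist_eq]
          simp only [ContinuousMap.coe_mk, Real.coe_toNNReal _ (Real.exp_pos _).le]
          rw [abs_le]
          constructor <;> linarith)
    refine ⟨fun ν => ν.toFiniteMeasure.testAgainstNN f, ?_, fun ν => ?_⟩
    · exact ProbabilityMeasure.continuous_testAgainstNN_eval f
    · rw [lintegral_map hφ.measurable hT.measurable, FiniteMeasure.testAgainstNN_coe_eq]
      rfl
  obtain ⟨F1, c1, e1⟩ := key φ hφ
  obtain ⟨F2, c2, e2⟩ := key ψ hψ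
  obtain ⟨F3, c3, e3⟩ := key χ hχ
  simp only [e1, e2, e3]
  simp only [← ENNReal.coe_rpow_of_nonneg _ l0.le, ← ENNReal.coe_rpow_of_nonneg _ l1'.le,
    ← ENNReal.coe_mul, ENNReal.coe_le_coe]
  exact isClosed_le (((NNReal.continuous_rpow_const l0.le).comp c1).mul
    ((NNReal.continuous_rpow_const l1'.le).comp c2)) c3

/-- Unimodal densities on the line which are at unit scale. -/
structure IsUnitDensity (ρ : ℝ → ℝ) : Prop where
  measurable : Measurable ρ
  nonneg : ∀ u, 0 ≤ ρ u
  le_exp : ∀ u, ρ u ≤ 21 * Real.exp (-|u|)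
  ge : ∀ u, 0 ≤ u → u ≤ 1 → 1 / 16 ≤ ρ u
  lintegral_eq : ∫⁻ u, ENNReal.ofReal (ρ u) = 1
  ordConnected : ∀ t, Set.OrdConnected {u | t < ρ u}

theorem lintegral_comp_affine {f : ℝ → ENNReal} (hf : Measurable f) (a : ℝ) {s : ℝ} (hs : 0 < s) :
    ∫⁻ u, f (a + s * u) = ENNReal.ofReal s⁻¹ * ∫⁻ x, f x := by
  have h1 : ∫⁻ u, f (a + s * u) = ∫⁻ v, f (a + v) ∂(Measure.map (fun u => s * u) volume) := by
    rw [lintegral_map (by fun_prop) (by fun_prop)]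
  rw [h1, Real.map_volume_mul_left hs.ne', lintegral_smul_measure, lintegral_add_left_eq_self,
    abs_of_pos (inv_pos.2 hs), smul_eq_mul]

theorem lintegral_exp_neg_abs : ∫⁻ u : ℝ, ENNReal.ofReal (Real.exp (-|u|)) = 2 := by
  have h := integral_comp_abs (f := fun x => Real.exp (-x))
  rw [integral_exp_neg_Ioi_zero] at h
  have hi : Integrable (fun u : ℝ => Real.exp (-|u|)) := by
    by_contra hc
    rw [integral_undef hc] at h
    norm_num at h
  rw [← ofReal_integral_eq_lintegral_ofReal hi
    (Filter.Eventually.of_forall fun _ => (Real.exp_pos _).le), h]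
  norm_num

theorem exists_isUnitDensity {A : ℝ → ℝ} (hc : Continuous A) (h0 : ∀ x, 0 < A x)
    (hl : Filter.Tendsto A (Filter.cocompact ℝ) (nhds 0))
    (hA : ∀ x y l : ℝ, 0 < l → l < 1 → A x ^ l * A y ^ (1 - l) ≤ A (l * x + (1 - l) * y))
    (h1 : ∫⁻ x, ENNReal.ofReal (A x) = 1) :
    ∃ a s : ℝ, 0 < s ∧ IsUnitDensity fun u => s * A (a + s * u) := by
  obtain ⟨x0, hx0⟩ : ∃ x0, ∀ x, A x ≤ A x0 := by
    refine hc.exists_forall_ge' 0 ?_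
    filter_upwards [hl.eventually (gt_mem_nhds (h0 0))] with x hx using le_of_lt hx
  set M := A x0 with hM
  have M0 : 0 < M := h0 x0
  have e0 := Real.exp_pos (-1)
  have hMe : M * Real.exp (-1) < M := by
    have : Real.exp (-1) < 1 := by simp
    nlinarith
  have hMe0 : 0 < M * Real.exp (-1) := by positivity
  have hcc := hl.eventually (gt_mem_nhds hMe0)
  rw [cocompact_eq_atBot_atTop, Filter.eventually_sup] at hcc
  obtain ⟨a', ha', ha'2⟩ := (hcc.1.and (Filter.eventually_lt_atBot x0)).exists
  obtain ⟨b', hb', hb'2⟩ := (hcc.2.and (Filter.eventually_gt_atTop x0)).exists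
  obtain ⟨a, haI, ha⟩ := intermediate_value_Icc ha'2.le hc.continuousOn ⟨ha'.le, hMe.le⟩
  obtain ⟨b, hbI, hb⟩ := intermediate_value_Icc' hb'2.le hc.continuousOn ⟨hb'.le, hMe.le⟩
  have hax : a < x0 := lt_of_le_of_ne haI.2 (by rintro rfl; linarith)
  have hbx : x0 < b := lt_of_le_of_ne hbI.1 (by rintro rfl; linarith)
  set w : ℝ → ℝ := fun x => -Real.log (A x / M) with hw
  have Aw : ∀ x, A x = M * Real.exp (-w x) := by
    intro x
    simp only [hw, neg_neg]
    rw [Real.exp_log (div_pos (h0 x) M0)]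
    field_simp
  have wx0 : w x0 = 0 := by simp [hw, ← hM, M0.ne']
  have wn : ∀ x, 0 ≤ w x := fun x => by
    simp only [hw]
    exact neg_nonneg.2 (Real.log_nonpos (div_pos (h0 x) M0).le ((div_le_one M0).2 (hx0 x)))
  have wa : w a = 1 := by
    simp only [hw, ha]
    rw [mul_div_assoc, mul_comm M, div_mul_cancel₀ _ M0.ne', Real.log_exp, neg_neg]
  have wb : w b = 1 := by
    simp only [hw, hb]
    rw [mul_div_assoc, mul_comm M, div_mul_cancel₀ _ M0.ne', Real.log_exp, neg_neg]
  have wc : ∀ x y l : ℝ, 0 < l → l < 1 → w (l * x + (1 - l) * y) ≤ l * w x + (1 - l) * w y := by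
    intro x y l l0 l1
    have h := hA x y l l0 l1
    rw [Aw x, Aw y, Aw (l * x + _), Real.mul_rpow M0.le (Real.exp_pos _).le,
      Real.mul_rpow M0.le (Real.exp_pos _).le, mul_mul_mul_comm, ← Real.rpow_add M0,
      ← Real.exp_mul, ← Real.exp_mul, ← Real.exp_add] at h
    simp only [add_sub_cancel, Real.rpow_one] at h
    have := Real.exp_le_exp.1 (le_of_mul_le_mul_left h M0)
    linarith
  set s := b - a with hs
  have s0 : 0 < s := by linarith
  have win : ∀ x, a ≤ x → x ≤ b → w x ≤ 1 := by
    intro x hxa hxb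
    rcases eq_or_lt_of_le hxa with rfl | hxa
    · exact wa.le
    rcases eq_or_lt_of_le hxb with rfl | hxb
    · exact wb.le
    have := wc a b ((b - x) / s) (div_pos (by linarith) s0) ((div_lt_one s0).2 (by linarith))
    rw [wa, wb] at this
    have e : (b - x) / s * a + (1 - (b - x) / s) * b = x := by
      field_simp; simp only [hs]; ring
    rw [e] at this
    linarith
  have wout : ∀ x, |x - x0| / s - 1 ≤ w x := by
    intro x
    rcases le_or_gt b x with hx | hx
    · have hp : 0 < x - x0 := by linarith
      have l0 : 0 < (b - x0) / (x - x0) := div_pos (by linarith) hp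
      rw [abs_of_pos hp]
      have : (x - x0) / (b - x0) ≤ w x := by
        rcases eq_or_lt_of_le hx with rfl | hx
        · rw [wb, div_self hp.ne']
        have := wc x x0 ((b - x0) / (x - x0)) l0 ((div_lt_one hp).2 (by linarith))
        have e : (b - x0) / (x - x0) * x + (1 - (b - x0) / (x - x0)) * x0 = b := by
          field_simp; ring
        rw [e, wb, wx0, mul_zero, add_zero] at this
        rw [div_le_iff₀ (by linarith)]
        rw [div_mul_eq_mul_div, le_div_iff₀ hp] at this
        linarith
      have h2 : (x - x0) / s ≤ (x - x0) / (b - x0) :=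
        div_le_div_of_nonneg_left hp.le (by linarith) (by linarith)
      linarith
    rcases le_or_gt x a with hx' | hx'
    · have hp : 0 < x0 - x := by linarith
      have l0 : 0 < (x0 - a) / (x0 - x) := div_pos (by linarith) hp
      rw [abs_sub_comm, abs_of_pos hp]
      have : (x0 - x) / (x0 - a) ≤ w x := by
        rcases eq_or_lt_of_le hx' with rfl | hx'
        · rw [wa, div_self hp.ne']
        have := wc x x0 ((x0 - a) / (x0 - x)) l0 ((div_lt_one hp).2 (by linarith))
        have e : (x0 - a) / (x0 - x) * x + (1 - (x0 - a) / (x0 - x)) * x0 = a := by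
          field_simp; ring
        rw [e, wa, wx0, mul_zero, add_zero] at this
        rw [div_le_iff₀ (by linarith)]
        rw [div_mul_eq_mul_div, le_div_iff₀ hp] at this
        linarith
      have h2 : (x0 - x) / s ≤ (x0 - x) / (x0 - a) :=
        div_le_div_of_nonneg_left hp.le (by linarith) (by linarith)
      linarith
    · have : |x - x0| / s ≤ 1 := by
        rw [div_le_one s0, abs_le]
        constructor <;> linarith
      linarith [wn x]
  have Ale : ∀ x, A x ≤ M * Real.exp 1 * Real.exp (-|(x - x0) / s|) := by
    intro x
    rw [Aw x, mul_assoc, ← Real.exp_add]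
    gcongr
    rw [abs_div, abs_of_pos s0]
    linarith [wout x]
  have sM1 : s * M ≤ Real.exp 1 := by
    have : ENNReal.ofReal (M * Real.exp (-1)) * ENNReal.ofReal s ≤ 1 := by
      rw [← h1, hs, ← Real.volume_Icc, ← setLIntegral_const]
      refine (setLIntegral_mono' measurableSet_Icc fun x hx => ?_).trans
        (setLIntegral_le_lintegral _ _)
      apply ENNReal.ofReal_le_ofReal
      rw [Aw x]
      gcongr
      exact win x hx.1 hx.2
    rw [← ENNReal.ofReal_mul hMe0.le, ENNReal.ofReal_le_one, Real.exp_neg] at this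
    have e1 := Real.exp_pos 1
    rw [← div_eq_mul_inv, div_mul_eq_mul_div, div_le_one e1] at this
    linarith
  have sM2 : 1 ≤ 2 * Real.exp 1 * (s * M) := by
    have : (1 : ENNReal) ≤ ENNReal.ofReal (2 * Real.exp 1 * (s * M)) := by
      calc (1 : ENNReal) = ∫⁻ x, ENNReal.ofReal (A x) := h1.symm
        _ ≤ ∫⁻ x, ENNReal.ofReal (M * Real.exp 1) *
            ENNReal.ofReal (Real.exp (-|-(x0 / s) + s⁻¹ * x|)) := by
          refine lintegral_mono fun x => ?_
          rw [← ENNReal.ofReal_mul (by positivity)]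
          refine ENNReal.ofReal_le_ofReal ((Ale x).trans_eq ?_)
          congr 4
          field_simp; ring
        _ = ENNReal.ofReal (2 * Real.exp 1 * (s * M)) := by
          rw [lintegral_const_mul _ (by fun_prop),
            lintegral_comp_affine (f := fun x => ENNReal.ofReal (Real.exp (-|x|)))
              (by fun_prop) _ (inv_pos.2 s0), lintegral_exp_neg_abs, inv_inv,
            show (2 : ENNReal) = ENNReal.ofReal 2 by simp, ← ENNReal.ofReal_mul s0.le,
            ← ENNReal.ofReal_mul (by positivity)]
          ring_nf
    simpa using this
  have e3 := Real.exp_one_lt_d9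
  have e1 := Real.exp_pos 1
  refine ⟨a, s, s0, ⟨by fun_prop, fun u => (mul_pos s0 (h0 _)).le, fun u => ?_, fun u u0 u1 => ?_,
    ?_, fun t => ?_⟩⟩
  · have h3 : |u| - 1 ≤ |(a + s * u - x0) / s| := by
      have hu : u = (a + s * u - x0) / s + (x0 - a) / s := by field_simp; ring
      have h4 : |(x0 - a) / s| ≤ 1 := by
        rw [abs_of_nonneg (div_nonneg (by linarith) s0.le), div_le_one s0]
        linarith
      have := abs_add_le ((a + s * u - x0) / s) ((x0 - a) / s)
      rw [← hu] at this
      linarith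
    calc s * A (a + s * u) ≤ s * (M * Real.exp 1 * Real.exp (-(|u| - 1))) := by
          refine mul_le_mul_of_nonneg_left ((Ale _).trans ?_) s0.le
          gcongr
      _ = (s * M) * (Real.exp 1 * Real.exp 1 * Real.exp (-|u|)) := by
          rw [neg_sub, sub_eq_add_neg, Real.exp_add]; ring
      _ ≤ Real.exp 1 * (Real.exp 1 * Real.exp 1 * Real.exp (-|u|)) := by gcongr
      _ = (Real.exp 1 * Real.exp 1 * Real.exp 1) * Real.exp (-|u|) := by ring
      _ ≤ (2.7182818286 * 2.7182818286 * 2.7182818286) * Real.exp (-|u|) := by gcongr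
      _ ≤ 21 * Real.exp (-|u|) := by
          gcongr; norm_num
  · have h5 : M * Real.exp (-1) ≤ A (a + s * u) := by
      rw [Aw (a + s * u)]
      gcongr
      refine win _ (by nlinarith) ?_
      have : s * u ≤ s := by nlinarith
      linarith
    have h6 : s * (M * Real.exp (-1)) ≤ s * A (a + s * u) := mul_le_mul_of_nonneg_left h5 s0.le
    refine le_trans ?_ h6
    rw [Real.exp_neg, ← mul_assoc, ← div_eq_mul_inv, div_le_div_iff₀ (by norm_num) e1]
    have h7 : 1 ≤ 2 * 2.7182818286 * (s * M) := sM2.trans (by gcongr)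
    norm_num at h7
    linarith
  · calc ∫⁻ u, ENNReal.ofReal (s * A (a + s * u)) = ∫⁻ u, (fun x => ENNReal.ofReal s *
        ENNReal.ofReal (A x)) (a + s * u) := by
          simp only [ENNReal.ofReal_mul s0.le]
      _ = 1 := by
        rw [lintegral_comp_affine (f := fun x => ENNReal.ofReal s * ENNReal.ofReal (A x))
          (by fun_prop) a s0, lintegral_const_mul _ (by fun_prop), h1,
          mul_one, ← ENNReal.ofReal_mul (by positivity), inv_mul_cancel₀ s0.ne', ENNReal.ofReal_one]
  · refine Convex.ordConnected ?_
    rw [convex_iff_forall_pos]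
    intro x hx y hy p q hp hq hpq
    obtain rfl : q = 1 - p := by linarith
    simp only [Set.mem_ofPred_eq] at hx hy ⊢
    rcases lt_or_ge t 0 with ht | ht
    · exact ht.trans (mul_pos s0 (h0 _))
    have h := hA (a + s * x) (a + s * y) p hp (by linarith)
    have e : p * (a + s * x) + (1 - p) * (a + s * y) = a + s * (p • x + (1 - p) • y) := by
      simp only [smul_eq_mul]; ring
    rw [e] at h
    have h8 : t / s < A (a + s * x) := by rw [div_lt_iff₀ s0]; linarith
    have h9 : t / s < A (a + s * y) := by rw [div_lt_iff₀ s0]; linarith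
    have ts : 0 ≤ t / s := by positivity
    have : t / s < A (a + s * (p • x + (1 - p) • y)) := by
      refine lt_of_lt_of_le ?_ h
      calc t / s = (t / s) ^ p * (t / s) ^ (1 - p) := by
            rw [← Real.rpow_add_of_nonneg ts hp.le hq.le]; simp
        _ < _ := mul_lt_mul'' (Real.rpow_lt_rpow ts h8 hp) (Real.rpow_lt_rpow ts h9 hq)
            (by positivity) (by positivity)
    rw [div_lt_iff₀ s0] at this
    linarith

/-- The two-sided exponential distribution. -/
noncomputable def laplaceMeasure : Measure ℝ :=
  volume.withDensity fun v => ENNReal.ofReal (Real.exp (-|v|) / 2)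

instance : IsProbabilityMeasure laplaceMeasure := by
  constructor
  rw [laplaceMeasure, withDensity_apply _ MeasurableSet.univ, Measure.restrict_univ]
  calc ∫⁻ v : ℝ, ENNReal.ofReal (Real.exp (-|v|) / 2)
      = ∫⁻ v : ℝ, ENNReal.ofReal (Real.exp (-|v|)) * ENNReal.ofReal (2⁻¹) := by
        congr 1; ext v; rw [← ENNReal.ofReal_mul (Real.exp_pos _).le]; rfl
    _ = 1 := by
        rw [lintegral_mul_const _ (by fun_prop), lintegral_exp_neg_abs,
          show (2 : ENNReal) = ENNReal.ofReal 2 by simp, ← ENNReal.ofReal_mul (by norm_num)]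
        norm_num

theorem convexPotential_abs_sub_div (x : ℝ) {τ : ℝ} (hτ : 0 < τ) :
    ConvexPotential fun y : ℝ => |x - y| / τ where
  continuous := by fun_prop
  nonneg y := by positivity
  convex y z l l0 l1 := by
    have l1' : 0 < 1 - l := by linarith
    rw [mul_div_assoc', mul_div_assoc', ← add_div]
    gcongr
    calc |x - (l • y + (1 - l) • z)| = |l * (x - y) + (1 - l) * (x - z)| := by
          simp only [smul_eq_mul]; ring_nf
      _ ≤ |l * (x - y)| + |(1 - l) * (x - z)| := abs_add_le _ _
      _ = _ := by rw [abs_mul, abs_mul, abs_of_pos l0, abs_of_pos l1']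

/-- A measure with the Prékopa-Leindler property becomes a rescaled unimodal density at unit scale
after convolution with a two-sided exponential distribution. -/
theorem IsPL.exists_isUnitDensity {η : Measure ℝ} [IsProbabilityMeasure η] (hη : IsPL η) {τ : ℝ}
    (hτ : 0 < τ) : ∃ a s : ℝ, ∃ ρ : ℝ → ℝ, 0 < s ∧ IsUnitDensity ρ ∧
      (η.prod laplaceMeasure).map (fun z => z.1 + τ * z.2) =
        (volume.withDensity fun u => ENNReal.ofReal (ρ u)).map fun u => a + s * u := by
  set A : ℝ → ℝ := fun x => (∫ y, Real.exp (-(|x - y| / τ)) ∂η) / (2 * τ) with hA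
  have bd : ∀ x y : ℝ, ‖Real.exp (-(|x - y| / τ))‖ ≤ 1 := fun x y => by
    rw [Real.norm_eq_abs, Real.abs_exp, Real.exp_le_one_iff, neg_nonpos]
    positivity
  have int : ∀ x, Integrable (fun y => Real.exp (-(|x - y| / τ))) η := fun x =>
    (integrable_const (1 : ℝ)).mono' (by fun_prop) (Filter.Eventually.of_forall (bd x))
  have A0 : ∀ x, 0 < A x := fun x => div_pos (integral_exp_pos (int x)) (by positivity)
  have Alin : ∀ x, ENNReal.ofReal (A x) =
      ∫⁻ y, ENNReal.ofReal (Real.exp (-(|x - y| / τ)) / (2 * τ)) ∂η := by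
    intro x
    simp only [hA]
    rw [← integral_div, ofReal_integral_eq_lintegral_ofReal ((int x).div_const _)]
    exact Filter.Eventually.of_forall fun y => by positivity
  have Ac : Continuous A := by
    refine Continuous.div_const ?_ _
    refine continuous_of_dominated (bound := fun _ => 1) (fun x => by fun_prop)
      (fun x => Filter.Eventually.of_forall (bd x)) (integrable_const _)
      (Filter.Eventually.of_forall fun y => by fun_prop)
  have Al : Filter.Tendsto A (Filter.cocompact ℝ) (nhds 0) := by
    have : Filter.Tendsto (fun x => ∫ y, Real.exp (-(|x - y| / τ)) ∂η) (Filter.cocompact ℝ)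
        (nhds (∫ y, (0 : ℝ) ∂η)) := by
      have : (Filter.cocompact ℝ).IsCountablyGenerated := by
        rw [cocompact_eq_atBot_atTop]
        infer_instance
      refine tendsto_integral_filter_of_dominated_convergence (fun _ => 1)
        (Filter.Eventually.of_forall fun x => by fun_prop)
        (Filter.Eventually.of_forall fun x => Filter.Eventually.of_forall (bd x))
        (integrable_const _) (Filter.Eventually.of_forall fun y => ?_)
      refine Real.tendsto_exp_neg_atTop_nhds_zero.comp ?_
      refine Filter.Tendsto.atTop_div_const hτ ?_
      have h1 : Filter.Tendsto (fun x : ℝ => ‖x‖ - ‖y‖) (Filter.cocompact ℝ) Filter.atTop :=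
        Filter.tendsto_atTop_add_const_right _ _ tendsto_norm_cocompact_atTop
      exact Filter.tendsto_atTop_mono (fun x => norm_sub_norm_le x y) h1
    simpa using this.div_const (2 * τ)
  have Alc : ∀ x y l : ℝ, 0 < l → l < 1 →
      A x ^ l * A y ^ (1 - l) ≤ A (l * x + (1 - l) * y) := by
    intro x y l l0 l1
    have l1' : 0 < 1 - l := by linarith
    have h := hη l l0 l1 _ _ _ (convexPotential_abs_sub_div x hτ) (convexPotential_abs_sub_div y hτ)
      (convexPotential_abs_sub_div (l * x + (1 - l) * y) hτ) (fun z w => by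
        rw [mul_div_assoc', mul_div_assoc', ← add_div]
        gcongr
        calc |l * x + (1 - l) * y - (l • z + (1 - l) • w)|
            = |l * (x - z) + (1 - l) * (y - w)| := by
              simp only [smul_eq_mul]; ring_nf
          _ ≤ |l * (x - z)| + |(1 - l) * (y - w)| := abs_add_le _ _
          _ = _ := by rw [abs_mul, abs_mul, abs_of_pos l0, abs_of_pos l1'])
    have e : ∀ x, ∫⁻ y, ENNReal.ofReal (Real.exp (-(|x - y| / τ))) ∂η =
        ENNReal.ofReal (2 * τ * A x) := by
      intro x
      rw [← ofReal_integral_eq_lintegral_ofReal (int x)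
        (Filter.Eventually.of_forall fun y => (Real.exp_pos _).le)]
      congr 1
      simp only [hA]
      field_simp
    rw [e, e, e, ENNReal.ofReal_rpow_of_nonneg (by have := A0 x; positivity) l0.le,
      ENNReal.ofReal_rpow_of_nonneg (by have := A0 y; positivity) l1'.le,
      ← ENNReal.ofReal_mul (by have := A0 x; positivity),
      ENNReal.ofReal_le_ofReal_iff (by have := A0 (l * x + (1 - l) * y); positivity),
      Real.mul_rpow (by positivity) (A0 x).le, Real.mul_rpow (by positivity) (A0 y).le,
      mul_mul_mul_comm, ← Real.rpow_add (by positivity)] at h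
    simp only [add_sub_cancel, Real.rpow_one] at h
    exact le_of_mul_le_mul_left h (by positivity)
  have conv : ∀ g : ℝ → ENNReal, Measurable g →
      ∫⁻ z, g (z.1 + τ * z.2) ∂(η.prod laplaceMeasure) = ∫⁻ x, ENNReal.ofReal (A x) * g x := by
    intro g hg
    rw [lintegral_prod _ (by fun_prop)]
    have h1 : ∀ y : ℝ, ∫⁻ v, g (y + τ * v) ∂laplaceMeasure =
        ∫⁻ x, ENNReal.ofReal (Real.exp (-(|x - y| / τ)) / (2 * τ)) * g x := by
      intro y
      rw [laplaceMeasure, lintegral_withDensity_eq_lintegral_mul _ (by fun_prop) (by fun_prop)]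
      have h2 := lintegral_comp_affine
        (f := fun x => ENNReal.ofReal (Real.exp (-(|x - y| / τ)) / 2) * g x) (by fun_prop) y hτ
      rw [← lintegral_const_mul _ (by fun_prop)] at h2
      convert h2 using 1
      · refine lintegral_congr fun v => ?_
        simp only [Pi.mul_apply, add_sub_cancel_left, abs_mul, abs_of_pos hτ]
        rw [mul_div_cancel_left₀ _ hτ.ne']
      · refine lintegral_congr fun v => ?_
        rw [← mul_assoc, ← ENNReal.ofReal_mul (by positivity)]
        congr 2
        field_simp
    simp only [h1]
    rw [lintegral_lintegral_swap (by fun_prop)]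
    refine lintegral_congr fun x => ?_
    rw [lintegral_mul_const _ (by fun_prop), Alin]
  have A1 : ∫⁻ x, ENNReal.ofReal (A x) = 1 := by
    have := conv (fun _ => 1) measurable_const
    simpa using this.symm
  obtain ⟨a, s, s0, hρ⟩ := _root_.exists_isUnitDensity Ac A0 Al Alc A1
  refine ⟨a, s, _, s0, hρ, Measure.ext_of_lintegral _ fun g hg => ?_⟩
  rw [lintegral_map hg (by fun_prop), lintegral_map hg (by fun_prop), conv g hg,
    lintegral_withDensity_eq_lintegral_mul _ (by fun_prop) (by fun_prop)]
  have h2 := lintegral_comp_affine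
        (f := fun x => ENNReal.ofReal s * (ENNReal.ofReal (A x) * g x)) (by fun_prop) a s0
  rw [lintegral_const_mul (ENNReal.ofReal s) (f := fun x => ENNReal.ofReal (A x) * g x)
    (by fun_prop), ← mul_assoc, ← ENNReal.ofReal_mul (by positivity), inv_mul_cancel₀ s0.ne', ENNReal.ofReal_one, one_mul] at h2
  rw [← h2]
  refine lintegral_congr fun u => ?_
  simp only [Pi.mul_apply]
  rw [ENNReal.ofReal_mul s0.le, mul_assoc]

/-- Integration by parts bound for oscillatory integrals whose phase has monotone derivative. -/
theorem norm_integral_exp_le_of_le_abs_deriv {p q q' : ℝ → ℝ} (hp : ∀ x, HasDerivAt p (q x) x)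
    (hq : ∀ x, HasDerivAt q (q' x) x) (hq' : Continuous q') {a b τ t : ℝ} (hab : a ≤ b)
    (hτ : 0 < τ) (ht : t ≠ 0) (hqτ : ∀ x ∈ Set.Icc a b, τ ≤ |q x|)
    (hs : (∀ x ∈ Set.Icc a b, 0 ≤ q' x) ∨ (∀ x ∈ Set.Icc a b, q' x ≤ 0)) :
    ‖∫ x in a..b, Complex.exp (Complex.I * t * p x)‖ ≤ 4 / (|t| * τ) := by
  have q0 : ∀ x ∈ Set.uIcc a b, q x ≠ 0 := fun x hx => by
    rw [Set.uIcc_of_le hab] at hx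
    exact abs_pos.1 (hτ.trans_le (hqτ x hx))
  have ht' : (t : ℂ) ≠ 0 := by exact_mod_cast ht
  have qc : Continuous q := continuous_iff_continuousAt.2 fun x => (hq x).continuousAt
  have pc : Continuous p := continuous_iff_continuousAt.2 fun x => (hp x).continuousAt
  have hv : ∀ x, HasDerivAt (fun x => Complex.exp (Complex.I * t * p x))
      (Complex.exp (Complex.I * t * p x) * (Complex.I * t * q x)) x := fun x =>
    ((hp x).ofReal_comp.const_mul _).cexp
  have hu : ∀ x ∈ Set.uIcc a b, HasDerivAt (fun x => (((q x)⁻¹ : ℝ) : ℂ))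
      ((-q' x / q x ^ 2 : ℝ) : ℂ) x := fun x hx => ((hq x).inv (q0 x hx)).ofReal_comp
  have ci : ContinuousOn (fun x => -q' x / q x ^ 2) (Set.uIcc a b) :=
    (hq'.neg.continuousOn).div (qc.pow 2).continuousOn fun x hx => pow_ne_zero 2 (q0 x hx)
  have parts := intervalIntegral.integral_mul_deriv_eq_deriv_mul hu
    (fun x _ => hv x) (Complex.continuous_ofReal.comp_continuousOn ci).intervalIntegrable
    (by apply Continuous.intervalIntegrable; fun_prop)
  have e : ∫ x in a..b, Complex.exp (Complex.I * t * p x) = (Complex.I * t)⁻¹ *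
      ∫ x in a..b, (((q x)⁻¹ : ℝ) : ℂ) *
        (Complex.exp (Complex.I * t * p x) * (Complex.I * t * q x)) := by
    rw [← intervalIntegral.integral_const_mul]
    refine intervalIntegral.integral_congr fun x hx => ?_
    have : (q x : ℂ) ≠ 0 := by exact_mod_cast q0 x hx
    push_cast
    field_simp [Complex.I_ne_zero]
  have ne : ∀ x, ‖Complex.exp (Complex.I * t * p x)‖ = 1 := fun x => by
    rw [show Complex.I * t * p x = ((t * p x : ℝ) : ℂ) * Complex.I by push_cast; ring]
    exact Complex.norm_exp_ofReal_mul_I _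
  have iq : ∀ x ∈ Set.Icc a b, |(q x)⁻¹| ≤ 1 / τ := fun x hx => by
    rw [abs_inv, ← one_div]
    exact one_div_le_one_div_of_le hτ (hqτ x hx)
  have int3 : ‖∫ x in a..b, ((-q' x / q x ^ 2 : ℝ) : ℂ) * Complex.exp (Complex.I * t * p x)‖
      ≤ 2 / τ := by
    refine (intervalIntegral.norm_integral_le_integral_norm hab).trans ?_
    have ftc : ∫ x in a..b, -q' x / q x ^ 2 = (q b)⁻¹ - (q a)⁻¹ :=
      intervalIntegral.integral_eq_sub_of_hasDerivAt (fun x hx => (hq x).inv (q0 x hx))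
        ci.intervalIntegrable
    have hb := abs_le.1 (iq b ⟨hab, le_rfl⟩)
    have ha := abs_le.1 (iq a ⟨le_rfl, hab⟩)
    rcases hs with hs | hs
    · have : ∫ x in a..b, ‖((-q' x / q x ^ 2 : ℝ) : ℂ) * Complex.exp (Complex.I * t * p x)‖ =
          -∫ x in a..b, -q' x / q x ^ 2 := by
        rw [← intervalIntegral.integral_neg]
        refine intervalIntegral.integral_congr fun x hx => ?_
        rw [Set.uIcc_of_le hab] at hx
        simp only [norm_mul, ne, mul_one, Complex.norm_real, Real.norm_eq_abs]
        rw [neg_div, abs_neg, neg_neg, abs_of_nonneg (div_nonneg (hs x hx) (by positivity))]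
      rw [this, ftc]
      have : 2 / τ = 1 / τ + 1 / τ := by ring
      linarith
    · have : ∫ x in a..b, ‖((-q' x / q x ^ 2 : ℝ) : ℂ) * Complex.exp (Complex.I * t * p x)‖ =
          ∫ x in a..b, -q' x / q x ^ 2 := by
        refine intervalIntegral.integral_congr fun x hx => ?_
        rw [Set.uIcc_of_le hab] at hx
        simp only [norm_mul, ne, mul_one, Complex.norm_real, Real.norm_eq_abs]
        rw [abs_of_nonneg (div_nonneg (neg_nonneg.2 (hs x hx)) (by positivity))]
      rw [this, ftc]
      have : 2 / τ = 1 / τ + 1 / τ := by ring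
      linarith
  rw [e, norm_mul, norm_inv, norm_mul, Complex.norm_I, one_mul, Complex.norm_real,
    Real.norm_eq_abs, parts]
  have t0 : 0 < |t| := abs_pos.2 ht
  rw [inv_mul_le_iff₀ t0]
  have e4 : |t| * (4 / (|t| * τ)) = 1 / τ + 1 / τ + 2 / τ := by
    field_simp; norm_num
  rw [e4]
  refine (norm_sub_le _ _).trans (add_le_add ((norm_sub_le _ _).trans (add_le_add ?_ ?_)) int3)
  · rw [norm_mul, ne, mul_one, Complex.norm_real]
    exact iq b ⟨hab, le_rfl⟩
  · rw [norm_mul, ne, mul_one, Complex.norm_real]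
    exact iq a ⟨le_rfl, hab⟩

theorem norm_setIntegral_exp_le_of_lt_abs_deriv {p q q' : ℝ → ℝ}
    (hp : ∀ x, HasDerivAt p (q x) x) (hq : ∀ x, HasDerivAt q (q' x) x) (hq' : Continuous q')
    {I : Set ℝ} (hI : I.OrdConnected) (hb : Bornology.IsBounded I) {τ t : ℝ}
    (hτ : 0 < τ) (ht : t ≠ 0) (hqτ : ∀ x ∈ I, τ ≤ |q x|)
    (hs : (∀ x ∈ I, 0 ≤ q' x) ∨ (∀ x ∈ I, q' x ≤ 0)) :
    ‖∫ x in I, Complex.exp (Complex.I * t * p x)‖ ≤ 4 / (|t| * τ) := by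
  have t0 : 0 < |t| := abs_pos.2 ht
  rcases I.eq_empty_or_nonempty with rfl | hne
  · simp only [Measure.restrict_empty, integral_zero_measure, norm_zero]
    positivity
  have hB := hb.bddBelow
  have hA := hb.bddAbove
  set a := sInf I
  set b := sSup I
  have h1 : I ⊆ Set.Icc a b := fun x hx => ⟨csInf_le hB hx, le_csSup hA hx⟩
  have h2 : Set.Ioo a b ⊆ I := by
    intro x hx
    obtain ⟨y, hy, hyx⟩ := exists_lt_of_csInf_lt hne hx.1
    obtain ⟨z, hz, hxz⟩ := exists_lt_of_lt_csSup hne hx.2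
    exact hI.out hy hz ⟨hyx.le, hxz.le⟩
  have hab : a ≤ b := by
    obtain ⟨x, hx⟩ := hne
    exact (h1 hx).1.trans (h1 hx).2
  have hae : I =ᵐ[volume] Set.Ioc a b := by
    refine Filter.EventuallyLE.antisymm ?_ ?_
    · exact (LE.le.eventuallyLE h1).trans Ioc_ae_eq_Icc.symm.le
    · exact Ioo_ae_eq_Ioc.symm.le.trans (LE.le.eventuallyLE h2)
  rw [setIntegral_congr_set hae, ← intervalIntegral.integral_of_le hab]
  rcases eq_or_lt_of_le hab with hab' | hab'
  · rw [hab', intervalIntegral.integral_same, norm_zero]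
    positivity
  have qc : Continuous q := continuous_iff_continuousAt.2 fun x => (hq x).continuousAt
  have cl : ∀ S : Set ℝ, IsClosed S → (∀ x ∈ I, x ∈ S) → ∀ x ∈ Set.Icc a b, x ∈ S := by
    intro S hS h x hx
    rw [← closure_Ioo hab'.ne] at hx
    exact closure_minimal (fun y hy => h y (h2 hy)) hS hx
  refine norm_integral_exp_le_of_le_abs_deriv hp hq hq' hab hτ ht
    (cl _ (isClosed_le continuous_const qc.abs) hqτ) ?_
  rcases hs with hs | hs
  · exact Or.inl (cl _ (isClosed_le continuous_const hq') hs)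
  · exact Or.inr (cl _ (isClosed_le hq' continuous_const) hs)

theorem norm_exp_I_mul (t x : ℝ) : ‖Complex.exp (Complex.I * t * x)‖ = 1 := by
  rw [show Complex.I * t * x = ((t * x : ℝ) : ℂ) * Complex.I by push_cast; ring]
  exact Complex.norm_exp_ofReal_mul_I _

/-- Van der Corput type bound for cubic phases on an interval. -/
theorem norm_setIntegral_exp_cubic_le (r0 r1 r2 r3 : ℝ) {J : Set ℝ} (hJ : J.OrdConnected)
    (hb : Bornology.IsBounded J) {τ t : ℝ} (hτ : 0 < τ) (ht : t ≠ 0) :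
    ‖∫ x in J, Complex.exp (Complex.I * t * ((r0 + r1 * x + r2 * x ^ 2 + r3 * x ^ 3 : ℝ) : ℂ))‖ ≤
      volume.real (J ∩ {x | |r1 + 2 * r2 * x + 3 * r3 * x ^ 2| ≤ τ}) + 16 / (|t| * τ) := by
  set p : ℝ → ℝ := fun x => r0 + r1 * x + r2 * x ^ 2 + r3 * x ^ 3 with hp
  set q : ℝ → ℝ := fun x => r1 + 2 * r2 * x + 3 * r3 * x ^ 2 with hq
  set q' : ℝ → ℝ := fun x => 2 * r2 + 6 * r3 * x with hq'
  have dp : ∀ x, HasDerivAt p (q x) x := fun x => by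
    have := ((((hasDerivAt_id x).const_mul r1).const_add r0).add
      (((hasDerivAt_id x).pow 2).const_mul r2)).add (((hasDerivAt_id x).pow 3).const_mul r3)
    exact this.congr_deriv (by simp only [hq, id, Nat.cast_ofNat]; ring)
  have dq : ∀ x, HasDerivAt q (q' x) x := fun x => by
    have := (((hasDerivAt_id x).const_mul (2 * r2)).const_add r1).add
      (((hasDerivAt_id x).pow 2).const_mul (3 * r3))
    exact this.congr_deriv (by simp only [hq', id, Nat.cast_ofNat]; ring)
  have cq' : Continuous q' := by fun_prop
  have cq : Continuous q := by fun_prop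
  have cp : Continuous p := by fun_prop
  have mE : MeasurableSet {x | |q x| ≤ τ} := measurableSet_le (by fun_prop) measurable_const
  have mP : MeasurableSet {x | τ < q x} := measurableSet_lt measurable_const (by fun_prop)
  have mD : MeasurableSet {x | 0 ≤ q' x} := measurableSet_le measurable_const (by fun_prop)
  have mJ : MeasurableSet J := hJ.measurableSet
  have Jfin : volume J < ⊤ := hb.measure_lt_top
  set F : ℝ → ℂ := fun x => Complex.exp (Complex.I * t * (p x : ℂ)) with hF
  have Fi : IntegrableOn F J := by
    refine IntegrableOn.of_bound Jfin (by fun_prop) 1 (Filter.Eventually.of_forall fun x => ?_)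
    exact (norm_exp_I_mul t (p x)).le
  have qd : ∀ x y, q y - q x = (y - x) * (q' x + q' y) / 2 := fun x y => by
    simp only [hq, hq']; ring
  have pos_conn : ∀ x y z, x ≤ y → y ≤ z → 0 ≤ q' x → 0 ≤ q' z → 0 ≤ q' y := by
    intro x y z hxy hyz h1 h2
    simp only [hq'] at *
    rcases le_or_gt 0 r3 with h | h <;> nlinarith
  have neg_conn : ∀ x y z, x ≤ y → y ≤ z → q' x < 0 → q' z < 0 → q' y < 0 := by
    intro x y z hxy hyz h1 h2
    simp only [hq'] at *
    rcases le_or_gt 0 r3 with h | h <;> nlinarith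
  have mono : ∀ x y, x ≤ y → 0 ≤ q' x → 0 ≤ q' y → q x ≤ q y := fun x y hxy h1 h2 => by
    have := qd x y
    have := mul_nonneg (sub_nonneg.2 hxy) (add_nonneg h1 h2)
    linarith
  have anti : ∀ x y, x ≤ y → q' x < 0 → q' y < 0 → q y ≤ q x := fun x y hxy h1 h2 => by
    have := qd x y
    have := mul_nonneg (sub_nonneg.2 hxy) (add_nonneg (neg_nonneg.2 h1.le) (neg_nonneg.2 h2.le))
    linarith
  have s1 := integral_inter_add_sdiff mE Fi
  have s2 := integral_inter_add_sdiff mP (Fi.mono_set Set.sdiff_subset : IntegrableOn F (J \ {x | |q x| ≤ τ}))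
  have s3 := integral_inter_add_sdiff mD (Fi.mono_set (Set.inter_subset_left.trans Set.sdiff_subset) :
    IntegrableOn F ((J \ {x | |q x| ≤ τ}) ∩ {x | τ < q x}))
  have s4 := integral_inter_add_sdiff mD (Fi.mono_set (Set.sdiff_subset.trans Set.sdiff_subset) :
    IntegrableOn F ((J \ {x | |q x| ≤ τ}) \ {x | τ < q x}))
  have negq : ∀ x, ¬ |q x| ≤ τ → ¬ τ < q x → q x < -τ := by
    intro x h1 h2
    by_contra h3
    exact h1 (abs_le.2 ⟨not_lt.1 h3, not_lt.1 h2⟩)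
  have b1 : ‖∫ x in (J \ {x | |q x| ≤ τ}) ∩ {x | τ < q x} ∩ {x | 0 ≤ q' x}, F x‖ ≤
      4 / (|t| * τ) := by
    refine norm_setIntegral_exp_le_of_lt_abs_deriv dp dq cq' ⟨?_⟩
      (hb.subset fun x hx => hx.1.1.1) hτ ht (fun x hx => (not_le.1 hx.1.1.2).le)
      (Or.inl fun x hx => hx.2)
    rintro x ⟨⟨⟨hx1, -⟩, hx3⟩, hx4⟩ z ⟨⟨⟨hz1, -⟩, hz3⟩, hz4⟩ y ⟨hxy, hyz⟩
    have h4 := pos_conn x y z hxy hyz hx4 hz4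
    have h3 : τ < q y := lt_of_lt_of_le hx3 (mono x y hxy hx4 h4)
    exact ⟨⟨⟨hJ.out hx1 hz1 ⟨hxy, hyz⟩, fun h => h3.not_ge ((le_abs_self _).trans h)⟩, h3⟩, h4⟩
  have b2 : ‖∫ x in ((J \ {x | |q x| ≤ τ}) ∩ {x | τ < q x}) \ {x | 0 ≤ q' x}, F x‖ ≤
      4 / (|t| * τ) := by
    refine norm_setIntegral_exp_le_of_lt_abs_deriv dp dq cq' ⟨?_⟩
      (hb.subset fun x hx => hx.1.1.1) hτ ht (fun x hx => (not_le.1 hx.1.1.2).le)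
      (Or.inr fun x hx => (not_le.1 hx.2).le)
    rintro x ⟨⟨⟨hx1, -⟩, hx3⟩, hx4⟩ z ⟨⟨⟨hz1, -⟩, hz3⟩, hz4⟩ y ⟨hxy, hyz⟩
    have h4 := neg_conn x y z hxy hyz (not_le.1 hx4) (not_le.1 hz4)
    have h3 : τ < q y := lt_of_lt_of_le hz3 (anti y z hyz h4 (not_le.1 hz4))
    exact ⟨⟨⟨hJ.out hx1 hz1 ⟨hxy, hyz⟩, fun h => h3.not_ge ((le_abs_self _).trans h)⟩, h3⟩,
      not_le.2 h4⟩
  have b3 : ‖∫ x in ((J \ {x | |q x| ≤ τ}) \ {x | τ < q x}) ∩ {x | 0 ≤ q' x}, F x‖ ≤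
      4 / (|t| * τ) := by
    refine norm_setIntegral_exp_le_of_lt_abs_deriv dp dq cq' ⟨?_⟩
      (hb.subset fun x hx => hx.1.1.1) hτ ht (fun x hx => (not_le.1 hx.1.1.2).le)
      (Or.inl fun x hx => hx.2)
    rintro x ⟨⟨⟨hx1, -⟩, hx3⟩, hx4⟩ z ⟨⟨⟨hz1, hz2⟩, hz3⟩, hz4⟩ y ⟨hxy, hyz⟩
    have h4 := pos_conn x y z hxy hyz hx4 hz4
    have h3 : q y < -τ := lt_of_le_of_lt (mono y z hyz h4 hz4) (negq z hz2 hz3)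
    refine ⟨⟨⟨hJ.out hx1 hz1 ⟨hxy, hyz⟩, fun h => ?_⟩, fun h => ?_⟩, h4⟩
    · have := (abs_le.1 (show |q y| ≤ τ from h)).1
      linarith
    · have : τ < q y := h
      linarith
  have b4 : ‖∫ x in ((J \ {x | |q x| ≤ τ}) \ {x | τ < q x}) \ {x | 0 ≤ q' x}, F x‖ ≤
      4 / (|t| * τ) := by
    refine norm_setIntegral_exp_le_of_lt_abs_deriv dp dq cq' ⟨?_⟩
      (hb.subset fun x hx => hx.1.1.1) hτ ht (fun x hx => (not_le.1 hx.1.1.2).le)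
      (Or.inr fun x hx => (not_le.1 hx.2).le)
    rintro x ⟨⟨⟨hx1, hx2⟩, hx3⟩, hx4⟩ z ⟨⟨⟨hz1, -⟩, hz3⟩, hz4⟩ y ⟨hxy, hyz⟩
    have h4 := neg_conn x y z hxy hyz (not_le.1 hx4) (not_le.1 hz4)
    have h3 : q y < -τ := lt_of_le_of_lt (anti x y hxy (not_le.1 hx4) h4) (negq x hx2 hx3)
    refine ⟨⟨⟨hJ.out hx1 hz1 ⟨hxy, hyz⟩, fun h => ?_⟩, fun h => ?_⟩, not_le.2 h4⟩
    · have := (abs_le.1 (show |q y| ≤ τ from h)).1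
      linarith
    · have : τ < q y := h
      linarith
  have b0 : ‖∫ x in J ∩ {x | |q x| ≤ τ}, F x‖ ≤ volume.real (J ∩ {x | |q x| ≤ τ}) := by
    have := norm_setIntegral_le_of_norm_le_const (f := F) (C := 1)
      ((measure_mono Set.inter_subset_left).trans_lt Jfin : volume (J ∩ {x | |q x| ≤ τ}) < ⊤)
      (fun x _ => (norm_exp_I_mul t (p x)).le)
    simpa using this
  rw [← s1, ← s2, ← s3, ← s4]
  have e : 16 / (|t| * τ) = 4 / (|t| * τ) + 4 / (|t| * τ) + (4 / (|t| * τ) + 4 / (|t| * τ)) := by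
    ring
  rw [e]
  exact (norm_add_le _ _).trans (add_le_add b0 ((norm_add_le _ _).trans (add_le_add
    ((norm_add_le _ _).trans (add_le_add b1 b2)) ((norm_add_le _ _).trans (add_le_add b3 b4)))))

theorem laplaceMeasure_ball_le (x : ℝ) {δ : ℝ} (h1 : δ ≤ 1 / 2) :
    laplaceMeasure (Metric.ball x (δ * (1 + |x|))) ≤ ENNReal.ofReal (2 * δ) := by
  rw [laplaceMeasure, withDensity_apply _ Metric.isOpen_ball.measurableSet]
  have hx : 0 < 1 + |x| := by positivity
  calc ∫⁻ v in Metric.ball x (δ * (1 + |x|)), ENNReal.ofReal (Real.exp (-|v|) / 2)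
      ≤ ∫⁻ v in Metric.ball x (δ * (1 + |x|)), ENNReal.ofReal (1 / (1 + |x|)) := by
        refine setLIntegral_mono' Metric.isOpen_ball.measurableSet fun v hv => ?_
        apply ENNReal.ofReal_le_ofReal
        rw [Metric.mem_ball, Real.dist_eq] at hv
        have h2 : |x| - |v| ≤ (1 + |x|) / 2 := by
          have h3 := abs_sub_abs_le_abs_sub x v
          rw [abs_sub_comm] at h3
          nlinarith
        have h4 := Real.add_one_le_exp |v|
        have h5 := Real.add_one_le_exp ((|x| - 1) / 2)
        have h6 : Real.exp ((|x| - 1) / 2) ≤ Real.exp |v| := Real.exp_le_exp.2 (by linarith)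
        rw [Real.exp_neg, div_le_div_iff₀ (by norm_num) hx, one_mul,
          inv_mul_le_iff₀ (Real.exp_pos _)]
        linarith
    _ = ENNReal.ofReal (2 * δ) := by
        rw [setLIntegral_const, Real.volume_ball, ← ENNReal.ofReal_mul (by positivity)]
        congr 1
        field_simp

theorem abs_coeff_le_of_lagrange {q0 q1 q2 τ κ : ℝ} {x : Fin 3 → ℝ} (hκ : 0 < κ)
    (hx : ∀ i, |q0 + q1 * x i + q2 * x i ^ 2| ≤ τ)
    (hsep : ∀ i j, i ≠ j → κ * (1 + |x j|) ≤ |x i - x j|) :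
    κ ^ 2 * (|q0| + |q1| + |q2|) ≤ 3 * τ := by
  have key : ∀ i j k, i ≠ j → i ≠ k → ∃ w : ℝ,
      w * ((x i - x j) * (x i - x k)) = q0 + q1 * x i + q2 * x i ^ 2 ∧
      κ ^ 2 * (|w * (x j * x k)| + |w * (-(x j + x k))| + |w|) ≤ τ := by
    intro i j k hij hik
    have h1 := hsep i j hij
    have h2 := hsep i k hik
    have p1 : 0 < κ * (1 + |x j|) := by positivity
    have p2 : 0 < κ * (1 + |x k|) := by positivity
    have n1 : x i - x j ≠ 0 := abs_pos.1 (p1.trans_le h1)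
    have n2 : x i - x k ≠ 0 := abs_pos.1 (p2.trans_le h2)
    refine ⟨(q0 + q1 * x i + q2 * x i ^ 2) / ((x i - x j) * (x i - x k)), ?_, ?_⟩
    · field_simp
    set w := (q0 + q1 * x i + q2 * x i ^ 2) / ((x i - x j) * (x i - x k)) with hw
    have hw2 : |w| * (|x i - x j| * |x i - x k|) ≤ τ := by
      rw [hw, abs_div, abs_mul, div_mul_cancel₀]
      · exact hx i
      · positivity
    calc κ ^ 2 * (|w * (x j * x k)| + |w * (-(x j + x k))| + |w|)
        ≤ κ ^ 2 * (|w| * (|x j| * |x k|) + |w| * (|x j| + |x k|) + |w|) := by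
          rw [abs_mul, abs_mul, abs_mul, abs_neg]
          gcongr
          exact abs_add_le _ _
      _ = |w| * ((κ * (1 + |x j|)) * (κ * (1 + |x k|))) := by ring
      _ ≤ |w| * (|x i - x j| * |x i - x k|) := by gcongr
      _ ≤ τ := hw2
  obtain ⟨a, ha, ha'⟩ := key 0 1 2 (by decide) (by decide)
  obtain ⟨b, hb, hb'⟩ := key 1 0 2 (by decide) (by decide)
  obtain ⟨c, hc, hc'⟩ := key 2 0 1 (by decide) (by decide)
  have n01 : x 0 - x 1 ≠ 0 := abs_pos.1 ((by positivity : 0 < κ * (1 + |x 1|)).trans_le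
    (hsep 0 1 (by decide)))
  have n02 : x 0 - x 2 ≠ 0 := abs_pos.1 ((by positivity : 0 < κ * (1 + |x 2|)).trans_le
    (hsep 0 2 (by decide)))
  have n12 : x 1 - x 2 ≠ 0 := abs_pos.1 ((by positivity : 0 < κ * (1 + |x 2|)).trans_le
    (hsep 1 2 (by decide)))
  generalize x 0 = u at *
  generalize x 1 = v at *
  generalize x 2 = z at *
  have nz : (u - v) * (u - z) * (v - z) ≠ 0 := by positivity
  have ea : a = (q0 + q1 * u + q2 * u ^ 2) / ((u - v) * (u - z)) := by
    rw [← ha]; field_simp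
  have eb : b = -(q0 + q1 * v + q2 * v ^ 2) / ((u - v) * (v - z)) := by
    rw [← hb]; field_simp; ring
  have ec : c = (q0 + q1 * z + q2 * z ^ 2) / ((u - z) * (v - z)) := by
    rw [← hc]; field_simp; ring
  have e2 : q2 = a + b + c := by
    rw [ea, eb, ec]; field_simp; ring
  have e1 : q1 = a * (-(v + z)) + b * (-(u + z)) + c * (-(u + v)) := by
    rw [ea, eb, ec]; field_simp; ring
  have e0 : q0 = a * (v * z) + b * (u * z) + c * (u * v) := by
    rw [ea, eb, ec]; field_simp; ring
  have h0 : |q0| ≤ |a * (v * z)| + |b * (u * z)| + |c * (u * v)| := by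
    rw [e0]; exact abs_add_three _ _ _
  have h1 : |q1| ≤ |a * (-(v + z))| + |b * (-(u + z))| + |c * (-(u + v))| := by
    rw [e1]; exact abs_add_three _ _ _
  have h2 : |q2| ≤ |a| + |b| + |c| := by
    rw [e2]; exact abs_add_three _ _ _
  nlinarith [mul_le_mul_of_nonneg_left (add_le_add (add_le_add h0 h1) h2) (sq_nonneg κ)]

/-- Sublevel set estimate for quadratic polynomials. -/
theorem laplaceMeasure_sublevel_le (q0 q1 q2 τ : ℝ) (hτ : 0 ≤ τ) :
    laplaceMeasure.real {x | |q0 + q1 * x + q2 * x ^ 2| ≤ τ} ^ 2 * (|q0| + |q1| + |q2|) ≤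
      300 * τ := by
  set E := {x : ℝ | |q0 + q1 * x + q2 * x ^ 2| ≤ τ} with hE
  set w := laplaceMeasure.real E with hw
  rcases eq_or_lt_of_le (measureReal_nonneg : 0 ≤ w) with h0 | h0
  · have h0' : w = 0 := h0.symm
    rw [h0']
    simpa using hτ
  have w1 : w ≤ 1 := measureReal_le_one
  set δ := w / 5 with hδ
  have d0 : 0 < δ := by positivity
  set B : ℝ → Set ℝ := fun x => Metric.ball x (δ * (1 + |x|)) with hB
  have hball : ∀ x, laplaceMeasure.real (B x) ≤ 2 * δ := fun x =>
    ENNReal.toReal_le_of_le_ofReal (by positivity)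
      (laplaceMeasure_ball_le x (by linarith))
  have ex : ∀ S : Set ℝ, laplaceMeasure.real S < w → ∃ x ∈ E, x ∉ S := by
    intro S hS
    by_contra h
    push Not at h
    exact hS.not_ge (measureReal_mono h)
  obtain ⟨x1, h1, -⟩ := ex ∅ (by simpa using h0)
  obtain ⟨x2, h2, h21⟩ := ex (B x1) ((hball x1).trans_lt (by linarith))
  obtain ⟨x3, h3, h31⟩ := ex (B x1 ∪ B x2) ((measureReal_union_le _ _).trans_lt
    ((add_le_add (hball x1) (hball x2)).trans_lt (by linarith)))
  have sep : ∀ x y, y ∉ B x → (δ / 2) * (1 + |x|) ≤ |y - x| ∧ (δ / 2) * (1 + |y|) ≤ |x - y| := by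
    intro x y h
    have h4 : δ * (1 + |x|) ≤ |y - x| := by simpa [hB, Real.dist_eq] using h
    have h5 : 0 ≤ δ * (1 + |x|) := by positivity
    refine ⟨by linarith, ?_⟩
    have h6 := abs_sub_abs_le_abs_sub y x
    rw [abs_sub_comm x y]
    have d1 : δ ≤ 1 := by linarith
    nlinarith [abs_nonneg (y - x)]
  have := abs_coeff_le_of_lagrange (q0 := q0) (q1 := q1) (q2 := q2) (τ := τ) (κ := δ / 2)
    (x := ![x1, x2, x3]) (by positivity) (by
      intro i; fin_cases i
      · exact h1
      · exact h2
      · exact h3) (by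
      have h31' := fun h => h31 (Or.inl h)
      have h32' := fun h => h31 (Or.inr h)
      intro i j hij
      fin_cases i <;> fin_cases j <;> first | exact absurd rfl hij | skip
      · exact (sep _ _ h21).2
      · exact (sep _ _ h31').2
      · exact (sep _ _ h21).1
      · exact (sep _ _ h32').2
      · exact (sep _ _ h31').1
      · exact (sep _ _ h32').1)
  rw [hδ] at this
  linarith

/-- Layer cake decomposition along the superlevel sets of a unimodal density. -/
theorem IsUnitDensity.layer_cake {V : Type*} [NormedAddCommGroup V] [NormedSpace ℝ V]
    [CompleteSpace V] {ρ : ℝ → ℝ} (hρ : IsUnitDensity ρ) {F : ℝ → V} (hF : StronglyMeasurable F)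
    (h1 : ∀ u, ‖F u‖ ≤ 1) :
    IntegrableOn (fun s => ∫ u in {u | s < ρ u}, F u) (Set.Ioi 0) ∧
      ∫ s in Set.Ioi 0, ∫ u in {u | s < ρ u}, F u = ∫ u, ρ u • F u := by
  have mρ := hρ.measurable
  set R : Set (ℝ × ℝ) := {z | 0 < z.2 ∧ z.2 < ρ z.1} with hR
  have mR : MeasurableSet R := (measurableSet_lt measurable_const measurable_snd).inter
    (measurableSet_lt measurable_snd (mρ.comp measurable_fst))
  have vR : (volume.prod volume) R = 1 := by
    have h := volume_regionBetween_eq_lintegral (μ := volume) (f := fun _ : ℝ => (0 : ℝ)) (g := ρ)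
      measurable_const.aemeasurable mρ.aemeasurable MeasurableSet.univ
    simp only [Measure.restrict_univ, Pi.sub_apply, sub_zero, hρ.lintegral_eq] at h
    rw [← h]
    congr 1
    ext z
    simp [hR, regionBetween]
  have int : Integrable (R.indicator fun z => F z.1) (volume.prod volume) := by
    rw [integrable_indicator_iff mR]
    refine IntegrableOn.of_bound (by rw [vR]; simp)
      (hF.comp_measurable measurable_fst).aestronglyMeasurable 1
      (Filter.Eventually.of_forall fun z => h1 _)
  have i1 : ∀ u, ∫ s, R.indicator (fun z => F z.1) (u, s) = ρ u • F u := by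
    intro u
    have : ∀ s, R.indicator (fun z => F z.1) (u, s) =
        (Set.Ioo 0 (ρ u)).indicator (fun _ => F u) s := by
      intro s
      simp only [Set.indicator, hR]
      rfl
    simp only [this]
    rw [integral_indicator_const _ measurableSet_Ioo, Real.volume_real_Ioo_of_le (hρ.nonneg u),
      sub_zero]
  have i2 : ∀ s, ∫ u, R.indicator (fun z => F z.1) (u, s) =
      (Set.Ioi 0).indicator (fun s => ∫ u in {u | s < ρ u}, F u) s := by
    intro s
    by_cases hs : 0 < s
    · rw [Set.indicator_of_mem (by exact hs),
        ← integral_indicator (measurableSet_lt measurable_const mρ)]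
      congr 1
      ext u
      simp only [Set.indicator, hR, Set.mem_ofPred_eq, hs, true_and]
    · rw [Set.indicator_of_notMem (by exact hs), ← integral_zero ℝ V]
      congr 1
      ext u
      exact Set.indicator_of_notMem (fun h => hs h.1) _
  constructor
  · rw [← integrable_indicator_iff measurableSet_Ioi]
    have := int.integral_prod_right
    simpa only [i2] using this
  · rw [← integral_indicator measurableSet_Ioi]
    have e := integral_integral_swap (f := fun u s => R.indicator (fun z => F z.1) (u, s)) int
    simp only [i1, i2] at e
    exact e.symm

theorem integral_mul_cubic (q0 q1 q2 q3 r0 r1 r2 r3 : ℝ) :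
    ∫ x in (0 : ℝ)..1, (q0 + q1 * x + q2 * x ^ 2 + q3 * x ^ 3) *
      (r0 + r1 * x + r2 * x ^ 2 + r3 * x ^ 3) =
      q0 * (r0 + r1 / 2 + r2 / 3 + r3 / 4) + q1 * (r0 / 2 + r1 / 3 + r2 / 4 + r3 / 5) +
      q2 * (r0 / 3 + r1 / 4 + r2 / 5 + r3 / 6) + q3 * (r0 / 4 + r1 / 5 + r2 / 6 + r3 / 7) := by
  have h : ∀ x ∈ Set.uIcc (0 : ℝ) 1, HasDerivAt (fun x : ℝ =>
      q0 * (r0 * x + r1 * (x ^ 2 / 2) + r2 * (x ^ 3 / 3) + r3 * (x ^ 4 / 4)) +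
      q1 * (r0 * (x ^ 2 / 2) + r1 * (x ^ 3 / 3) + r2 * (x ^ 4 / 4) + r3 * (x ^ 5 / 5)) +
      q2 * (r0 * (x ^ 3 / 3) + r1 * (x ^ 4 / 4) + r2 * (x ^ 5 / 5) + r3 * (x ^ 6 / 6)) +
      q3 * (r0 * (x ^ 4 / 4) + r1 * (x ^ 5 / 5) + r2 * (x ^ 6 / 6) + r3 * (x ^ 7 / 7)))
      ((q0 + q1 * x + q2 * x ^ 2 + q3 * x ^ 3) * (r0 + r1 * x + r2 * x ^ 2 + r3 * x ^ 3)) x := by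
    intro x _
    have p : ∀ n : ℕ, HasDerivAt (fun x : ℝ => x ^ (n + 1) / ((n : ℝ) + 1)) (x ^ n) x := by
      intro n
      have := (hasDerivAt_pow (n + 1) x).div_const ((n : ℝ) + 1)
      rw [Nat.add_sub_cancel, Nat.cast_add_one,
        mul_div_cancel_left₀ _ (by positivity : (n : ℝ) + 1 ≠ 0)] at this
      exact this
    have p0 := hasDerivAt_id' x
    have p1 := p 1
    have p2 := p 2
    have p3 := p 3
    have p4 := p 4
    have p5 := p 5
    have p6 := p 6
    norm_num at p1 p2 p3 p4 p5 p6
    have c : ∀ {a b c d : ℝ → ℝ} {a' b' c' d' : ℝ}, HasDerivAt a a' x → HasDerivAt b b' x →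
        HasDerivAt c c' x → HasDerivAt d d' x → ∀ q : ℝ, HasDerivAt (fun x => q * (r0 * a x +
          r1 * b x + r2 * c x + r3 * d x)) (q * (r0 * a' + r1 * b' + r2 * c' + r3 * d')) x :=
      fun ha hb hc hd q => ((((ha.const_mul r0).add (hb.const_mul r1)).add
        (hc.const_mul r2)).add (hd.const_mul r3)).const_mul q
    refine ((((c p0 p1 p2 p3 q0).add (c p1 p2 p3 p4 q1)).add (c p2 p3 p4 p5 q2)).add
      (c p3 p4 p5 p6 q3)).congr_deriv ?_
    ring
  rw [intervalIntegral.integral_eq_sub_of_hasDerivAt h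
    (Continuous.intervalIntegrable (by fun_prop) _ _)]
  ring

theorem abs_dual_cubic_le (q0 q1 q2 q3 r0 r1 r2 r3 : ℝ) :
    |∫ x in (0 : ℝ)..1, (q0 + q1 * x + q2 * x ^ 2 + q3 * x ^ 3) *
      (r0 + r1 * x + r2 * x ^ 2 + r3 * x ^ 3)| ≤
      (|q0| + |q1| + |q2| + |q3|) * ∫ x in (0 : ℝ)..1, |r0 + r1 * x + r2 * x ^ 2 + r3 * x ^ 3| := by
  rw [← intervalIntegral.integral_const_mul]
  refine (intervalIntegral.abs_integral_le_integral_abs zero_le_one).trans ?_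
  refine intervalIntegral.integral_mono_on zero_le_one
    (Continuous.intervalIntegrable (by fun_prop) _ _)
    (Continuous.intervalIntegrable (by fun_prop) _ _) fun x hx => ?_
  rw [abs_mul]
  gcongr
  have a0 : |x| ≤ 1 := abs_le.2 ⟨by linarith [hx.1], hx.2⟩
  have a1 : ∀ (q : ℝ) (n : ℕ), |q * x ^ n| ≤ |q| := fun q n => by
    rw [abs_mul, abs_pow]
    exact mul_le_of_le_one_right (abs_nonneg _) (pow_le_one₀ (abs_nonneg _) a0)
  have := a1 q1 1
  rw [pow_one] at this
  calc _ ≤ |q0| + |q1 * x| + |q2 * x ^ 2| + |q3 * x ^ 3| := by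
        refine (abs_add_le _ _).trans ?_
        gcongr
        exact abs_add_three _ _ _
    _ ≤ _ := by
        linarith [a1 q2 2, a1 q3 3]

theorem sum_abs_coeff_le (r0 r1 r2 r3 : ℝ) :
    |r0| + |r1| + |r2| + |r3| ≤
      40000 * ∫ x in (0 : ℝ)..1, |r0 + r1 * x + r2 * x ^ 2 + r3 * x ^ 3| := by
  have h0 := abs_dual_cubic_le 16 (-120) 240 (-140) r0 r1 r2 r3
  have h1 := abs_dual_cubic_le (-120) 1200 (-2700) 1680 r0 r1 r2 r3
  have h2 := abs_dual_cubic_le 240 (-2700) 6480 (-4200) r0 r1 r2 r3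
  have h3 := abs_dual_cubic_le (-140) 1680 (-4200) 2800 r0 r1 r2 r3
  rw [integral_mul_cubic] at h0 h1 h2 h3
  generalize (∫ x in (0 : ℝ)..1, |r0 + r1 * x + r2 * x ^ 2 + r3 * x ^ 3|) = J at *
  ring_nf at h0 h1 h2 h3
  have hJ : 0 ≤ J := by linarith [abs_nonneg r0]
  linarith

theorem integrable_pow_laplaceMeasure (k : ℕ) :
    Integrable (fun u : ℝ => (1 + |u|) ^ k) laplaceMeasure := by
  have h : Integrable (fun u : ℝ => Real.exp (-|u|)) := by
    refine ⟨by fun_prop, ?_⟩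
    rw [hasFiniteIntegral_iff_ofReal (Filter.Eventually.of_forall fun _ => (Real.exp_pos _).le),
      lintegral_exp_neg_abs]
    simp
  have h2 := (h.comp_mul_left' (g := fun u : ℝ => Real.exp (-|u|))
    (show (1 / 2 : ℝ) ≠ 0 by norm_num)).const_mul (k.factorial * 2 ^ k * Real.exp (1 / 2))
  rw [laplaceMeasure, integrable_withDensity_iff (by fun_prop)
    (Filter.Eventually.of_forall fun _ => by simp)]
  refine h2.mono' (by fun_prop) (Filter.Eventually.of_forall fun u => ?_)
  have hu : 0 ≤ (1 + |u|) / 2 := by positivity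
  have h3 := Real.pow_div_factorial_le_exp _ hu k
  have h4 : (1 + |u|) ^ k ≤ k.factorial * 2 ^ k * Real.exp ((1 + |u|) / 2) := by
    rw [div_pow, div_div, div_le_iff₀ (by positivity)] at h3
    linarith
  rw [ENNReal.toReal_ofReal (by positivity), Real.norm_of_nonneg (by positivity)]
  calc (1 + |u|) ^ k * (Real.exp (-|u|) / 2)
      ≤ k.factorial * 2 ^ k * Real.exp ((1 + |u|) / 2) * Real.exp (-|u|) := by
        gcongr
        linarith [Real.exp_pos (-|u|)]
    _ = k.factorial * 2 ^ k * Real.exp (1 / 2) * Real.exp (-|1 / 2 * u|) := by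
        rw [mul_assoc, mul_assoc _ (Real.exp _), ← Real.exp_add, ← Real.exp_add, abs_mul,
          abs_of_pos (by norm_num : (0 : ℝ) < 1 / 2)]
        ring_nf

theorem IsUnitDensity.le_laplaceMeasure {ρ : ℝ → ℝ} (hρ : IsUnitDensity ρ) :
    (volume.withDensity fun u => ENNReal.ofReal (ρ u)) ≤ (42 : ENNReal) • laplaceMeasure := by
  rw [laplaceMeasure, ← withDensity_smul _ (by fun_prop)]
  refine withDensity_mono (Filter.Eventually.of_forall fun u => ?_)
  simp only [Pi.smul_apply, smul_eq_mul]
  rw [show (42 : ENNReal) = ENNReal.ofReal 42 by simp, ← ENNReal.ofReal_mul (by norm_num)]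
  exact ENNReal.ofReal_le_ofReal (by linarith [hρ.le_exp u])

theorem IsUnitDensity.isProbabilityMeasure {ρ : ℝ → ℝ} (hρ : IsUnitDensity ρ) :
    IsProbabilityMeasure (volume.withDensity fun u => ENNReal.ofReal (ρ u)) :=
  ⟨by rw [withDensity_apply _ MeasurableSet.univ, Measure.restrict_univ, hρ.lintegral_eq]⟩

theorem IsUnitDensity.integrable {ρ : ℝ → ℝ} (hρ : IsUnitDensity ρ) {g : ℝ → ℝ}
    (hg : Integrable g laplaceMeasure) :
    Integrable g (volume.withDensity fun u => ENNReal.ofReal (ρ u)) :=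
  (hg.smul_measure (by simp)).mono_measure hρ.le_laplaceMeasure

theorem IsUnitDensity.integral_le {ρ : ℝ → ℝ} (hρ : IsUnitDensity ρ) {g : ℝ → ℝ}
    (hg : Integrable g laplaceMeasure) (h0 : ∀ u, 0 ≤ g u) :
    ∫ u, g u ∂(volume.withDensity fun u => ENNReal.ofReal (ρ u)) ≤
      42 * ∫ u, g u ∂laplaceMeasure := by
  refine (integral_mono_measure hρ.le_laplaceMeasure (Filter.Eventually.of_forall h0)
    (hg.smul_measure (by simp))).trans_eq ?_
  rw [integral_smul_measure]
  simp

theorem IsUnitDensity.setIntegral_unitInterval_le {ρ : ℝ → ℝ} (hρ : IsUnitDensity ρ) {g : ℝ → ℝ}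
    (hc : Continuous g) (hg : Integrable g laplaceMeasure) (h0 : ∀ u, 0 ≤ g u) :
    ∫ x in (0 : ℝ)..1, g x ≤
      16 * ∫ u, g u ∂(volume.withDensity fun u => ENNReal.ofReal (ρ u)) := by
  have hi := hρ.integrable hg
  have mρ := hρ.measurable
  rw [integrable_withDensity_iff (by fun_prop)
    (Filter.Eventually.of_forall fun _ => by simp)] at hi
  rw [integral_withDensity_eq_integral_toReal_smul (by fun_prop)
    (Filter.Eventually.of_forall fun _ => by simp), ← integral_const_mul,
    intervalIntegral.integral_of_le zero_le_one]
  simp only [smul_eq_mul, ENNReal.toReal_ofReal (hρ.nonneg _), mul_comm (g _)] at hi ⊢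
  refine le_trans ?_ (setIntegral_le_integral (s := Set.Ioc 0 1) (hi.const_mul 16)
    (Filter.Eventually.of_forall fun u => mul_nonneg (by norm_num)
      (mul_nonneg (hρ.nonneg u) (h0 u))))
  refine setIntegral_mono_on (hc.integrableOn_Ioc) (hi.const_mul 16).integrableOn
    measurableSet_Ioc fun u hu => ?_
  have := hρ.ge u hu.1.le hu.2
  nlinarith [h0 u]

theorem abs_cubic_le (r0 r1 r2 r3 x : ℝ) :
    |r0 + r1 * x + r2 * x ^ 2 + r3 * x ^ 3| ≤ (|r0| + |r1| + |r2| + |r3|) * (1 + |x|) ^ 3 := by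
  have a1 : ∀ (q : ℝ) (n : ℕ), n ≤ 3 → |q * x ^ n| ≤ |q| * (1 + |x|) ^ 3 := fun q n hn => by
    rw [abs_mul, abs_pow]
    gcongr
    calc |x| ^ n ≤ (1 + |x|) ^ n := by gcongr; linarith
      _ ≤ (1 + |x|) ^ 3 := pow_le_pow_right₀ (by linarith [abs_nonneg x]) hn
  have h0 := a1 r0 0 (by norm_num)
  have h1 := a1 r1 1 (by norm_num)
  have h2 := a1 r2 2 (by norm_num)
  have h3 := a1 r3 3 (by norm_num)
  rw [pow_zero, mul_one] at h0
  rw [pow_one] at h1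
  calc _ ≤ |r0| + |r1 * x| + |r2 * x ^ 2| + |r3 * x ^ 3| := by
        refine (abs_add_le _ _).trans ?_
        gcongr
        exact abs_add_three _ _ _
    _ ≤ _ := by linarith

theorem integrable_cubic_laplaceMeasure (r0 r1 r2 r3 : ℝ) :
    Integrable (fun x => r0 + r1 * x + r2 * x ^ 2 + r3 * x ^ 3) laplaceMeasure :=
  ((integrable_pow_laplaceMeasure 3).const_mul (|r0| + |r1| + |r2| + |r3|)).mono' (by fun_prop)
    (Filter.Eventually.of_forall fun x => abs_cubic_le r0 r1 r2 r3 x)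

theorem integrable_cubic_sq_laplaceMeasure (r0 r1 r2 r3 : ℝ) :
    Integrable (fun x => (r0 + r1 * x + r2 * x ^ 2 + r3 * x ^ 3) ^ 2) laplaceMeasure := by
  refine ((integrable_pow_laplaceMeasure 6).const_mul ((|r0| + |r1| + |r2| + |r3|) ^ 2)).mono'
    (by fun_prop) (Filter.Eventually.of_forall fun x => ?_)
  rw [Real.norm_of_nonneg (sq_nonneg _), ← sq_abs]
  calc _ ≤ ((|r0| + |r1| + |r2| + |r3|) * (1 + |x|) ^ 3) ^ 2 := by
        gcongr; exact abs_cubic_le r0 r1 r2 r3 x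
    _ = _ := by ring

theorem exists_unitDensity_sq_le : ∃ C : ℝ, 0 < C ∧ ∀ ρ, IsUnitDensity ρ → ∀ r0 r1 r2 r3 : ℝ,
    ∫ x, (r0 + r1 * x + r2 * x ^ 2 + r3 * x ^ 3) ^ 2
      ∂(volume.withDensity fun u => ENNReal.ofReal (ρ u)) ≤
    C * (∫ x, |r0 + r1 * x + r2 * x ^ 2 + r3 * x ^ 3|
      ∂(volume.withDensity fun u => ENNReal.ofReal (ρ u))) ^ 2 := by
  set K := ∫ x : ℝ, (1 + |x|) ^ 6 ∂laplaceMeasure with hK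
  have K0 : 0 ≤ K := integral_nonneg fun x => by positivity
  refine ⟨42 * (K + 1) * 640000 ^ 2, by positivity, fun ρ hρ r0 r1 r2 r3 => ?_⟩
  have h1 := hρ.integral_le (integrable_cubic_sq_laplaceMeasure r0 r1 r2 r3) fun _ => sq_nonneg _
  have h2 := hρ.setIntegral_unitInterval_le (by fun_prop)
    (integrable_cubic_laplaceMeasure r0 r1 r2 r3).abs fun _ => abs_nonneg _
  have h3 := sum_abs_coeff_le r0 r1 r2 r3
  have h4 : ∫ x, (r0 + r1 * x + r2 * x ^ 2 + r3 * x ^ 3) ^ 2 ∂laplaceMeasure ≤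
      (|r0| + |r1| + |r2| + |r3|) ^ 2 * K := by
    rw [hK, ← integral_const_mul]
    refine integral_mono (integrable_cubic_sq_laplaceMeasure r0 r1 r2 r3)
      ((integrable_pow_laplaceMeasure 6).const_mul _) fun x => ?_
    calc _ = |r0 + r1 * x + r2 * x ^ 2 + r3 * x ^ 3| ^ 2 := (sq_abs _).symm
      _ ≤ ((|r0| + |r1| + |r2| + |r3|) * (1 + |x|) ^ 3) ^ 2 := by
          gcongr; exact abs_cubic_le r0 r1 r2 r3 x
      _ = _ := by ring
  set J := ∫ x, |r0 + r1 * x + r2 * x ^ 2 + r3 * x ^ 3|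
      ∂(volume.withDensity fun u => ENNReal.ofReal (ρ u))
  have h5 : |r0| + |r1| + |r2| + |r3| ≤ 640000 * J := by linarith
  calc _ ≤ 42 * ((|r0| + |r1| + |r2| + |r3|) ^ 2 * K) := h1.trans (by linarith)
    _ ≤ 42 * ((640000 * J) ^ 2 * (K + 1)) := by
        gcongr
        linarith
    _ = _ := by ring

theorem IsUnitDensity.norm_integral_le_sublevel {ρ : ℝ → ℝ} (hρ : IsUnitDensity ρ)
    (r0 r1 r2 r3 t : ℝ) (ht : t ≠ 0) {τ : ℝ} (hτ : 0 < τ) :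
    ‖∫ x, Complex.exp (Complex.I * t * ((r0 + r1 * x + r2 * x ^ 2 + r3 * x ^ 3 : ℝ) : ℂ))
      ∂(volume.withDensity fun u => ENNReal.ofReal (ρ u))‖ ≤
    42 * laplaceMeasure.real {x | |r1 + 2 * r2 * x + 3 * r3 * x ^ 2| ≤ τ} +
      336 / (|t| * τ) := by
  set F : ℝ → ℂ := fun x =>
    Complex.exp (Complex.I * t * ((r0 + r1 * x + r2 * x ^ 2 + r3 * x ^ 3 : ℝ) : ℂ)) with hF
  set E : Set ℝ := {x | |r1 + 2 * r2 * x + 3 * r3 * x ^ 2| ≤ τ} with hE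
  have mE : MeasurableSet E :=
    measurableSet_le (by fun_prop : Continuous fun x : ℝ =>
      |r1 + 2 * r2 * x + 3 * r3 * x ^ 2|).measurable measurable_const
  have mρ := hρ.measurable
  have cF : Continuous F := by simp only [hF]; fun_prop
  have := hρ.isProbabilityMeasure
  obtain ⟨i1, e1⟩ := hρ.layer_cake cF.stronglyMeasurable fun u => (norm_exp_I_mul t _).le
  obtain ⟨i2, e2⟩ := hρ.layer_cake (F := E.indicator fun _ => (1 : ℝ))
    (stronglyMeasurable_const.indicator mE) fun u => by
      refine (norm_indicator_le_norm_self _ _).trans (by simp)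
  have hP : ∀ G : ℝ → ℂ, ∫ u, G u ∂(volume.withDensity fun u => ENNReal.ofReal (ρ u)) =
      ∫ u, ρ u • G u := fun G => by
    rw [integral_withDensity_eq_integral_toReal_smul (by fun_prop)
      (Filter.Eventually.of_forall fun _ => by simp)]
    simp only [ENNReal.toReal_ofReal (hρ.nonneg _)]
  have hP' : ∫ u, ρ u • E.indicator (fun _ => (1 : ℝ)) u =
      (volume.withDensity fun u => ENNReal.ofReal (ρ u)).real E := by
    rw [← integral_indicator_one mE, integral_withDensity_eq_integral_toReal_smul (by fun_prop)
      (Filter.Eventually.of_forall fun _ => by simp)]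
    simp only [ENNReal.toReal_ofReal (hρ.nonneg _)]
    rfl
  rw [hP, ← e1]
  rw [hP'] at e2
  have hle : (volume.withDensity fun u => ENNReal.ofReal (ρ u)).real E ≤
      42 * laplaceMeasure.real E := by
    have h := hρ.le_laplaceMeasure E
    rw [Measure.smul_apply, smul_eq_mul] at h
    have := ENNReal.toReal_mono (by finiteness) h
    rw [ENNReal.toReal_mul] at this
    simpa [Measure.real] using this
  have i3 : IntegrableOn (fun s : ℝ => (Set.Ioo (0 : ℝ) 21).indicator
      (fun _ => 16 / (|t| * τ)) s) (Set.Ioi 0) :=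
    ((integrable_indicator_iff measurableSet_Ioo).2 (integrableOn_const (by simp))).integrableOn
  have key : ∀ s ∈ Set.Ioi (0 : ℝ), ‖∫ u in {u | s < ρ u}, F u‖ ≤
      (∫ u in {u | s < ρ u}, E.indicator (fun _ => (1 : ℝ)) u) +
        (Set.Ioo (0 : ℝ) 21).indicator (fun _ => 16 / (|t| * τ)) s := by
    intro s hs
    have hs' : 0 < s := hs
    by_cases h21 : s < 21
    · have hb : Bornology.IsBounded {u | s < ρ u} := by
        refine (Metric.isBounded_closedBall (x := (0 : ℝ)) (r := 21 / s)).subset fun u hu => ?_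
        have h1 : s < 21 * Real.exp (-|u|) := lt_of_lt_of_le hu (hρ.le_exp u)
        rw [Metric.mem_closedBall, dist_zero_right, Real.norm_eq_abs, le_div_iff₀ hs']
        rw [Real.exp_neg, ← div_eq_mul_inv, lt_div_iff₀ (Real.exp_pos _)] at h1
        nlinarith [Real.add_one_le_exp |u|]
      rw [Set.indicator_of_mem (by exact ⟨hs, h21⟩), setIntegral_indicator mE]
      rw [setIntegral_const, smul_eq_mul, mul_one]
      exact norm_setIntegral_exp_cubic_le r0 r1 r2 r3 (hρ.ordConnected s) hb hτ ht
    · have he : {u | s < ρ u} = ∅ := by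
        refine Set.eq_empty_of_forall_notMem fun u hu => h21 ?_
        have h1 : s < 21 * Real.exp (-|u|) := lt_of_lt_of_le hu (hρ.le_exp u)
        have h2 : Real.exp (-|u|) ≤ 1 := Real.exp_le_one_iff.2 (by simp)
        linarith
      rw [he, Set.indicator_of_notMem (fun h => h21 h.2)]
      simp
  calc _ ≤ ∫ s in Set.Ioi 0, ‖∫ u in {u | s < ρ u}, F u‖ := norm_integral_le_integral_norm _
    _ ≤ ∫ s in Set.Ioi (0 : ℝ), ((∫ u in {u | s < ρ u}, E.indicator (fun _ => (1 : ℝ)) u) +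
        (Set.Ioo (0 : ℝ) 21).indicator (fun _ => 16 / (|t| * τ)) s) :=
      setIntegral_mono_on i1.norm (i2.add i3) measurableSet_Ioi key
    _ ≤ _ := by
      rw [integral_add i2 i3, e2, setIntegral_indicator measurableSet_Ioo, setIntegral_const]
      have : Set.Ioi (0 : ℝ) ∩ Set.Ioo 0 21 = Set.Ioo 0 21 :=
        Set.inter_eq_right.2 fun x hx => hx.1
      rw [this, Real.volume_real_Ioo_of_le (by norm_num), smul_eq_mul]
      have : (21 - 0) * (16 / (|t| * τ)) = 336 / (|t| * τ) := by ring
      rw [this]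
      gcongr

theorem exists_unitDensity_decay : ∃ C : ℝ, 0 < C ∧ ∀ ρ, IsUnitDensity ρ →
    ∀ r0 r1 r2 r3 t m : ℝ, m = ∫ x, (r0 + r1 * x + r2 * x ^ 2 + r3 * x ^ 3)
      ∂(volume.withDensity fun u => ENNReal.ofReal (ρ u)) →
    ‖∫ x, Complex.exp (Complex.I * t * ((r0 + r1 * x + r2 * x ^ 2 + r3 * x ^ 3 : ℝ) : ℂ))
      ∂(volume.withDensity fun u => ENNReal.ofReal (ρ u))‖ ^ 3 *
      (1 + |t| * ∫ x, |r0 + r1 * x + r2 * x ^ 2 + r3 * x ^ 3 - m|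
      ∂(volume.withDensity fun u => ENNReal.ofReal (ρ u))) ≤ C := by
  set K := ∫ x : ℝ, (1 + |x|) ^ 3 ∂laplaceMeasure with hK
  have K0 : 0 ≤ K := integral_nonneg fun x => by positivity
  refine ⟨1 + 84 * K * 1200 ^ 3, by positivity, fun ρ hρ r0 r1 r2 r3 t m hm => ?_⟩
  have := hρ.isProbabilityMeasure
  set P := volume.withDensity fun u => ENNReal.ofReal (ρ u) with hPdef
  set N := |r1| + |2 * r2| + |3 * r3| with hN
  have N0 : 0 ≤ N := by positivity
  set I := ‖∫ x, Complex.exp (Complex.I * t * ((r0 + r1 * x + r2 * x ^ 2 + r3 * x ^ 3 : ℝ) : ℂ)) ∂P‖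
    with hI
  have I0 : 0 ≤ I := norm_nonneg _
  have I1 : I ≤ 1 := by
    refine (norm_integral_le_of_norm_le_const
      (Filter.Eventually.of_forall fun u => (norm_exp_I_mul t _).le)).trans ?_
    simp
  have ip := hρ.integrable (integrable_cubic_laplaceMeasure r0 r1 r2 r3)
  have ip0 := integrable_cubic_laplaceMeasure 0 r1 r2 r3
  have hσ0 : ∫ x, |0 + r1 * x + r2 * x ^ 2 + r3 * x ^ 3| ∂P ≤ 42 * (N * K) := by
    refine (hρ.integral_le ip0.abs fun _ => abs_nonneg _).trans ?_
    gcongr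
    rw [hK, ← integral_const_mul]
    refine integral_mono ip0.abs ((integrable_pow_laplaceMeasure 3).const_mul _) fun x => ?_
    refine (abs_cubic_le 0 r1 r2 r3 x).trans ?_
    rw [hN, abs_mul, abs_mul, abs_zero, abs_two, abs_of_pos (by norm_num : (0 : ℝ) < 3)]
    gcongr <;> linarith [abs_nonneg r2, abs_nonneg r3]
  have hm0 : |m - r0| ≤ ∫ x, |0 + r1 * x + r2 * x ^ 2 + r3 * x ^ 3| ∂P := by
    have e : m - r0 = ∫ x, (0 + r1 * x + r2 * x ^ 2 + r3 * x ^ 3) ∂P := by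
      have : r0 = ∫ x, r0 ∂P := by simp
      rw [hm]
      nth_rw 2 [this]
      rw [← integral_sub ip (integrable_const _)]
      congr 1; ext x; ring
    rw [e]
    exact abs_integral_le_integral_abs
  have hσ : ∫ x, |r0 + r1 * x + r2 * x ^ 2 + r3 * x ^ 3 - m| ∂P ≤ 84 * K * N := by
    have i0 := (hρ.integrable ip0).abs
    calc _ ≤ ∫ x, (|0 + r1 * x + r2 * x ^ 2 + r3 * x ^ 3| + |m - r0|) ∂P := by
          refine integral_mono (ip.sub (integrable_const _)).abs (i0.add (integrable_const _))
            fun x => ?_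
          refine le_trans (le_of_eq ?_) (abs_sub _ _)
          congr 1; ring
      _ = (∫ x, |0 + r1 * x + r2 * x ^ 2 + r3 * x ^ 3| ∂P) + |m - r0| := by
          rw [integral_add i0 (integrable_const _)]; simp [hPdef]
      _ ≤ _ := by linarith
  have main : I ^ 3 * (|t| * N) ≤ 1200 ^ 3 := by
    by_cases h0 : |t| * N = 0
    · rw [h0]; norm_num
    have h1 : 0 < |t| * N := lt_of_le_of_ne (by positivity) (Ne.symm h0)
    have ht : t ≠ 0 := by rintro rfl; simp at h0
    have ht' : 0 < |t| := abs_pos.2 ht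
    set L := (|t| * N) ^ (1 / 3 : ℝ) with hL
    have L0 : 0 < L := Real.rpow_pos_of_pos h1 _
    have L3 : L ^ 3 = |t| * N := by
      rw [hL, ← Real.rpow_natCast, ← Real.rpow_mul h1.le]; norm_num
    have d := hρ.norm_integral_le_sublevel r0 r1 r2 r3 t ht (τ := L / |t|) (by positivity)
    have s := laplaceMeasure_sublevel_le r1 (2 * r2) (3 * r3) (L / |t|) (by positivity)
    rw [mul_div_cancel₀ L ht'.ne'] at d
    set w := laplaceMeasure.real {x | |r1 + 2 * r2 * x + 3 * r3 * x ^ 2| ≤ L / |t|}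
    have w0 : 0 ≤ w := measureReal_nonneg
    have h2 : (w * L) ^ 2 ≤ 300 := by
      have : w ^ 2 * N * |t| ≤ 300 * L := by
        rw [← le_div_iff₀ ht', mul_div_assoc]; exact s
      have : (w * L) ^ 2 * L ≤ 300 * L := by
        calc _ = w ^ 2 * L ^ 3 := by ring
          _ = w ^ 2 * N * |t| := by rw [L3]; ring
          _ ≤ _ := this
      exact le_of_mul_le_mul_right this L0
    have h3 : w * L ≤ 18 := by nlinarith [mul_nonneg w0 L0.le]
    have h4 : I * L ≤ 1200 := by
      calc I * L ≤ (42 * w + 336 / L) * L := by gcongr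
        _ = 42 * (w * L) + 336 := by field_simp
        _ ≤ 1200 := by linarith
    calc I ^ 3 * (|t| * N) = (I * L) ^ 3 := by rw [← L3]; ring
      _ ≤ 1200 ^ 3 := by gcongr
  have I3 : I ^ 3 ≤ 1 := pow_le_one₀ I0 I1
  calc I ^ 3 * (1 + |t| * ∫ x, |r0 + r1 * x + r2 * x ^ 2 + r3 * x ^ 3 - m| ∂P)
      ≤ I ^ 3 * (1 + |t| * (84 * K * N)) := by gcongr
    _ = I ^ 3 + 84 * K * (I ^ 3 * (|t| * N)) := by ring
    _ ≤ 1 + 84 * K * 1200 ^ 3 := by gcongr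

theorem measurable_add_mul_snd (τ : ℝ) : Measurable fun z : ℝ × ℝ => z.1 + τ * z.2 := by fun_prop

theorem tendsto_integral_add_mul_laplaceMeasure {η : Measure ℝ} [IsProbabilityMeasure η] {R : ℝ}
    (hR : ∀ᵐ y ∂η, |y| ≤ R) {V : Type*} [NormedAddCommGroup V] [NormedSpace ℝ V]
    [SecondCountableTopology V] {g : ℝ → V} (hg : Continuous g) {B : ℝ}
    (hB : ∀ x, ‖g x‖ ≤ B * (1 + |x|) ^ 6) :
    Filter.Tendsto (fun n : ℕ => ∫ z, g (z.1 + 1 / ((n : ℝ) + 1) * z.2) ∂(η.prod laplaceMeasure))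
      Filter.atTop (nhds (∫ y, g y ∂η)) := by
  have e : ∫ y, g y ∂η = ∫ z, g z.1 ∂(η.prod laplaceMeasure) := by
    rw [integral_fun_fst]; simp
  rw [e]
  have B0 : 0 ≤ B := by
    have := (norm_nonneg _).trans (hB 0)
    simpa using this
  have hR' : ∀ᵐ z ∂(η.prod laplaceMeasure), |z.1| ≤ R :=
    Measure.quasiMeasurePreserving_fst.ae hR
  refine tendsto_integral_of_dominated_convergence
    (fun z => B * ((1 + |R|) ^ 6 * (1 + |z.2|) ^ 6)) (fun n => ?_) ?_ (fun n => ?_) ?_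
  · exact (by fun_prop : Continuous fun z : ℝ × ℝ =>
      g (z.1 + 1 / ((n : ℝ) + 1) * z.2)).aestronglyMeasurable
  · exact (((integrable_pow_laplaceMeasure 6).comp_snd (μ := η)).const_mul _).const_mul _
  · filter_upwards [hR'] with z hz
    refine (hB _).trans ?_
    rw [← mul_pow]
    gcongr
    have h1 : |1 / ((n : ℝ) + 1) * z.2| ≤ |z.2| := by
      rw [abs_mul]
      refine mul_le_of_le_one_left (abs_nonneg _) ?_
      rw [abs_of_nonneg (by positivity)]
      exact Nat.one_div_le_one_div (Nat.zero_le n) |>.trans (by norm_num)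
    have h2 := abs_add_le z.1 (1 / ((n : ℝ) + 1) * z.2)
    nlinarith [le_abs_self R, abs_nonneg R, abs_nonneg z.2]
  · refine Filter.Eventually.of_forall fun z => ?_
    have h1 : Filter.Tendsto (fun n : ℕ => z.1 + 1 / ((n : ℝ) + 1) * z.2) Filter.atTop
        (nhds (z.1 + 0 * z.2)) :=
      (tendsto_one_div_add_atTop_nhds_zero_nat.mul_const _).const_add _
    rw [zero_mul, add_zero] at h1
    exact (hg.tendsto _).comp h1

theorem IsPL.exists_isUnitDensity_integral {η : Measure ℝ} [IsProbabilityMeasure η] (hη : IsPL η)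
    {τ : ℝ} (hτ : 0 < τ) : ∃ a s : ℝ, ∃ ρ : ℝ → ℝ, 0 < s ∧ IsUnitDensity ρ ∧
      (∀ S, MeasurableSet S → (η.prod laplaceMeasure) {z | z.1 + τ * z.2 ∈ S} =
        (volume.withDensity fun u => ENNReal.ofReal (ρ u)) {u | a + s * u ∈ S}) ∧
      (∀ g : ℝ → ℝ, Continuous g → (Integrable (fun z : ℝ × ℝ => g (z.1 + τ * z.2))
          (η.prod laplaceMeasure) ↔ Integrable (fun u => g (a + s * u))
          (volume.withDensity fun u => ENNReal.ofReal (ρ u))) ∧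
        ∫ z, g (z.1 + τ * z.2) ∂(η.prod laplaceMeasure) =
          ∫ u, g (a + s * u) ∂(volume.withDensity fun u => ENNReal.ofReal (ρ u))) ∧
      (∀ g : ℝ → ℂ, Continuous g → ∫ z, g (z.1 + τ * z.2) ∂(η.prod laplaceMeasure) =
          ∫ u, g (a + s * u) ∂(volume.withDensity fun u => ENNReal.ofReal (ρ u))) := by
  obtain ⟨a, s, ρ, s0, hρ, h⟩ := hη.exists_isUnitDensity hτ
  have m2 : Measurable fun u : ℝ => a + s * u := by fun_prop
  refine ⟨a, s, ρ, s0, hρ, fun S hS => ?_, fun g hg => ⟨?_, ?_⟩, fun g hg => ?_⟩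
  · have := congrArg (fun m => m S) h
    simp only [Measure.map_apply (measurable_add_mul_snd τ) hS, Measure.map_apply m2 hS] at this
    exact this
  · have h1 := integrable_map_measure (μ := η.prod laplaceMeasure) (g := g)
      hg.aestronglyMeasurable (measurable_add_mul_snd τ).aemeasurable
    have h2 := integrable_map_measure (g := g)
      (μ := volume.withDensity fun u => ENNReal.ofReal (ρ u))
      hg.aestronglyMeasurable m2.aemeasurable
    rw [h] at h1
    exact h1.symm.trans h2
  · rw [← integral_map (f := g) (measurable_add_mul_snd τ).aemeasurable hg.aestronglyMeasurable, h,
      integral_map m2.aemeasurable hg.aestronglyMeasurable]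
  · rw [← integral_map (f := g) (measurable_add_mul_snd τ).aemeasurable hg.aestronglyMeasurable, h,
      integral_map m2.aemeasurable hg.aestronglyMeasurable]

theorem cubic_comp_affine (r0 r1 r2 r3 a s u : ℝ) :
    r0 + r1 * (a + s * u) + r2 * (a + s * u) ^ 2 + r3 * (a + s * u) ^ 3 =
      (r0 + r1 * a + r2 * a ^ 2 + r3 * a ^ 3) +
      (r1 * s + 2 * r2 * a * s + 3 * r3 * a ^ 2 * s) * u +
      (r2 * s ^ 2 + 3 * r3 * a * s ^ 2) * u ^ 2 + (r3 * s ^ 3) * u ^ 3 := by ring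

theorem abs_cubic_le_pow_six (r0 r1 r2 r3 x : ℝ) :
    |r0 + r1 * x + r2 * x ^ 2 + r3 * x ^ 3| ≤ (|r0| + |r1| + |r2| + |r3|) * (1 + |x|) ^ 6 := by
  refine (abs_cubic_le r0 r1 r2 r3 x).trans ?_
  gcongr
  · linarith [abs_nonneg x]
  · norm_num

/-- Reverse Hölder inequality for cubic polynomials on the line. -/
theorem exists_isPL_cubic_sq_le : ∃ C : ℝ, 0 < C ∧ ∀ (η : Measure ℝ) [IsProbabilityMeasure η],
    IsPL η → ∀ R, (∀ᵐ y ∂η, |y| ≤ R) → ∀ r0 r1 r2 r3 : ℝ,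
    ∫ x, (r0 + r1 * x + r2 * x ^ 2 + r3 * x ^ 3) ^ 2 ∂η ≤
    C * (∫ x, |r0 + r1 * x + r2 * x ^ 2 + r3 * x ^ 3| ∂η) ^ 2 := by
  obtain ⟨C, C0, hC⟩ := exists_unitDensity_sq_le
  refine ⟨C, C0, fun η _ hη R hR r0 r1 r2 r3 => ?_⟩
  have t1 := tendsto_integral_add_mul_laplaceMeasure hR
    (g := fun x => (r0 + r1 * x + r2 * x ^ 2 + r3 * x ^ 3) ^ 2) (by fun_prop)
    (B := (|r0| + |r1| + |r2| + |r3|) ^ 2) fun x => by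
      rw [Real.norm_of_nonneg (sq_nonneg _), ← sq_abs]
      calc _ ≤ ((|r0| + |r1| + |r2| + |r3|) * (1 + |x|) ^ 3) ^ 2 := by
            gcongr; exact abs_cubic_le r0 r1 r2 r3 x
        _ = _ := by ring
  have t2 := tendsto_integral_add_mul_laplaceMeasure hR
    (g := fun x => |r0 + r1 * x + r2 * x ^ 2 + r3 * x ^ 3|) (by fun_prop)
    (B := |r0| + |r1| + |r2| + |r3|) fun x => by
      rw [Real.norm_eq_abs, abs_abs]
      exact abs_cubic_le_pow_six r0 r1 r2 r3 x
  refine le_of_tendsto_of_tendsto' t1 ((t2.pow 2).const_mul C) fun n => ?_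
  obtain ⟨a, s, ρ, s0, hρ, -, h, -⟩ := hη.exists_isUnitDensity_integral
    (show (0 : ℝ) < 1 / ((n : ℝ) + 1) by positivity)
  rw [(h (fun x => (r0 + r1 * x + r2 * x ^ 2 + r3 * x ^ 3) ^ 2) (by fun_prop)).2,
    (h (fun x => |r0 + r1 * x + r2 * x ^ 2 + r3 * x ^ 3|) (by fun_prop)).2]
  simp only [cubic_comp_affine]
  exact hC ρ hρ _ _ _ _

/-- Decay of characteristic functions of cubic polynomials on the line. -/
theorem exists_isPL_cubic_decay : ∃ C : ℝ, 0 < C ∧ ∀ (η : Measure ℝ) [IsProbabilityMeasure η],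
    IsPL η → ∀ R, (∀ᵐ y ∂η, |y| ≤ R) → ∀ r0 r1 r2 r3 t m : ℝ,
    m = ∫ x, (r0 + r1 * x + r2 * x ^ 2 + r3 * x ^ 3) ∂η →
    ‖∫ x, Complex.exp (Complex.I * t * ((r0 + r1 * x + r2 * x ^ 2 + r3 * x ^ 3 : ℝ) : ℂ)) ∂η‖ ^ 3 *
      (1 + |t| * ∫ x, |r0 + r1 * x + r2 * x ^ 2 + r3 * x ^ 3 - m| ∂η) ≤ C := by
  obtain ⟨C, C0, hC⟩ := exists_unitDensity_decay
  refine ⟨C, C0, fun η _ hη R hR r0 r1 r2 r3 t m hm => ?_⟩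
  have t1 := tendsto_integral_add_mul_laplaceMeasure hR
    (g := fun x => r0 + r1 * x + r2 * x ^ 2 + r3 * x ^ 3) (by fun_prop)
    (B := |r0| + |r1| + |r2| + |r3|) fun x => abs_cubic_le_pow_six r0 r1 r2 r3 x
  have t2 := tendsto_integral_add_mul_laplaceMeasure hR
    (g := fun x => |r0 - m + r1 * x + r2 * x ^ 2 + r3 * x ^ 3|) (by fun_prop)
    (B := |r0 - m| + |r1| + |r2| + |r3|) fun x => by
      rw [Real.norm_eq_abs, abs_abs]
      exact abs_cubic_le_pow_six (r0 - m) r1 r2 r3 x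
  have t3 := tendsto_integral_add_mul_laplaceMeasure hR
    (g := fun x => Complex.exp (Complex.I * t * ((r0 + r1 * x + r2 * x ^ 2 + r3 * x ^ 3 : ℝ) : ℂ)))
    (by fun_prop) (B := 1) fun x => by
      rw [norm_exp_I_mul, one_mul]
      exact one_le_pow₀ (by linarith [abs_nonneg x])
  rw [← hm] at t1
  have t4 : ∀ x, r0 + r1 * x + r2 * x ^ 2 + r3 * x ^ 3 - m =
    r0 - m + r1 * x + r2 * x ^ 2 + r3 * x ^ 3 := fun x => by ring
  simp only [t4]
  have t5 := (t3.norm.pow 3).mul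
    (((t2.sub ((t1.sub_const m).abs)).const_mul |t|).const_add 1)
  rw [sub_self, abs_zero, sub_zero] at t5
  refine le_of_tendsto' t5 fun n => ?_
  obtain ⟨a, s, ρ, s0, hρ, -, h, h'⟩ := hη.exists_isUnitDensity_integral
    (show (0 : ℝ) < 1 / ((n : ℝ) + 1) by positivity)
  have := hρ.isProbabilityMeasure
  simp only [h' (fun x => Complex.exp (Complex.I * t *
      ((r0 + r1 * x + r2 * x ^ 2 + r3 * x ^ 3 : ℝ) : ℂ))) (by fun_prop),
    (h (fun x => r0 + r1 * x + r2 * x ^ 2 + r3 * x ^ 3) (by fun_prop)).2,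
    (h (fun x => |r0 - m + r1 * x + r2 * x ^ 2 + r3 * x ^ 3|) (by fun_prop)).2]
  simp only [← t4]
  simp only [cubic_comp_affine]
  set b0 := r0 + r1 * a + r2 * a ^ 2 + r3 * a ^ 3
  set b1 := r1 * s + 2 * r2 * a * s + 3 * r3 * a ^ 2 * s
  set b2 := r2 * s ^ 2 + 3 * r3 * a * s ^ 2
  set b3 := r3 * s ^ 3
  set m' := ∫ u, (b0 + b1 * u + b2 * u ^ 2 + b3 * u ^ 3)
    ∂(volume.withDensity fun u => ENNReal.ofReal (ρ u)) with hm'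
  refine le_trans ?_ (hC ρ hρ b0 b1 b2 b3 t m' hm')
  gcongr
  have ip := hρ.integrable (integrable_cubic_laplaceMeasure b0 b1 b2 b3)
  have iabs : Integrable (fun u => |b0 + b1 * u + b2 * u ^ 2 + b3 * u ^ 3 - m'|)
    (volume.withDensity fun u => ENNReal.ofReal (ρ u)) := (ip.sub (integrable_const m')).abs
  rw [sub_le_iff_le_add]
  calc _ ≤ ∫ u, (|b0 + b1 * u + b2 * u ^ 2 + b3 * u ^ 3 - m'| + |m' - m|)
        ∂(volume.withDensity fun u => ENNReal.ofReal (ρ u)) := by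
        refine integral_mono (ip.sub (integrable_const _)).abs
          (iabs.add (integrable_const _)) fun x => ?_
        refine le_trans (le_of_eq ?_) (abs_add_le _ _)
        congr 1; ring
    _ = _ := by
        rw [integral_add iabs (integrable_const _), integral_const,
          probReal_univ, one_smul]

theorem integrable_sq_laplaceMeasure : Integrable (fun u : ℝ => u ^ 2) laplaceMeasure := by
  refine (integrable_pow_laplaceMeasure 2).mono' (by fun_prop)
    (Filter.Eventually.of_forall fun u => ?_)
  rw [Real.norm_of_nonneg (sq_nonneg _), ← sq_abs]
  gcongr
  linarith

theorem one_third_le_laplaceMeasure :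
    1 / 3 ≤ laplaceMeasure.real (Metric.closedBall 0 1) := by
  have h : ENNReal.ofReal (1 / 3) ≤ laplaceMeasure (Metric.closedBall 0 1) := by
    rw [laplaceMeasure, withDensity_apply _ Metric.isClosed_closedBall.measurableSet]
    calc ENNReal.ofReal (1 / 3) = ∫⁻ v in Metric.closedBall (0 : ℝ) 1, ENNReal.ofReal (1 / 6) := by
          rw [setLIntegral_const, Real.volume_closedBall, ← ENNReal.ofReal_mul (by norm_num)]
          norm_num
      _ ≤ _ := by
          refine setLIntegral_mono' Metric.isClosed_closedBall.measurableSet fun v hv => ?_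
          rw [Metric.mem_closedBall, dist_zero_right, Real.norm_eq_abs] at hv
          refine ENNReal.ofReal_le_ofReal ?_
          have h1 : Real.exp (-1) ≤ Real.exp (-|v|) := Real.exp_le_exp.2 (by linarith)
          have h2 : (1 / 3 : ℝ) ≤ Real.exp (-1) := by
            rw [Real.exp_neg, ← one_div]
            exact one_div_le_one_div_of_le (Real.exp_pos _) (by linarith [Real.exp_one_lt_d9])
          linarith
  rw [Measure.real]
  exact (ENNReal.ofReal_le_iff_le_toReal (by finiteness)).1 h

/-- Small ball estimate for measures on the line with the Prékopa-Leindler property. -/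
theorem exists_isPL_small_ball : ∃ C : ℝ, 0 < C ∧ ∀ (η : Measure ℝ) [IsProbabilityMeasure η],
    IsPL η → Integrable (fun y => y ^ 2) η → ∀ v, (∀ b, v ≤ ∫ y, (y - b) ^ 2 ∂η) →
    ∀ z ε, 0 < ε → η.real (Metric.closedBall z ε) ^ 2 * v ≤ C * ε ^ 2 := by
  set K := ∫ u : ℝ, u ^ 2 ∂laplaceMeasure with hK
  have K0 : 0 ≤ K := integral_nonneg fun u => sq_nonneg u
  refine ⟨84 * K * 252 ^ 2 + 2 * K + 1, by positivity, fun η _ hη hi v hv z ε hε => ?_⟩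
  obtain ⟨a, s, ρ, s0, hρ, hS, h, -⟩ := hη.exists_isUnitDensity_integral hε
  have := hρ.isProbabilityMeasure
  set P := volume.withDensity fun u => ENNReal.ofReal (ρ u) with hP
  set x := η.real (Metric.closedBall z ε) with hx
  have x0 : 0 ≤ x := measureReal_nonneg
  have x1 : x ≤ 1 := measureReal_le_one
  have hxs : x * s ≤ 252 * ε := by
    have h1 : x * laplaceMeasure.real (Metric.closedBall 0 1) ≤
        (η.prod laplaceMeasure).real {w | w.1 + ε * w.2 ∈ Metric.closedBall z (2 * ε)} := by
      rw [hx, ← measureReal_prod_prod]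
      refine measureReal_mono fun w hw => ?_
      have w1 := hw.1
      have w2 := hw.2
      rw [Metric.mem_closedBall, Real.dist_eq] at w1
      rw [Metric.mem_closedBall, dist_zero_right, Real.norm_eq_abs] at w2
      change dist (w.1 + ε * w.2) z ≤ 2 * ε
      rw [Real.dist_eq]
      calc |w.1 + ε * w.2 - z| = |(w.1 - z) + ε * w.2| := by ring_nf
        _ ≤ |w.1 - z| + |ε * w.2| := abs_add_le _ _
        _ ≤ ε + ε * 1 := by rw [abs_mul, abs_of_pos hε]; gcongr
        _ = 2 * ε := by ring
    have h2 : P {u | a + s * u ∈ Metric.closedBall z (2 * ε)} ≤ ENNReal.ofReal (84 * ε / s) := by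
      calc P {u | a + s * u ∈ Metric.closedBall z (2 * ε)}
          ≤ P (Metric.closedBall ((z - a) / s) (2 * ε / s)) := by
            refine measure_mono fun u hu => ?_
            have hu' : dist (a + s * u) z ≤ 2 * ε := hu
            rw [Real.dist_eq] at hu'
            rw [Metric.mem_closedBall, Real.dist_eq, le_div_iff₀ s0]
            calc |u - (z - a) / s| * s = |(u - (z - a) / s) * s| := by
                  rw [abs_mul, abs_of_pos s0]
              _ = |a + s * u - z| := by congr 1; field_simp; ring
              _ ≤ _ := hu'
        _ ≤ ∫⁻ u in Metric.closedBall ((z - a) / s) (2 * ε / s), ENNReal.ofReal 21 := by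
            rw [hP, withDensity_apply _ Metric.isClosed_closedBall.measurableSet]
            refine lintegral_mono fun u => ENNReal.ofReal_le_ofReal ?_
            have : Real.exp (-|u|) ≤ 1 := Real.exp_le_one_iff.2 (by simp)
            linarith [hρ.le_exp u]
        _ = _ := by
            rw [setLIntegral_const, Real.volume_closedBall, ← ENNReal.ofReal_mul (by norm_num)]
            congr 1; ring
    have h3 : (η.prod laplaceMeasure).real {w | w.1 + ε * w.2 ∈ Metric.closedBall z (2 * ε)} ≤
        84 * ε / s := by
      rw [Measure.real, hS _ Metric.isClosed_closedBall.measurableSet]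
      exact ENNReal.toReal_le_of_le_ofReal (by positivity) h2
    have h4 := mul_le_mul_of_nonneg_left one_third_le_laplaceMeasure x0
    have h5 : x * (1 / 3) ≤ 84 * ε / s := by linarith
    rw [le_div_iff₀ s0] at h5
    linarith
  have hvs : v ≤ 84 * K * s ^ 2 + 2 * K * ε ^ 2 := by
    have i1 : Integrable (fun w : ℝ × ℝ => w.1 ^ 2) (η.prod laplaceMeasure) := hi.comp_fst _
    have i2 : Integrable (fun w : ℝ × ℝ => w.2 ^ 2) (η.prod laplaceMeasure) :=
      integrable_sq_laplaceMeasure.comp_snd _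
    have i3 : Integrable (fun u : ℝ => (a + s * u - a) ^ 2) P := by
      refine ((hρ.integrable integrable_sq_laplaceMeasure).const_mul (s ^ 2)).congr
        (Filter.Eventually.of_forall fun u => ?_)
      simp only; ring
    obtain ⟨hg1, hg2⟩ := h (fun y => (y - a) ^ 2) (by fun_prop)
    have i4 := hg1.2 i3
    calc v ≤ ∫ y, (y - a) ^ 2 ∂η := hv a
      _ = ∫ w, (w.1 - a) ^ 2 ∂(η.prod laplaceMeasure) := by
          rw [integral_fun_fst (f := fun y : ℝ => (y - a) ^ 2)]; simp
      _ ≤ ∫ w, (2 * (w.1 + ε * w.2 - a) ^ 2 + 2 * ε ^ 2 * w.2 ^ 2) ∂(η.prod laplaceMeasure) := by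
          refine integral_mono_of_nonneg (Filter.Eventually.of_forall fun w => sq_nonneg _)
            ((i4.const_mul 2).add (i2.const_mul _)) (Filter.Eventually.of_forall fun w => ?_)
          simp only
          nlinarith [sq_nonneg (w.1 - a + 2 * (ε * w.2))]
      _ = 2 * ∫ u, (a + s * u - a) ^ 2 ∂P + 2 * ε ^ 2 * K := by
          rw [integral_add (i4.const_mul 2) (i2.const_mul _), integral_const_mul,
            integral_const_mul, hg2, integral_fun_snd (f := fun y : ℝ => y ^ 2)]
          simp [hK]
      _ = 2 * (s ^ 2 * ∫ u, u ^ 2 ∂P) + 2 * ε ^ 2 * K := by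
          rw [← integral_const_mul (s ^ 2)]
          congr 3; ext u; ring
      _ ≤ 2 * (s ^ 2 * (42 * K)) + 2 * ε ^ 2 * K := by
          gcongr
          exact hρ.integral_le integrable_sq_laplaceMeasure fun u => sq_nonneg u
      _ = _ := by ring
  calc x ^ 2 * v ≤ x ^ 2 * (84 * K * s ^ 2 + 2 * K * ε ^ 2) := by gcongr
    _ = 84 * K * (x * s) ^ 2 + 2 * K * ε ^ 2 * x ^ 2 := by ring
    _ ≤ 84 * K * (252 * ε) ^ 2 + 2 * K * ε ^ 2 * 1 := by
        gcongr
        exact pow_le_one₀ x0 x1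
    _ ≤ _ := by nlinarith [sq_nonneg ε]

/-- Reverse Hölder inequality between the second and sixth moments. -/
theorem exists_isPL_sixth_moment_le : ∃ C : ℝ, 0 < C ∧ ∀ (η : Measure ℝ) [IsProbabilityMeasure η],
    IsPL η → Integrable (fun y => y ^ 2) η → ∫ y, y ^ 2 ∂η ≤ 1 →
    Integrable (fun y => y ^ 6) η ∧ ∫ y, y ^ 6 ∂η ≤ C := by
  set K := ∫ u : ℝ, u ^ 2 ∂laplaceMeasure with hK
  set K' := ∫ u : ℝ, (1 + |u|) ^ 6 ∂laplaceMeasure with hK'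
  have K0 : 0 ≤ K := integral_nonneg fun u => sq_nonneg u
  have K0' : 0 ≤ K' := integral_nonneg fun u => by positivity
  set D := 640000 * (1 + (2 + 2 * K)) with hD
  refine ⟨32 * (D ^ 6 * (42 * K')) + 32 * K' + 1, by positivity, fun η _ hη hi h1 => ?_⟩
  obtain ⟨a, s, ρ, s0, hρ, -, h, -⟩ := hη.exists_isUnitDensity_integral one_pos
  have := hρ.isProbabilityMeasure
  set P := volume.withDensity fun u => ENNReal.ofReal (ρ u) with hP
  simp only [one_mul] at h
  have i1 : Integrable (fun w : ℝ × ℝ => w.1 ^ 2) (η.prod laplaceMeasure) := hi.comp_fst _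
  have i2 : Integrable (fun w : ℝ × ℝ => w.2 ^ 2) (η.prod laplaceMeasure) :=
    integrable_sq_laplaceMeasure.comp_snd _
  have hE2 : ∫ w, (w.1 + w.2) ^ 2 ∂(η.prod laplaceMeasure) ≤ 2 + 2 * K := by
    calc _ ≤ ∫ w, (2 * w.1 ^ 2 + 2 * w.2 ^ 2) ∂(η.prod laplaceMeasure) := by
          refine integral_mono_of_nonneg (Filter.Eventually.of_forall fun w => sq_nonneg _)
            ((i1.const_mul 2).add (i2.const_mul _)) (Filter.Eventually.of_forall fun w => ?_)
          simp only
          nlinarith [sq_nonneg (w.1 - w.2)]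
      _ = 2 * (∫ y, y ^ 2 ∂η) + 2 * K := by
          rw [integral_add (i1.const_mul 2) (i2.const_mul _), integral_const_mul,
            integral_const_mul, integral_fun_snd (f := fun y : ℝ => y ^ 2),
            integral_fun_fst (f := fun y : ℝ => y ^ 2)]
          simp [hK]
      _ ≤ _ := by linarith
  have lin : ∀ u : ℝ, a + s * u = a + s * u + 0 * u ^ 2 + 0 * u ^ 3 := fun u => by ring
  have il : Integrable (fun u : ℝ => a + s * u) laplaceMeasure := by
    exact (integrable_cubic_laplaceMeasure a s 0 0).congr
      (Filter.Eventually.of_forall fun u => (lin u).symm)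
  have il2 : Integrable (fun u : ℝ => (a + s * u) ^ 2) laplaceMeasure := by
    refine (integrable_cubic_sq_laplaceMeasure a s 0 0).congr
      (Filter.Eventually.of_forall fun u => ?_)
    simp only [← lin]
  have hab : |a| + |s| ≤ D := by
    have h2 := hρ.setIntegral_unitInterval_le (by fun_prop) il.abs fun _ => abs_nonneg _
    have h3 := sum_abs_coeff_le a s 0 0
    simp only [← lin, abs_zero, add_zero] at h3
    have h4 : ∫ u, |a + s * u| ∂P ≤ 1 + (2 + 2 * K) := by
      calc ∫ u, |a + s * u| ∂P ≤ ∫ u, (1 + (a + s * u) ^ 2) ∂P := by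
            refine integral_mono (hρ.integrable il).abs
              ((integrable_const _).add (hρ.integrable il2)) fun u => ?_
            simp only
            nlinarith [sq_abs (a + s * u), sq_nonneg (|a + s * u| - 1)]
        _ = 1 + ∫ u, (a + s * u) ^ 2 ∂P := by
            rw [integral_add (integrable_const _) (hρ.integrable il2)]; simp [hP]
        _ ≤ _ := by
            rw [← (h (fun y => y ^ 2) (by fun_prop)).2]
            linarith
    rw [hD]
    linarith
  have bd6 : ∀ u, (a + s * u) ^ 6 ≤ D ^ 6 * (1 + |u|) ^ 6 := fun u => by
    rw [← mul_pow, ← Even.pow_abs (by decide : Even 6)]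
    gcongr
    calc |a + s * u| ≤ |a| + |s| * |u| := by rw [← abs_mul]; exact abs_add_le _ _
      _ ≤ (|a| + |s|) * (1 + |u|) := by
          nlinarith [abs_nonneg a, abs_nonneg s, abs_nonneg u]
      _ ≤ D * (1 + |u|) := by gcongr
  have il6 : Integrable (fun u : ℝ => (a + s * u) ^ 6) laplaceMeasure := by
    refine ((integrable_pow_laplaceMeasure 6).const_mul (D ^ 6)).mono' (by fun_prop)
      (Filter.Eventually.of_forall fun u => ?_)
    rw [Real.norm_of_nonneg (by positivity)]
    exact bd6 u
  have il6' : Integrable (fun u : ℝ => u ^ 6) laplaceMeasure := by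
    refine (integrable_pow_laplaceMeasure 6).mono' (by fun_prop)
      (Filter.Eventually.of_forall fun u => ?_)
    rw [Real.norm_of_nonneg (by positivity), ← Even.pow_abs (by decide : Even 6)]
    gcongr
    linarith
  obtain ⟨hg1, hg2⟩ := h (fun y => y ^ 6) (by fun_prop)
  have i4 := hg1.2 (hρ.integrable il6)
  have i5 : Integrable (fun w : ℝ × ℝ => w.2 ^ 6) (η.prod laplaceMeasure) := il6'.comp_snd _
  have i6 := (i4.const_mul 32).add (i5.const_mul 32)
  have pw : ∀ w : ℝ × ℝ, w.1 ^ 6 ≤ 32 * (w.1 + w.2) ^ 6 + 32 * w.2 ^ 6 := fun w => by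
    have h1 : w.1 ^ 6 = |w.1 + w.2 + -w.2| ^ 6 := by
      rw [Even.pow_abs (by decide)]; ring
    have h2 := add_pow_le (abs_nonneg (w.1 + w.2)) (abs_nonneg w.2) 6
    calc w.1 ^ 6 ≤ (|w.1 + w.2| + |w.2|) ^ 6 := by
          rw [h1]; gcongr; exact (abs_add_le _ _).trans_eq (by rw [abs_neg])
      _ ≤ _ := by
          rw [Even.pow_abs (by decide), Even.pow_abs (by decide)] at h2
          norm_num at h2
          linarith
  have i7 : Integrable (fun w : ℝ × ℝ => w.1 ^ 6) (η.prod laplaceMeasure) :=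
    i6.mono' (by fun_prop) (Filter.Eventually.of_forall fun w => by
      rw [Real.norm_of_nonneg (by positivity)]; exact pw w)
  constructor
  · have := (measurePreserving_fst (μ := η) (ν := laplaceMeasure)).integrable_comp
      (g := fun y : ℝ => y ^ 6) (by fun_prop)
    exact this.1 i7
  · calc ∫ y, y ^ 6 ∂η = ∫ w, w.1 ^ 6 ∂(η.prod laplaceMeasure) := by
          rw [integral_fun_fst (f := fun y : ℝ => y ^ 6)]; simp
      _ ≤ ∫ w, (32 * (w.1 + w.2) ^ 6 + 32 * w.2 ^ 6) ∂(η.prod laplaceMeasure) :=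
          integral_mono i7 i6 pw
      _ = 32 * ∫ u, (a + s * u) ^ 6 ∂P + 32 * ∫ u, u ^ 6 ∂laplaceMeasure := by
          rw [integral_add (i4.const_mul 32) (i5.const_mul _), integral_const_mul,
            integral_const_mul, hg2, integral_fun_snd (f := fun y : ℝ => y ^ 6)]
          simp
      _ ≤ 32 * (42 * (D ^ 6 * K')) + 32 * K' := by
          gcongr
          · refine (hρ.integral_le il6 fun u => by positivity).trans ?_
            gcongr
            rw [hK', ← integral_const_mul]
            exact integral_mono il6 ((integrable_pow_laplaceMeasure 6).const_mul _) bd6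
          · refine integral_mono il6' (integrable_pow_laplaceMeasure 6) fun u => ?_
            simp only
            rw [← Even.pow_abs (by decide : Even 6)]
            gcongr
            linarith
      _ ≤ _ := by linarith

/-- Probability measures supported in a ball which have the Prékopa-Leindler property and satisfy a
linear constraint. -/
structure IsAdmissible {n : ℕ} (R : ℝ) (h : (Fin n → ℝ) → ℝ) (ν : Measure (Fin n → ℝ)) :
    Prop where
  prob : IsProbabilityMeasure ν
  isPL : IsPL ν
  ae_norm_le : ∀ᵐ x ∂ν, ‖x‖ ≤ R
  integral_eq : ∫ x, h x ∂ν = 0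

theorem integrable_of_ae_norm_le {n : ℕ} {R : ℝ} {ν : Measure (Fin n → ℝ)} [IsFiniteMeasure ν]
    (hR : ∀ᵐ x ∂ν, ‖x‖ ≤ R) {V : Type*} [NormedAddCommGroup V] [SecondCountableTopology V]
    {g : (Fin n → ℝ) → V} (hg : Continuous g) : Integrable g ν := by
  obtain ⟨B, hB⟩ := ((isCompact_closedBall (0 : Fin n → ℝ) R).image hg).isBounded.exists_norm_le
  refine Integrable.of_bound hg.aestronglyMeasurable B ?_
  filter_upwards [hR] with x hx
  exact hB _ ⟨x, by simpa using hx, rfl⟩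

theorem continuous_integral_probabilityMeasure {X : Type*} [TopologicalSpace X] [CompactSpace X]
    [MeasurableSpace X] [BorelSpace X] {g : X → ℝ} (hg : Continuous g) :
    Continuous fun ν : ProbabilityMeasure X => ∫ x, g x ∂(ν : Measure X) := by
  refine continuous_iff_continuousAt.2 fun ν => ?_
  exact (ProbabilityMeasure.tendsto_iff_forall_integral_tendsto.1
    (Filter.tendsto_id (x := nhds ν))) (BoundedContinuousFunction.mkOfCompact ⟨g, hg⟩)

theorem IsAdmissible.exists_max {n : ℕ} {R : ℝ} {h G : (Fin n → ℝ) → ℝ} (hh : Continuous h)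
    (hG : Continuous G) (ε : ℝ) {μ : Measure (Fin n → ℝ)} (hμ : IsAdmissible R h μ) :
    ∃ ν0, IsAdmissible R h ν0 ∧ ∀ ν, IsAdmissible R h ν →
      ∫ x, G x ∂ν + ε * ∑ i, (∫ x, x i ∂ν) ^ 2 ≤ ∫ x, G x ∂ν0 + ε * ∑ i, (∫ x, x i ∂ν0) ^ 2 := by
  set K := Metric.closedBall (0 : Fin n → ℝ) R with hK
  have mK : MeasurableSet K := Metric.isClosed_closedBall.measurableSet
  have : CompactSpace K := isCompact_iff_compactSpace.1 (isCompact_closedBall 0 R)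
  set v : K → (Fin n → ℝ) := Subtype.val with hv
  have cv : Continuous v := continuous_subtype_val
  have lift : ∀ ν, IsAdmissible R h ν → ∃ ν' : ProbabilityMeasure K, (ν' : Measure K).map v = ν := by
    intro ν hν
    have := hν.prob
    have hr : ν.restrict K = ν := by
      refine Measure.restrict_eq_self_of_ae_mem ?_
      filter_upwards [hν.ae_norm_le] with x hx
      simpa [hK] using hx
    have hm := map_comap_subtype_coe mK ν
    rw [hr] at hm
    have hp : IsProbabilityMeasure (ν.comap v) := by
      constructor
      rw [hv, comap_subtype_coe_apply mK, Set.image_univ, Subtype.range_coe,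
        ← Measure.restrict_apply_univ, hr, measure_univ]
    exact ⟨⟨ν.comap v, hp⟩, hm⟩
  have im : ∀ (ν' : ProbabilityMeasure K) {g : (Fin n → ℝ) → ℝ}, Continuous g →
      ∫ x, g x ∂((ν' : Measure K).map v) = ∫ x, g (v x) ∂(ν' : Measure K) := fun ν' g hg =>
    integral_map cv.measurable.aemeasurable hg.aestronglyMeasurable
  set S : Set (ProbabilityMeasure K) := {ν | IsPL ((ν : Measure K).map v)} ∩
    {ν | ∫ x, h (v x) ∂(ν : Measure K) = 0} with hS
  have cS : IsCompact S := ((isClosed_setOf_isPL cv).inter (isClosed_singleton.preimage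
    (continuous_integral_probabilityMeasure (hh.comp cv)))).isCompact
  have cJ : Continuous fun ν : ProbabilityMeasure K => ∫ x, G (v x) ∂(ν : Measure K) +
      ε * ∑ i, (∫ x, v x i ∂(ν : Measure K)) ^ 2 := by
    refine (continuous_integral_probabilityMeasure (hG.comp cv)).add
      ((continuous_finsetSum _ fun i _ => ?_).const_mul ε)
    exact (continuous_integral_probabilityMeasure ((continuous_apply i).comp cv)).pow 2
  have memS : ∀ ν' : ProbabilityMeasure K, IsAdmissible R h ((ν' : Measure K).map v) → ν' ∈ S :=
    fun ν' hν' => ⟨hν'.isPL, by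
      change ∫ x, h (v x) ∂(ν' : Measure K) = 0
      rw [← im ν' hh]
      exact hν'.integral_eq⟩
  obtain ⟨μ', rfl⟩ := lift μ hμ
  obtain ⟨ν0, h0, hmax⟩ := cS.exists_isMaxOn ⟨μ', memS μ' hμ⟩ cJ.continuousOn
  have J : ∀ ν' : ProbabilityMeasure K, ∫ x, G x ∂((ν' : Measure K).map v) +
      ε * ∑ i, (∫ x, x i ∂((ν' : Measure K).map v)) ^ 2 = ∫ x, G (v x) ∂(ν' : Measure K) +
      ε * ∑ i, (∫ x, v x i ∂(ν' : Measure K)) ^ 2 := fun ν' => by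
    rw [im ν' hG]
    simp only [im ν' (continuous_apply _)]
  refine ⟨(ν0 : Measure K).map v, ⟨Measure.isProbabilityMeasure_map cv.measurable.aemeasurable,
    h0.1, ?_, ?_⟩, fun ν hν => ?_⟩
  · rw [ae_map_iff cv.measurable.aemeasurable
      (measurableSet_le measurable_norm measurable_const)]
    exact Filter.Eventually.of_forall fun x => mem_closedBall_zero_iff.1 x.2
  · rw [im ν0 hh]
    exact h0.2
  · obtain ⟨ν', rfl⟩ := lift ν hν
    rw [J, J]
    exact hmax (memS ν' hν)

theorem IsPL.measure_singleton_eq_zero {η : Measure ℝ} [IsProbabilityMeasure η] (hη : IsPL η)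
    (hi1 : Integrable (fun y => y) η) (hi : Integrable (fun y => y ^ 2) η) (h0 : ∫ y, y ∂η = 0)
    (hne : ¬ ∀ᵐ y ∂η, y = 0) : η {0} = 0 := by
  obtain ⟨C, C0, hC⟩ := exists_isPL_small_ball
  set v := ∫ y, y ^ 2 ∂η with hv
  have v0 : 0 < v := by
    refine lt_of_le_of_ne (integral_nonneg fun y => sq_nonneg y) fun h => hne ?_
    have := (integral_eq_zero_iff_of_nonneg (fun y => sq_nonneg y) hi).1 h.symm
    filter_upwards [this] with y hy
    exact pow_eq_zero_iff (two_ne_zero) |>.1 hy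
  have hvb : ∀ b, v ≤ ∫ y, (y - b) ^ 2 ∂η := by
    intro b
    have e : ∫ y, (y - b) ^ 2 ∂η = v + b ^ 2 := by
      calc ∫ y, (y - b) ^ 2 ∂η = ∫ y, (y ^ 2 + (-(2 * b) * y + b ^ 2)) ∂η := by
            congr 1; ext y; ring
        _ = _ := by
            have i2 : Integrable (fun y => -(2 * b) * y + b ^ 2) η :=
              (hi1.const_mul _).add (integrable_const _)
            rw [integral_add hi i2, integral_add (hi1.const_mul _) (integrable_const _),
              integral_const_mul, h0]
            simp [hv]
    rw [e]
    linarith [sq_nonneg b]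
  have key : ∀ ε : ℝ, 0 < ε → η.real {0} ^ 2 * v ≤ C * ε ^ 2 := fun ε hε => by
    refine le_trans ?_ (hC η hη hi v hvb 0 ε hε)
    gcongr
    · simp
    · simpa using hε.le
  have lim : Filter.Tendsto (fun ε : ℝ => C * ε ^ 2) (nhdsWithin 0 (Set.Ioi 0)) (nhds (C * 0 ^ 2)) :=
    ((by fun_prop : Continuous fun ε : ℝ => C * ε ^ 2).tendsto 0).mono_left nhdsWithin_le_nhds
  have h1 : η.real {0} ^ 2 * v ≤ C * 0 ^ 2 :=
    ge_of_tendsto lim (Filter.eventually_of_mem self_mem_nhdsWithin fun ε hε => key ε hε)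
  have h2 : η.real {0} = 0 := by
    have h3 : η.real {0} ^ 2 ≤ 0 := by
      by_contra hc
      push Not at hc
      nlinarith [mul_pos hc v0]
    exact pow_eq_zero_iff two_ne_zero |>.1 (le_antisymm h3 (sq_nonneg _))
  simpa [Measure.real, ENNReal.toReal_eq_zero_iff] using h2

theorem IsAdmissible.exists_linear_relation {n : ℕ} {R : ℝ} {h G : (Fin n → ℝ) → ℝ}
    (hh : Continuous h) (hG : Continuous G) {ε : ℝ} (hε : 0 < ε) {ν : Measure (Fin n → ℝ)}
    (hν : IsAdmissible R h ν) (hmax : ∀ ν', IsAdmissible R h ν' →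
      ∫ x, G x ∂ν' + ε * ∑ i, (∫ x, x i ∂ν') ^ 2 ≤ ∫ x, G x ∂ν + ε * ∑ i, (∫ x, x i ∂ν) ^ 2)
    (i j : Fin n) : ∃ α β : ℝ, (α, β) ≠ 0 ∧
      ∀ᵐ x ∂ν, α * (x i - ∫ x, x i ∂ν) + β * (x j - ∫ x, x j ∂ν) = 0 := by
  have := hν.prob
  have int : ∀ {g : (Fin n → ℝ) → ℝ}, Continuous g → Integrable g ν := fun hg =>
    integrable_of_ae_norm_le hν.ae_norm_le hg
  by_contra hcon
  set m : Fin n → ℝ := fun k => ∫ x, x k ∂ν with hm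
  set u : ℝ → (Fin n → ℝ) → ℝ := fun θ x =>
    Real.cos θ * (x i - m i) + Real.sin θ * (x j - m j) with hu
  have cu : ∀ θ, Continuous (u θ) := fun θ => by simp only [hu]; fun_prop
  have au : ∀ θ, IsAffine (u θ) := fun θ x y l => by
    simp only [hu, Pi.add_apply, Pi.smul_apply, smul_eq_mul]; ring
  have mu0 : ∀ θ, ∫ x, u θ x ∂ν = 0 := fun θ => by
    have e : ∀ k, ∫ x, (x k - m k) ∂ν = 0 := fun k => by
      rw [integral_sub (int (continuous_apply k)) (integrable_const _)]
      simp [hm]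
    simp only [hu]
    rw [integral_add (int (by fun_prop)) (int (by fun_prop)), integral_const_mul,
      integral_const_mul, e, e]
    simp
  have une : ∀ θ, ¬ ∀ᵐ x ∂ν, u θ x = 0 := by
    intro θ hθ
    refine hcon ⟨Real.cos θ, Real.sin θ, fun h0 => ?_, hθ⟩
    have h1 := Real.sin_sq_add_cos_sq θ
    rw [Prod.mk_eq_zero] at h0
    rw [h0.1, h0.2] at h1
    norm_num at h1
  have null : ∀ θ, ∀ᵐ x ∂ν, u θ x ≠ 0 := by
    intro θ
    have mm := (cu θ).measurable
    have hp : IsProbabilityMeasure (ν.map (u θ)) :=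
      Measure.isProbabilityMeasure_map mm.aemeasurable
    have h1 := (hν.isPL.map (au θ) (cu θ)).measure_singleton_eq_zero
      ((integrable_map_measure (by fun_prop) mm.aemeasurable).2 (int (cu θ)))
      ((integrable_map_measure (by fun_prop) mm.aemeasurable).2 (int ((cu θ).pow 2)))
      (by rw [integral_map mm.aemeasurable (by fun_prop)]; exact mu0 θ)
      (fun hc => une θ ((ae_map_iff mm.aemeasurable (p := fun y => y = 0)
        (measurableSet_singleton 0)).1 hc))
    rw [Measure.map_apply mm (measurableSet_singleton _)] at h1
    rw [ae_iff]
    simp only [ne_eq, not_not]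
    exact h1
  have mset : ∀ θ, MeasurableSet {x | 0 ≤ u θ x} := fun θ =>
    measurableSet_le measurable_const (cu θ).measurable
  set F : ℝ → ℝ := fun θ => ∫ x, {x | 0 ≤ u θ x}.indicator h x ∂ν with hF
  have Fc : Continuous F := by
    refine continuous_iff_continuousAt.2 fun θ0 => ?_
    refine tendsto_integral_filter_of_dominated_convergence (fun x => ‖h x‖) ?_ ?_
      (int hh).norm ?_
    · exact Filter.Eventually.of_forall fun θ =>
        hh.aestronglyMeasurable.indicator (mset θ)
    · exact Filter.Eventually.of_forall fun θ => Filter.Eventually.of_forall fun x =>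
        norm_indicator_le_norm_self _ _
    · filter_upwards [null θ0] with x hx
      refine Filter.Tendsto.congr' ?_ tendsto_const_nhds
      have c2 : Continuous fun θ => u θ x := by simp only [hu]; fun_prop
      rcases lt_or_gt_of_ne hx with h1 | h1
      · filter_upwards [c2.continuousAt.eventually_lt_const h1] with θ hθ
        simp only [Set.indicator, Set.mem_ofPred_eq]
        rw [if_neg (not_le.2 h1), if_neg (not_le.2 hθ)]
      · filter_upwards [c2.continuousAt.eventually_const_lt h1] with θ hθ
        simp only [Set.indicator, Set.mem_ofPred_eq]
        rw [if_pos h1.le, if_pos hθ.le]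
  have Fpi : F Real.pi = -F 0 := by
    have e : F 0 + F Real.pi = 0 := by
      simp only [hF]
      rw [← integral_add ((int hh).indicator (mset _)) ((int hh).indicator (mset _))]
      refine (integral_congr_ae ?_).trans hν.integral_eq
      filter_upwards [null 0] with x hx
      have e1 : u Real.pi x = -u 0 x := by simp [hu]
      simp only [Set.indicator, Set.mem_ofPred_eq, e1]
      rcases lt_or_gt_of_ne hx with h1 | h1
      · rw [if_neg (not_le.2 h1), if_pos (by linarith : 0 ≤ -u 0 x), zero_add]
      · rw [if_pos h1.le, if_neg (by linarith : ¬ 0 ≤ -u 0 x), add_zero]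
    linarith
  obtain ⟨θ, hθ⟩ : ∃ θ, F θ = 0 := by
    by_cases h0 : F 0 ≤ 0
    · exact (intermediate_value_univ 0 Real.pi Fc) ⟨h0, by rw [Fpi]; linarith⟩
    · exact (intermediate_value_univ Real.pi 0 Fc) ⟨by rw [Fpi]; linarith, by linarith⟩
  set A := {x | 0 ≤ u θ x} with hA
  have mA : MeasurableSet A := mset θ
  have hA0 : ∫ x in A, h x ∂ν = 0 := by rw [← integral_indicator mA]; exact hθ
  have hB0 : ∫ x in Aᶜ, h x ∂ν = 0 := by
    have := integral_add_compl mA (int hh)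
    rw [hA0, hν.integral_eq, zero_add] at this
    exact this
  have plA : IsPL (ν.restrict A) := hν.isPL.restrict_halfspace (au θ) (cu θ)
  have plB : IsPL (ν.restrict Aᶜ) := by
    have e : ν.restrict Aᶜ = ν.restrict {x | 0 ≤ -u θ x} := by
      refine Measure.restrict_congr_set ?_
      filter_upwards [null θ] with x hx
      refine propext ⟨fun h1 => ?_, fun h1 => ?_⟩
      · have h2 : ¬ 0 ≤ u θ x := h1
        change 0 ≤ -u θ x
        linarith
      · have h2 : 0 ≤ -u θ x := h1
        change ¬ 0 ≤ u θ x
        exact fun h3 => hx (le_antisymm (by linarith) h3)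
    rw [e]
    exact hν.isPL.restrict_halfspace
      (fun x y l => by rw [au θ]; simp only [smul_eq_mul]; ring) (cu θ).neg
  have intu := int (cu θ)
  have sumu : ∫ x in A, u θ x ∂ν + ∫ x in Aᶜ, u θ x ∂ν = 0 := by
    rw [integral_add_compl mA intu, mu0]
  have posA : ν A ≠ 0 := by
    intro h0
    have h1 : ∫ x in A, u θ x ∂ν = 0 := by
      rw [Measure.restrict_eq_zero.2 h0, integral_zero_measure]
    have h2 : ∀ᵐ x ∂ν, 0 ≤ -u θ x := by
      filter_upwards [measure_eq_zero_iff_ae_notMem.1 h0] with x hx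
      have : ¬ 0 ≤ u θ x := hx
      linarith
    have h3 := (integral_eq_zero_iff_of_nonneg_ae h2 intu.neg).1
      (by rw [integral_neg, mu0, neg_zero])
    refine une θ ?_
    filter_upwards [h3] with x hx
    simpa using hx
  have intA : ∫ x in A, u θ x ∂ν ≠ 0 := by
    intro h1
    have h3 := (setIntegral_eq_zero_iff_of_nonneg_ae (s := A) (f := u θ) (μ := ν)
      ((ae_restrict_iff' mA).2 (Filter.Eventually.of_forall fun x hx => hx)) intu.integrableOn).1 h1
    have h4 := (ae_restrict_iff' mA).1 h3
    refine posA (measure_eq_zero_iff_ae_notMem.2 ?_)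
    filter_upwards [h4, null θ] with x h5 h6 h7
    exact h6 (h5 h7)
  have posB : ν Aᶜ ≠ 0 := by
    intro h0
    rw [Measure.restrict_eq_zero.2 h0, integral_zero_measure, add_zero] at sumu
    exact intA sumu
  have adm : ∀ S, ν S ≠ 0 → IsPL (ν.restrict S) → ∫ x in S, h x ∂ν = 0 →
      IsAdmissible R h ((ν S)⁻¹ • ν.restrict S) := fun S h0 hpl hS => by
    refine ⟨?_, hpl.smul _, ?_, ?_⟩
    · constructor
      rw [Measure.smul_apply, Measure.restrict_apply_univ, smul_eq_mul,
        ENNReal.inv_mul_cancel h0 (measure_ne_top _ _)]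
    · exact Measure.ae_smul_measure (ae_restrict_of_ae hν.ae_norm_le) _
    · rw [integral_smul_measure, hS, smul_zero]
  have JA := hmax _ (adm A posA plA hA0)
  have JB := hmax _ (adm Aᶜ posB plB hB0)
  set p := ν.real A with hp
  set q := ν.real Aᶜ with hq
  have p0 : 0 < p := ENNReal.toReal_pos posA (measure_ne_top _ _)
  have q0 : 0 < q := ENNReal.toReal_pos posB (measure_ne_top _ _)
  have pq : p + q = 1 := by
    rw [hp, hq, measureReal_add_measureReal_compl mA, probReal_univ]
  have intS : ∀ S (g : (Fin n → ℝ) → ℝ), ∫ x, g x ∂((ν S)⁻¹ • ν.restrict S) =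
      (ν.real S)⁻¹ * ∫ x in S, g x ∂ν := fun S g => by
    rw [integral_smul_measure, ENNReal.toReal_inv, smul_eq_mul, Measure.real]
  simp only [intS, ← hp, ← hq] at JA JB
  set a : Fin n → ℝ := fun k => ∫ x in A, x k ∂ν with ha
  set b : Fin n → ℝ := fun k => ∫ x in Aᶜ, x k ∂ν with hb
  have ab : ∀ k, a k + b k = m k := fun k => integral_add_compl mA (int (continuous_apply k))
  have Gab := integral_add_compl mA (int hG)
  have id1 : ∀ k, p * (p⁻¹ * a k) ^ 2 + q * (q⁻¹ * b k) ^ 2 - m k ^ 2 =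
      p * q * (p⁻¹ * a k - q⁻¹ * b k) ^ 2 := fun k => by
    rw [← ab k]
    have hq1 : q = 1 - p := by linarith
    have : 1 - p ≠ 0 := by rw [← hq1]; exact q0.ne'
    rw [hq1]
    field_simp
    ring
  have sum0 : ∑ k, p * q * (p⁻¹ * a k - q⁻¹ * b k) ^ 2 ≤ 0 := by
    simp only [← id1, Finset.sum_sub_distrib, Finset.sum_add_distrib, ← Finset.mul_sum]
    have h1 := mul_le_mul_of_nonneg_left JA p0.le
    have h2 := mul_le_mul_of_nonneg_left JB q0.le
    rw [mul_add, mul_inv_cancel_left₀ p0.ne'] at h1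
    rw [mul_add, mul_inv_cancel_left₀ q0.ne'] at h2
    have hq1 : q = 1 - p := by linarith
    refine le_of_mul_le_mul_left ?_ hε
    rw [hq1] at h2 ⊢
    linarith
  have eqk : ∀ k, a k = p * m k := fun k => by
    have h1 := (Finset.sum_eq_zero_iff_of_nonneg (fun k _ => by positivity)).1
      (le_antisymm sum0 (Finset.sum_nonneg fun k _ => by positivity)) k (Finset.mem_univ k)
    have h2 : p⁻¹ * a k - q⁻¹ * b k = 0 := by
      simpa [p0.ne', q0.ne'] using h1
    have h3 : q * a k = p * b k := by
      field_simp at h2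
      linarith
    rw [← ab k]
    calc a k = (p + q) * a k := by rw [pq, one_mul]
      _ = _ := by rw [add_mul, h3]; ring
  refine intA ?_
  have iA : ∀ k, ∫ x in A, (x k - m k) ∂ν = 0 := fun k => by
    rw [integral_sub (int (continuous_apply k)).integrableOn (integrable_const _)]
    rw [setIntegral_const, smul_eq_mul, ← hp]
    exact sub_eq_zero.2 (eqk k)
  simp only [hu]
  rw [integral_add (int (by fun_prop)).integrableOn (int (by fun_prop)).integrableOn,
    integral_const_mul, integral_const_mul, iA, iA]
  simp

theorem IsAdmissible.exists_ae_mem_line {n : ℕ} {R : ℝ} {h G : (Fin n → ℝ) → ℝ}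
    (hh : Continuous h) (hG : Continuous G) {ε : ℝ} (hε : 0 < ε) {ν : Measure (Fin n → ℝ)}
    (hν : IsAdmissible R h ν) (hmax : ∀ ν', IsAdmissible R h ν' →
      ∫ x, G x ∂ν' + ε * ∑ i, (∫ x, x i ∂ν') ^ 2 ≤ ∫ x, G x ∂ν + ε * ∑ i, (∫ x, x i ∂ν) ^ 2) :
    ∃ (T : (Fin n → ℝ) → ℝ) (x0 c : Fin n → ℝ), IsAffine T ∧ Continuous T ∧
      ∀ᵐ x ∂ν, x = x0 + T x • c := by
  set m : Fin n → ℝ := fun k => ∫ x, x k ∂ν with hm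
  by_cases hall : ∀ k, ∀ᵐ x ∂ν, x k - m k = 0
  · refine ⟨fun _ => 0, m, 0, fun x y l => by simp, continuous_const, ?_⟩
    filter_upwards [ae_all_iff.2 hall] with x hx
    ext k
    simpa using sub_eq_zero.1 (hx k)
  · obtain ⟨i, hi⟩ := not_forall.1 hall
    have rel : ∀ j, ∃ c : ℝ, ∀ᵐ x ∂ν, x j - m j = (x i - m i) * c := fun j => by
      obtain ⟨α, β, h0, hr⟩ := hν.exists_linear_relation hh hG hε hmax i j
      have hβ : β ≠ 0 := by
        rintro rfl
        have hα : α ≠ 0 := fun h1 => h0 (by rw [h1]; rfl)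
        refine hi ?_
        filter_upwards [hr] with x hx
        simpa [hα] using hx
      refine ⟨-α / β, ?_⟩
      filter_upwards [hr] with x hx
      field_simp
      linarith
    choose c hc using rel
    refine ⟨fun x => x i - m i, m, c, fun x y l => ?_, by fun_prop, ?_⟩
    · simp only [Pi.add_apply, Pi.smul_apply, smul_eq_mul]; ring
    · filter_upwards [ae_all_iff.2 hc] with x hx
      ext k
      simp only [Pi.add_apply, Pi.smul_apply, smul_eq_mul]
      linarith [hx k]

/-- Localization: an inequality between integrals of continuous functions against a compactly
supported log-concave measure follows from the same inequality along lines. -/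
theorem IsAdmissible.integral_nonpos {n : ℕ} {R : ℝ} {h G : (Fin n → ℝ) → ℝ}
    (hh : Continuous h) (hG : Continuous G) {μ : Measure (Fin n → ℝ)} (hμ : IsAdmissible R h μ)
    (needle : ∀ η : Measure ℝ, IsProbabilityMeasure η → IsPL η → ∀ r, (∀ᵐ y ∂η, |y| ≤ r) →
      ∀ x0 c : Fin n → ℝ, ∫ s, h (x0 + s • c) ∂η = 0 → ∫ s, G (x0 + s • c) ∂η ≤ 0) :
    ∫ x, G x ∂μ ≤ 0 := by
  have bound : ∀ ε : ℝ, 0 < ε → ∫ x, G x ∂μ ≤ ε * (n * R ^ 2) := by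
    intro ε hε
    obtain ⟨ν, hν, hmax⟩ := hμ.exists_max hh hG ε
    have := hν.prob
    obtain ⟨T, x0, c, aT, cT, hT⟩ := hν.exists_ae_mem_line hh hG hε hmax
    have mT := cT.measurable.aemeasurable (μ := ν)
    have push : ∀ {g : (Fin n → ℝ) → ℝ}, Continuous g →
        ∫ s, g (x0 + s • c) ∂(ν.map T) = ∫ x, g x ∂ν := fun {g} hg => by
      rw [integral_map mT (by
        have : Continuous fun s : ℝ => g (x0 + s • c) := by fun_prop
        exact this.aestronglyMeasurable)]
      refine integral_congr_ae ?_
      filter_upwards [hT] with x hx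
      rw [← hx]
    obtain ⟨B, hB⟩ := ((isCompact_closedBall (0 : Fin n → ℝ) R).image cT).isBounded.exists_norm_le
    have hb : ∀ᵐ y ∂(ν.map T), |y| ≤ B := by
      rw [ae_map_iff mT (measurableSet_le (by fun_prop) measurable_const)]
      filter_upwards [hν.ae_norm_le] with x hx
      exact hB _ ⟨x, by simpa using hx, rfl⟩
    have h1 := needle (ν.map T) (Measure.isProbabilityMeasure_map mT) (hν.isPL.map aT cT) B hb x0 c
      (by rw [push hh]; exact hν.integral_eq)
    rw [push hG] at h1
    have h2 := hmax μ hμ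
    have h3 : ∑ i, (∫ x, x i ∂ν) ^ 2 ≤ n * R ^ 2 := by
      have h4 : ∀ i ∈ Finset.univ, (∫ x, x i ∂ν) ^ 2 ≤ R ^ 2 := fun i _ => by
        have h5 : ‖∫ x, x i ∂ν‖ ≤ R := by
          refine (norm_integral_le_of_norm_le_const (C := R) ?_).trans (by simp)
          filter_upwards [hν.ae_norm_le] with x hx
          exact (norm_le_pi_norm x i).trans hx
        rw [← sq_abs]
        exact pow_le_pow_left₀ (abs_nonneg _) h5 2
      simpa using Finset.sum_le_sum h4
    have h6 : 0 ≤ ε * ∑ i, (∫ x, x i ∂μ) ^ 2 := by positivity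
    have h7 := mul_le_mul_of_nonneg_left h3 hε.le
    linarith
  have lim : Filter.Tendsto (fun ε : ℝ => ε * (n * R ^ 2)) (nhdsWithin 0 (Set.Ioi 0))
      (nhds (0 * (n * R ^ 2))) :=
    ((by fun_prop : Continuous fun ε : ℝ => ε * (n * R ^ 2)).tendsto 0).mono_left
      nhdsWithin_le_nhds
  rw [zero_mul] at lim
  exact ge_of_tendsto lim (Filter.eventually_of_mem self_mem_nhdsWithin bound)

/-- Functions whose restrictions to lines are polynomials of degree at most three. -/
def IsCubicOnLines {n : ℕ} (f : (Fin n → ℝ) → ℝ) : Prop :=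
  ∀ x0 c : Fin n → ℝ, ∃ r0 r1 r2 r3 : ℝ, ∀ s : ℝ,
    f (x0 + s • c) = r0 + r1 * s + r2 * s ^ 2 + r3 * s ^ 3

theorem IsCubicOnLines.sub_const {n : ℕ} {f : (Fin n → ℝ) → ℝ} (hf : IsCubicOnLines f) (a : ℝ) :
    IsCubicOnLines fun x => f x - a := fun x0 c => by
  obtain ⟨r0, r1, r2, r3, h⟩ := hf x0 c
  exact ⟨r0 - a, r1, r2, r3, fun s => by simp only [h]; ring⟩

theorem integrable_of_ae_abs_le {r : ℝ} {η : Measure ℝ} [IsFiniteMeasure η]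
    (hr : ∀ᵐ y ∂η, |y| ≤ r) {V : Type*} [NormedAddCommGroup V] [SecondCountableTopology V]
    {g : ℝ → V} (hg : Continuous g) : Integrable g η := by
  obtain ⟨B, hB⟩ := ((isCompact_closedBall (0 : ℝ) r).image hg).isBounded.exists_norm_le
  refine Integrable.of_bound hg.aestronglyMeasurable B ?_
  filter_upwards [hr] with x hx
  exact hB _ ⟨x, by simpa using hx, rfl⟩

theorem exists_cubic_sq_le : ∃ C : ℝ, 0 < C ∧ ∀ (n : ℕ) (μ : Measure (Fin n → ℝ)),
    IsProbabilityMeasure μ → IsPL μ → ∀ R, (∀ᵐ x ∂μ, ‖x‖ ≤ R) →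
    ∀ f, Continuous f → IsCubicOnLines f → ∫ x, f x ^ 2 ∂μ ≤ C * (∫ x, |f x| ∂μ) ^ 2 := by
  obtain ⟨C, C0, hC⟩ := exists_isPL_cubic_sq_le
  refine ⟨C, C0, fun n μ hp hpl R hR f cf hf => ?_⟩
  have int : ∀ {g : (Fin n → ℝ) → ℝ}, Continuous g → Integrable g μ := fun hg =>
    integrable_of_ae_norm_le hR hg
  set V := ∫ x, f x ^ 2 ∂μ with hV
  have hadm : IsAdmissible R (fun x => f x ^ 2 - V) μ := ⟨hp, hpl, hR, by
    rw [integral_sub (int (by fun_prop)) (integrable_const _)]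
    simp [hV]⟩
  have key := hadm.integral_nonpos (G := fun x => √(V / C) - |f x|) (by fun_prop) (by fun_prop)
    (fun η hη hηpl r hr x0 c h0 => by
      rw [integral_sub (integrable_of_ae_abs_le hr (by fun_prop)) (integrable_const _)] at h0
      rw [integral_sub (integrable_const _) (integrable_of_ae_abs_le hr (by fun_prop))]
      simp only [integral_const, probReal_univ, smul_eq_mul, one_mul, sub_nonpos,
        sub_eq_zero] at h0 ⊢
      obtain ⟨r0, r1, r2, r3, h⟩ := hf x0 c
      simp only [h] at h0 ⊢
      refine Real.sqrt_le_iff.2 ⟨by positivity, ?_⟩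
      rw [div_le_iff₀' C0, ← h0]
      exact hC η hηpl r hr r0 r1 r2 r3)
  rw [integral_sub (integrable_const _) (int cf.abs)] at key
  simp only [integral_const, probReal_univ, smul_eq_mul, one_mul, sub_nonpos] at key
  have := (Real.sqrt_le_iff.1 key).2
  rwa [div_le_iff₀' C0] at this

theorem rpow_neg_third_ge {z : ℝ} (hz : 0 < z) : (4 - z) / 3 ≤ z ^ (-(1 / 3 : ℝ)) := by
  have hw : 0 < z ^ (-(1 / 3 : ℝ)) := Real.rpow_pos_of_pos hz _
  have hw3 : (z ^ (-(1 / 3 : ℝ))) ^ 3 * z = 1 := by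
    rw [← Real.rpow_natCast, ← Real.rpow_mul hz.le]
    norm_num
    rw [Real.rpow_neg_one, inv_mul_cancel₀ hz.ne']
  set w := z ^ (-(1 / 3 : ℝ))
  have h1 : 0 ≤ (w - 1) ^ 2 * (3 * w ^ 2 + 2 * w + 1) := by positivity
  have h2 : 0 < w ^ 3 := by positivity
  refine le_of_mul_le_mul_left ?_ h2
  nlinarith

theorem one_add_integral_rpow_le {X : Type*} [MeasurableSpace X] {η : Measure X}
    [IsProbabilityMeasure η] {u : X → ℝ} (hu : Integrable u η) (hu0 : ∀ x, 0 ≤ u x) :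
    (1 + ∫ x, u x ∂η) ^ (-(1 / 3 : ℝ)) ≤ ∫ x, (1 + u x) ^ (-(1 / 3 : ℝ)) ∂η := by
  set B := 1 + ∫ x, u x ∂η with hB
  have B0 : 0 < B := by
    have : 0 ≤ ∫ x, u x ∂η := integral_nonneg hu0
    linarith
  have i1 : Integrable (fun x => 4 / 3 - (1 + u x) / (3 * B)) η :=
    (integrable_const _).sub (((integrable_const _).add hu).div_const _)
  have i2 : Integrable (fun x => (1 + u x) ^ (-(1 / 3 : ℝ))) η := by
    refine Integrable.of_bound ((hu.aemeasurable.const_add 1).pow_const _).aestronglyMeasurable 1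
      (Filter.Eventually.of_forall fun x => ?_)
    have h1 : (1 : ℝ) ≤ 1 + u x := by linarith [hu0 x]
    rw [Real.norm_eq_abs, abs_of_nonneg (Real.rpow_nonneg (by linarith) _)]
    exact Real.rpow_le_one_of_one_le_of_nonpos h1 (by norm_num)
  have e : ∫ x, B ^ (-(1 / 3 : ℝ)) * (4 / 3 - (1 + u x) / (3 * B)) ∂η = B ^ (-(1 / 3 : ℝ)) := by
    have i3 : Integrable (fun x => 1 + u x) η := (integrable_const _).add hu
    rw [integral_const_mul, integral_sub (integrable_const _) (i3.div_const _), integral_div, integral_div,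
      integral_add (integrable_const _) hu]
    simp only [integral_const, probReal_univ, smul_eq_mul, one_mul, ← hB]
    field_simp
    norm_num
  rw [← e]
  refine integral_mono (i1.const_mul _) i2 fun x => ?_
  have h1 : 0 < 1 + u x := by linarith [hu0 x]
  have h2 := rpow_neg_third_ge (div_pos h1 B0)
  have h3 : (1 + u x) ^ (-(1 / 3 : ℝ)) = B ^ (-(1 / 3 : ℝ)) * ((1 + u x) / B) ^ (-(1 / 3 : ℝ)) := by
    rw [← Real.mul_rpow B0.le (by positivity), mul_div_cancel₀ _ B0.ne']
  simp only [h3]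
  refine mul_le_mul_of_nonneg_left (le_trans (le_of_eq ?_) h2) (Real.rpow_nonneg B0.le _)
  field_simp

theorem continuous_one_add_rpow {X : Type*} [TopologicalSpace X] {u : X → ℝ} (hu : Continuous u)
    (hu0 : ∀ x, 0 ≤ u x) : Continuous fun x => (1 + u x) ^ (-(1 / 3 : ℝ)) :=
  (continuous_const.add hu).rpow_const fun x => Or.inl (by linarith [hu0 x] : 0 < 1 + u x).ne'

theorem exists_norm_eq_re_mul (z : ℂ) : ∃ w : ℂ, ‖w‖ = 1 ∧ (w * z).re = ‖z‖ := by
  by_cases hz : z = 0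
  · exact ⟨1, by simp [hz]⟩
  · refine ⟨(starRingEnd ℂ) z / ‖z‖, ?_, ?_⟩
    · simp [hz]
    · rw [div_mul_eq_mul_div, mul_comm, Complex.mul_conj, Complex.normSq_eq_norm_sq]
      norm_cast
      field_simp

theorem exists_cubic_norm_integral_exp_le : ∃ C : ℝ, 0 < C ∧ ∀ (n : ℕ) (μ : Measure (Fin n → ℝ)),
    IsProbabilityMeasure μ → IsPL μ → ∀ R, (∀ᵐ x ∂μ, ‖x‖ ≤ R) →
    ∀ f, Continuous f → IsCubicOnLines f → ∀ t a : ℝ,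
      3 * |∫ x, f x ∂μ - a| ≤ ∫ x, |f x - a| ∂μ →
      ‖∫ x, Complex.exp (Complex.I * t * (f x : ℂ)) ∂μ‖ ≤
        C * ∫ x, (1 + |t| * |f x - a|) ^ (-(1 / 3 : ℝ)) ∂μ := by
  obtain ⟨C, C0, hC⟩ := exists_isPL_cubic_decay
  refine ⟨(3 / 2 * C) ^ (1 / 3 : ℝ), by positivity, fun n μ hp hpl R hR f cf hf t a ha => ?_⟩
  set C' := (3 / 2 * C) ^ (1 / 3 : ℝ) with hC'
  have int : ∀ {V : Type} [NormedAddCommGroup V] [SecondCountableTopology V]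
    {g : (Fin n → ℝ) → V}, Continuous g → Integrable g μ := fun hg =>
    integrable_of_ae_norm_le hR hg
  set M := ∫ x, |f x - a| ∂μ with hM
  set β := (∫ x, f x ∂μ - a) / M with hβ
  have M0 : 0 ≤ M := integral_nonneg fun x => abs_nonneg _
  have hβM : β * M = ∫ x, f x ∂μ - a := by
    by_cases h0 : M = 0
    · rw [h0] at ha ⊢
      rw [mul_zero]
      exact (abs_nonpos_iff.1 (by linarith)).symm
    · exact div_mul_cancel₀ _ h0
  have hβ3 : |β| ≤ 1 / 3 := by
    rw [hβ, abs_div, abs_of_nonneg M0]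
    exact div_le_of_le_mul₀ M0 (by norm_num) (by linarith)
  have hadm : IsAdmissible R (fun x => f x - a - β * |f x - a|) μ := ⟨hp, hpl, hR, by
    rw [integral_sub (int (by fun_prop)) (int (by fun_prop)), integral_const_mul, hβM,
      integral_sub (int cf) (integrable_const _)]
    simp⟩
  obtain ⟨w, hw, hwz⟩ := exists_norm_eq_re_mul (∫ x, Complex.exp (Complex.I * t * (f x : ℂ)) ∂μ)
  have crp : ∀ {X : Type} [TopologicalSpace X] {u : X → ℝ}, Continuous u →
      Continuous fun x => (1 + |t| * |u x - a|) ^ (-(1 / 3 : ℝ)) := fun hu =>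
    continuous_one_add_rpow (by fun_prop) fun x => by positivity
  have key := hadm.integral_nonpos (G := fun x =>
      (w * Complex.exp (Complex.I * t * (f x : ℂ))).re -
        C' * (1 + |t| * |f x - a|) ^ (-(1 / 3 : ℝ))) (by fun_prop)
    (by have := crp cf; fun_prop)
    (fun η hη hηpl r hr x0 c h0 => by
      obtain ⟨r0, r1, r2, r3, h⟩ := hf x0 c
      simp only [h] at h0 ⊢
      set p : ℝ → ℝ := fun s => r0 + r1 * s + r2 * s ^ 2 + r3 * s ^ 3 with hpdef
      have cp : Continuous p := by simp only [hpdef]; fun_prop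
      have intη : ∀ {V : Type} [NormedAddCommGroup V] [SecondCountableTopology V]
        {g : ℝ → V}, Continuous g → Integrable g η := fun hg => integrable_of_ae_abs_le hr hg
      have dec := hC η hηpl r hr r0 r1 r2 r3 t _ rfl
      change ∫ s, (p s - a - β * |p s - a|) ∂η = 0 at h0
      change ‖∫ s, Complex.exp (Complex.I * t * (p s : ℂ)) ∂η‖ ^ 3 *
        (1 + |t| * ∫ s, |p s - ∫ s, p s ∂η| ∂η) ≤ C at dec
      change ∫ s, ((w * Complex.exp (Complex.I * t * (p s : ℂ))).re -
        C' * (1 + |t| * |p s - a|) ^ (-(1 / 3 : ℝ))) ∂η ≤ 0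
      set m := ∫ s, p s ∂η with hm
      set N := ∫ s, |p s - a| ∂η with hN
      have N0 : 0 ≤ N := integral_nonneg fun x => abs_nonneg _
      have hma : |m - a| ≤ 1 / 3 * N := by
        rw [integral_sub (intη (by fun_prop)) (intη (by fun_prop)), integral_const_mul,
          integral_sub (intη cp) (integrable_const _)] at h0
        simp only [integral_const, probReal_univ, smul_eq_mul, one_mul, ← hm, ← hN] at h0
        rw [sub_eq_zero.1 h0, abs_mul, abs_of_nonneg N0]
        exact mul_le_mul_of_nonneg_right hβ3 N0
      have hNm : N ≤ 3 / 2 * ∫ s, |p s - m| ∂η := by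
        have h1 : N ≤ ∫ s, (|p s - m| + |m - a|) ∂η :=
          integral_mono (intη (by fun_prop)) (intη (by fun_prop)) fun s =>
            abs_sub_le _ _ _
        rw [integral_add (intη (by fun_prop)) (integrable_const _)] at h1
        simp only [integral_const, probReal_univ, smul_eq_mul, one_mul] at h1
        linarith
      set Z := ∫ s, Complex.exp (Complex.I * t * (p s : ℂ)) ∂η with hZ
      have hZ3 : ‖Z‖ ^ 3 * (1 + |t| * N) ≤ 3 / 2 * C := by
        have h1 : 1 + |t| * N ≤ 3 / 2 * (1 + |t| * ∫ s, |p s - m| ∂η) := by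
          have := mul_le_mul_of_nonneg_left hNm (abs_nonneg t)
          linarith
        have := mul_le_mul_of_nonneg_left h1 (pow_nonneg (norm_nonneg Z) 3)
        linarith
      have hB : 0 < 1 + |t| * N := by positivity
      have hZ1 : ‖Z‖ ≤ C' * (1 + |t| * N) ^ (-(1 / 3 : ℝ)) := by
        have h1 : ‖Z‖ ^ 3 ≤ 3 / 2 * C * (1 + |t| * N)⁻¹ := by
          rw [← div_eq_mul_inv, le_div_iff₀ hB]
          exact hZ3
        have h2 := Real.rpow_le_rpow (by positivity) h1 (by norm_num : (0 : ℝ) ≤ 1 / 3)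
        rw [Real.mul_rpow (by positivity) (by positivity), Real.inv_rpow hB.le,
          ← Real.rpow_neg hB.le] at h2
        refine le_trans (le_of_eq ?_) h2
        rw [← Real.rpow_natCast, ← Real.rpow_mul (norm_nonneg _)]
        norm_num
      have hJ := one_add_integral_rpow_le (η := η) (u := fun s => |t| * |p s - a|)
        (intη (by fun_prop)) (fun s => by positivity)
      rw [integral_const_mul] at hJ
      have ir : ∫ s, (w * Complex.exp (Complex.I * t * (p s : ℂ))).re ∂η ≤ ‖Z‖ := by
        have h1 : ∫ s, (w * Complex.exp (Complex.I * t * (p s : ℂ))).re ∂η = (w * Z).re := by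
          rw [hZ, ← integral_const_mul]
          exact integral_re (𝕜 := ℂ) (intη
            (g := fun s => w * Complex.exp (Complex.I * t * (p s : ℂ))) (by fun_prop))
        rw [h1]
        refine (Complex.re_le_norm _).trans ?_
        rw [norm_mul, hw, one_mul]
      rw [integral_sub (intη (by fun_prop)) (intη ((crp cp).const_mul _)), integral_const_mul]
      have := mul_le_mul_of_nonneg_left hJ (by positivity : 0 ≤ C')
      linarith)
  rw [integral_sub (int (by fun_prop)) (int ((crp cf).const_mul _)), integral_const_mul] at key
  have h1 : ∫ x, (w * Complex.exp (Complex.I * t * (f x : ℂ))).re ∂μ =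
      (w * ∫ x, Complex.exp (Complex.I * t * (f x : ℂ)) ∂μ).re := by
    rw [← integral_const_mul]
    exact integral_re (𝕜 := ℂ) (int
      (g := fun x => w * Complex.exp (Complex.I * t * (f x : ℂ))) (by fun_prop))
  rw [h1, hwz] at key
  linarith

theorem setIntegral_one_add_rpow_le {T δ : ℝ} (hT : 0 < T) (hδ : 0 < δ) (y : ℝ) :
    ∫ a in Set.Icc (-δ) δ, (1 + T * |y - a|) ^ (-(1 / 3 : ℝ)) ≤ 5 * δ * (T * δ) ^ (-(1 / 3 : ℝ)) := by
  set κ := (T * δ) ^ (-(1 / 3 : ℝ)) with hκ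
  have κ0 : 0 ≤ κ := by positivity
  set g : ℝ → ℝ := (Set.Iic δ).indicator fun s => (1 + T * s) ^ (-(1 / 3 : ℝ)) with hg
  have cφ : Continuous fun s : ℝ => (1 + T * |s|) ^ (-(1 / 3 : ℝ)) :=
    continuous_one_add_rpow (by fun_prop) fun x => by positivity
  have habs : (fun s : ℝ => g |s|) =
      (Set.Icc (-δ) δ).indicator fun s => (1 + T * |s|) ^ (-(1 / 3 : ℝ)) := by
    ext s
    simp only [hg, Set.indicator, Set.mem_Iic, Set.mem_Icc, abs_le]
  have ig : Integrable fun s : ℝ => g |s| := by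
    rw [habs, integrable_indicator_iff measurableSet_Icc]
    exact cφ.continuousOn.integrableOn_compact isCompact_Icc
  have g0 : ∀ s, 0 ≤ s → 0 ≤ g s := fun s hs =>
    Set.indicator_apply_nonneg fun _ => by positivity
  have hgint : ∫ s, g |s| ≤ 3 * δ * κ := by
    have h1 : ∫ s in Set.Ioi 0, g s = ∫ s in Set.Ioc 0 δ, (1 + T * s) ^ (-(1 / 3 : ℝ)) := by
      rw [hg, setIntegral_indicator measurableSet_Iic, Set.Ioi_inter_Iic]
    have h2 : IntegrableOn (fun s : ℝ => T ^ (-(1 / 3 : ℝ)) * s ^ (-(1 / 3 : ℝ)))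
        (Set.Ioc 0 δ) := by
      refine Integrable.const_mul ?_ _
      exact (intervalIntegrable_iff_integrableOn_Ioc_of_le hδ.le).1
        (intervalIntegral.intervalIntegrable_rpow' (by norm_num))
    have h3 : IntegrableOn (fun s : ℝ => (1 + T * s) ^ (-(1 / 3 : ℝ))) (Set.Ioc 0 δ) := by
      refine ((cφ.continuousOn.integrableOn_compact (isCompact_Icc (a := 0) (b := δ))).mono_set
        Set.Ioc_subset_Icc_self).congr_fun (fun s hs => ?_) measurableSet_Ioc
      simp only [abs_of_pos hs.1]
    have h4 : ∫ s in Set.Ioc 0 δ, (1 + T * s) ^ (-(1 / 3 : ℝ)) ≤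
        ∫ s in Set.Ioc 0 δ, T ^ (-(1 / 3 : ℝ)) * s ^ (-(1 / 3 : ℝ)) := by
      refine setIntegral_mono_on h3 h2 measurableSet_Ioc fun s hs => ?_
      have s0 : 0 < s := hs.1
      rw [← Real.mul_rpow hT.le s0.le]
      exact Real.rpow_le_rpow_of_nonpos (by positivity) (by linarith) (by norm_num)
    have h5 : ∫ s in Set.Ioc 0 δ, T ^ (-(1 / 3 : ℝ)) * s ^ (-(1 / 3 : ℝ)) = 3 / 2 * δ * κ := by
      rw [integral_const_mul, ← intervalIntegral.integral_of_le hδ.le,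
        integral_rpow (Or.inl (by norm_num)), hκ, Real.mul_rpow hT.le hδ.le,
        Real.zero_rpow (by norm_num), Real.rpow_add_one hδ.ne']
      norm_num
      ring
    rw [integral_comp_abs, h1]
    linarith
  calc ∫ a in Set.Icc (-δ) δ, (1 + T * |y - a|) ^ (-(1 / 3 : ℝ))
      ≤ ∫ a in Set.Icc (-δ) δ, (κ + g |y - a|) := by
        refine setIntegral_mono ?_ ?_ fun a => ?_
        · exact ((cφ.comp (continuous_const.sub continuous_id)).continuousOn.integrableOn_compact
            isCompact_Icc)
        · exact (integrable_const _).add (ig.comp_sub_left y).integrableOn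
        · by_cases h : |y - a| ≤ δ
          · simp only [hg, Set.indicator, Set.mem_Iic, if_pos h]
            linarith
          · simp only [hg, Set.indicator, Set.mem_Iic, if_neg h, add_zero]
            refine Real.rpow_le_rpow_of_nonpos (by positivity) ?_ (by norm_num)
            have := mul_le_mul_of_nonneg_left (not_le.1 h).le hT.le
            linarith
    _ = 2 * δ * κ + ∫ a in Set.Icc (-δ) δ, g |y - a| := by
        rw [integral_add (integrable_const _) (ig.comp_sub_left y).integrableOn,
          setIntegral_const, Real.volume_real_Icc_of_le (by linarith), smul_eq_mul]
        ring
    _ ≤ 2 * δ * κ + ∫ a, g |y - a| := by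
        refine add_le_add_right ?_ _
        exact setIntegral_le_integral (ig.comp_sub_left y)
          (Filter.Eventually.of_forall fun a => g0 _ (abs_nonneg _))
    _ ≤ _ := by
        rw [integral_sub_left_eq_self (fun s => g |s|)]
        linarith

theorem exists_cubic_decay : ∃ C : ℝ, 0 < C ∧ ∀ (n : ℕ) (μ : Measure (Fin n → ℝ)),
    IsProbabilityMeasure μ → IsPL μ → ∀ R, (∀ᵐ x ∂μ, ‖x‖ ≤ R) →
    ∀ f, Continuous f → IsCubicOnLines f → ∀ t : ℝ,
      ‖∫ x, Complex.exp (Complex.I * t * (f x : ℂ)) ∂μ‖ ^ 6 *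
        (t ^ 2 * ∫ x, (f x - ∫ x, f x ∂μ) ^ 2 ∂μ) ≤ C := by
  obtain ⟨C1, C10, hC1⟩ := exists_cubic_sq_le
  obtain ⟨C2, C20, hC2⟩ := exists_cubic_norm_integral_exp_le
  refine ⟨C1 * (4 * (5 / 2 * C2) ^ 3) ^ 2, by positivity,
    fun n μ hp hpl R hR f cf hf t => ?_⟩
  have int : ∀ {V : Type} [NormedAddCommGroup V] [SecondCountableTopology V]
    {g : (Fin n → ℝ) → V}, Continuous g → Integrable g μ := fun hg =>
    integrable_of_ae_norm_le hR hg
  set m := ∫ x, f x ∂μ with hm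
  set M := ∫ x, |f x - m| ∂μ with hM
  set Z := ∫ x, Complex.exp (Complex.I * t * (f x : ℂ)) ∂μ with hZ
  have M0 : 0 ≤ M := integral_nonneg fun x => abs_nonneg _
  have hV : ∫ x, (f x - m) ^ 2 ∂μ ≤ C1 * M ^ 2 :=
    hC1 n μ hp hpl R hR (fun x => f x - m) (by fun_prop) (hf.sub_const m)
  suffices hs : ‖Z‖ ^ 3 * (|t| * M) ≤ 4 * (5 / 2 * C2) ^ 3 by
    calc ‖Z‖ ^ 6 * (t ^ 2 * ∫ x, (f x - m) ^ 2 ∂μ) ≤ ‖Z‖ ^ 6 * (t ^ 2 * (C1 * M ^ 2)) := by gcongr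
      _ = C1 * (‖Z‖ ^ 3 * (|t| * M)) ^ 2 := by rw [← sq_abs t]; ring
      _ ≤ _ := by gcongr
  rcases M0.eq_or_lt with h0 | hMpos
  · rw [← h0, mul_zero, mul_zero]
    positivity
  by_cases ht : t = 0
  · rw [ht, abs_zero, zero_mul, mul_zero]
    positivity
  have hT : 0 < |t| := abs_pos.2 ht
  set δ := M / 4 with hδ
  have δ0 : 0 < δ := by positivity
  have pt : ∀ a ∈ Set.Icc (-δ) δ,
      ‖Z‖ ≤ C2 * ∫ x, (1 + |t| * |f x - m - a|) ^ (-(1 / 3 : ℝ)) ∂μ := fun a ha => by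
    have ha' : |a| ≤ δ := abs_le.2 ha
    have h1 : M ≤ ∫ x, (|f x - (m + a)| + |a|) ∂μ :=
      integral_mono (int (by fun_prop)) (int (by fun_prop)) fun x => by
        have h2 : f x - m = f x - (m + a) + a := by ring
        simp only [h2]
        exact abs_add_le _ _
    rw [integral_add (int (by fun_prop)) (integrable_const _)] at h1
    simp only [integral_const, probReal_univ, smul_eq_mul, one_mul] at h1
    have h3 := hC2 n μ hp hpl R hR f cf hf t (m + a) (by
      rw [← hm, show m - (m + a) = -a by ring, abs_neg]
      linarith)
    simpa only [sub_add_eq_sub_sub] using h3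
  have cφ : Continuous fun p : ℝ × (Fin n → ℝ) =>
      (1 + |t| * |f p.2 - m - p.1|) ^ (-(1 / 3 : ℝ)) :=
    continuous_one_add_rpow (by fun_prop) fun x => by positivity
  have φ1 : ∀ p : ℝ × (Fin n → ℝ), ‖(1 + |t| * |f p.2 - m - p.1|) ^ (-(1 / 3 : ℝ))‖ ≤ 1 := fun p => by
    have h1 : 0 ≤ |t| * |f p.2 - m - p.1| := by positivity
    rw [Real.norm_eq_abs, abs_of_nonneg (by positivity)]
    exact Real.rpow_le_one_of_one_le_of_nonpos (by linarith) (by norm_num)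
  have iφ : Integrable (fun p : ℝ × (Fin n → ℝ) => (1 + |t| * |f p.2 - m - p.1|) ^ (-(1 / 3 : ℝ)))
      ((volume.restrict (Set.Icc (-δ) δ)).prod μ) :=
    Integrable.of_bound cφ.aestronglyMeasurable 1 (Filter.Eventually.of_forall φ1)
  have avg : 2 * δ * ‖Z‖ ≤ C2 * (5 * δ * (|t| * δ) ^ (-(1 / 3 : ℝ))) := by
    calc 2 * δ * ‖Z‖ = ∫ a in Set.Icc (-δ) δ, ‖Z‖ := by
          rw [setIntegral_const, Real.volume_real_Icc_of_le (by linarith), smul_eq_mul]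
          ring
      _ ≤ ∫ a in Set.Icc (-δ) δ, C2 * ∫ x, (1 + |t| * |f x - m - a|) ^ (-(1 / 3 : ℝ)) ∂μ :=
          setIntegral_mono_on (integrable_const _) (iφ.integral_prod_left.const_mul _)
            measurableSet_Icc pt
      _ = C2 * ∫ x, (∫ a in Set.Icc (-δ) δ, (1 + |t| * |f x - m - a|) ^ (-(1 / 3 : ℝ))) ∂μ := by
          rw [integral_const_mul, integral_integral_swap iφ]
      _ ≤ C2 * ∫ x, 5 * δ * (|t| * δ) ^ (-(1 / 3 : ℝ)) ∂μ := by
          refine mul_le_mul_of_nonneg_left (integral_mono iφ.integral_prod_right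
            (integrable_const _) fun x => ?_) C20.le
          exact setIntegral_one_add_rpow_le hT δ0 _
      _ = _ := by simp
  set κ := (|t| * δ) ^ (-(1 / 3 : ℝ)) with hκ
  have κ3 : κ ^ 3 * (|t| * δ) = 1 := by
    rw [hκ, ← Real.rpow_natCast, ← Real.rpow_mul (by positivity)]
    norm_num
    rw [Real.rpow_neg_one]
    field_simp
  have hZκ : ‖Z‖ ≤ 5 / 2 * C2 * κ := by
    refine le_of_mul_le_mul_left ?_ δ0
    linarith
  calc ‖Z‖ ^ 3 * (|t| * M) ≤ (5 / 2 * C2 * κ) ^ 3 * (|t| * M) := by gcongr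
    _ = 4 * (5 / 2 * C2) ^ 3 * (κ ^ 3 * (|t| * δ)) := by rw [hδ]; ring
    _ = _ := by rw [κ3, mul_one]

theorem exists_cubic_decay_of_logConcave : ∃ C : ℝ, 0 < C ∧ ∀ (n : ℕ) (ρ : (Fin n → ℝ) → ENNReal),
    LogConcave ρ → ∀ μ : Measure (Fin n → ℝ), μ = volume.withDensity ρ → IsProbabilityMeasure μ →
    ∀ f, Continuous f → IsCubicOnLines f → Integrable f μ → Integrable (fun x => f x ^ 2) μ →
    ∀ t : ℝ, ‖∫ x, Complex.exp (Complex.I * t * (f x : ℂ)) ∂μ‖ ^ 6 *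
        (t ^ 2 * (∫ x, f x ^ 2 ∂μ - (∫ x, f x ∂μ) ^ 2)) ≤ C := by
  obtain ⟨C, C0, hC⟩ := exists_cubic_decay
  refine ⟨C, C0, fun n ρ hρ μ hμ hp f cf hf if1 if2 t => ?_⟩
  set K : ℕ → Set (Fin n → ℝ) := fun N => Metric.closedBall 0 N with hK
  have mK : ∀ N, MeasurableSet (K N) := fun N => Metric.isClosed_closedBall.measurableSet
  have monoK : Monotone K := fun a b hab =>
    Metric.closedBall_subset_closedBall (by exact_mod_cast hab)
  have unionK : ⋃ N, K N = Set.univ := Metric.iUnion_closedBall_nat 0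
  have lim : ∀ {V : Type} [NormedAddCommGroup V] [NormedSpace ℝ V] {g : (Fin n → ℝ) → V},
      Integrable g μ → Filter.Tendsto (fun N => ∫ x in K N, g x ∂μ) Filter.atTop
        (nhds (∫ x, g x ∂μ)) := fun hg => by
    have := tendsto_setIntegral_of_monotone mK monoK (by rw [unionK]; exact hg.integrableOn)
    rwa [unionK, setIntegral_univ] at this
  have ie : Integrable (fun x => Complex.exp (Complex.I * t * (f x : ℂ))) μ :=
    Integrable.of_bound (by
      have : Continuous fun x => Complex.exp (Complex.I * t * (f x : ℂ)) := by fun_prop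
      exact this.aestronglyMeasurable) 1
      (Filter.Eventually.of_forall fun x => (norm_exp_I_mul t (f x)).le)
  have limp : Filter.Tendsto (fun N => μ.real (K N)) Filter.atTop (nhds 1) := by
    have := lim (integrable_const (1 : ℝ))
    simpa using this
  have liminv : Filter.Tendsto (fun N => (μ.real (K N))⁻¹) Filter.atTop (nhds 1) := by
    simpa using limp.inv₀ one_ne_zero
  have L : Filter.Tendsto (fun N => ‖(μ.real (K N))⁻¹ •
      ∫ x in K N, Complex.exp (Complex.I * t * (f x : ℂ)) ∂μ‖ ^ 6 *
      (t ^ 2 * ((μ.real (K N))⁻¹ • ∫ x in K N, f x ^ 2 ∂μ -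
        ((μ.real (K N))⁻¹ • ∫ x in K N, f x ∂μ) ^ 2))) Filter.atTop
      (nhds (‖(1 : ℝ) • ∫ x, Complex.exp (Complex.I * t * (f x : ℂ)) ∂μ‖ ^ 6 *
        (t ^ 2 * ((1 : ℝ) • ∫ x, f x ^ 2 ∂μ - ((1 : ℝ) • ∫ x, f x ∂μ) ^ 2)))) :=
    ((liminv.smul (lim ie)).norm.pow 6).mul (((liminv.smul (lim if2)).sub
      ((liminv.smul (lim if1)).pow 2)).const_mul (t ^ 2))
  simp only [one_smul] at L
  refine le_of_tendsto L ?_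
  filter_upwards [limp.eventually_const_lt zero_lt_one] with N hN
  have posK : μ (K N) ≠ 0 := fun h0 => by simp [Measure.real, h0] at hN
  set ν := (μ (K N))⁻¹ • μ.restrict (K N) with hν
  have hνp : IsProbabilityMeasure ν := by
    constructor
    rw [hν, Measure.smul_apply, Measure.restrict_apply_univ, smul_eq_mul,
      ENNReal.inv_mul_cancel posK (measure_ne_top _ _)]
  have hνpl : IsPL ν := by
    rw [hν, hμ]
    exact (hρ.isPL_restrict (convex_closedBall _ _) (mK N)).smul _
  have hνR : ∀ᵐ x ∂ν, ‖x‖ ≤ N := by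
    refine Measure.ae_smul_measure ((ae_restrict_iff' (mK N)).2
      (Filter.Eventually.of_forall fun x hx => ?_)) _
    exact mem_closedBall_zero_iff.1 hx
  have int : ∀ {g : (Fin n → ℝ) → ℝ}, Continuous g → Integrable g ν := fun hg =>
    integrable_of_ae_norm_le hνR hg
  have intS : ∀ {V : Type} [NormedAddCommGroup V] [NormedSpace ℝ V] (g : (Fin n → ℝ) → V),
      ∫ x, g x ∂ν = (μ.real (K N))⁻¹ • ∫ x in K N, g x ∂μ := fun g => by
    rw [hν, integral_smul_measure, ENNReal.toReal_inv, Measure.real]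
  simp only [← intS]
  refine le_trans (le_of_eq ?_) (hC n ν hνp hνpl N hνR f cf hf t)
  congr 2
  set m := ∫ x, f x ∂ν with hm
  calc ∫ x, f x ^ 2 ∂ν - m ^ 2 = ∫ x, f x ^ 2 ∂ν - 2 * m * m + m ^ 2 := by ring
    _ = ∫ x, (f x ^ 2 - 2 * m * f x + m ^ 2) ∂ν := by
      rw [integral_add (int (by fun_prop)) (integrable_const _),
        integral_sub (int (by fun_prop)) (int (by fun_prop)), integral_const_mul]
      simp [hm]
    _ = _ := by
      congr 1
      ext x
      ring

theorem IsLogConcave.exists_logConcave {n : ℕ} {μ : Measure (Fin n → ℝ)} (hμ : IsLogConcave μ) :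
    ∃ ρ : (Fin n → ℝ) → ENNReal, LogConcave ρ ∧ μ = volume.withDensity ρ := by
  obtain ⟨ρ, h0, hμ, hρ⟩ := hμ
  refine ⟨_, fun x y l l0 l1 => ?_, hμ⟩
  rw [ENNReal.ofReal_rpow_of_nonneg (h0 x) l0.le,
    ENNReal.ofReal_rpow_of_nonneg (h0 y) (by linarith),
    ← ENNReal.ofReal_mul (Real.rpow_nonneg (h0 x) _)]
  exact ENNReal.ofReal_le_ofReal (hρ x y l l0.le l1.le)

theorem IsLogConcave.isPL {n : ℕ} {μ : Measure (Fin n → ℝ)} (hμ : IsLogConcave μ) : IsPL μ := by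
  obtain ⟨ρ, hρ, rfl⟩ := hμ.exists_logConcave
  exact hρ.isPL

theorem isAffine_eval {n : ℕ} (i : Fin n) : IsAffine fun x : Fin n → ℝ => x i :=
  fun x y l => by simp

theorem IsIsotropic.integrable_sq {n : ℕ} {μ : Measure (Fin n → ℝ)} (hμ : IsIsotropic μ)
    (i : Fin n) : Integrable (fun x => x i ^ 2) μ := by
  by_contra h
  have h1 := hμ.2 i i
  simp only [← pow_two] at h1
  rw [integral_undef h] at h1
  simp at h1

theorem integrable_pow_six {n : ℕ} {μ : Measure (Fin n → ℝ)} [IsProbabilityMeasure μ]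
    (hiso : IsIsotropic μ) (hpl : IsPL μ) (i : Fin n) : Integrable (fun x => x i ^ 6) μ := by
  obtain ⟨C, C0, hC⟩ := exists_isPL_sixth_moment_le
  have mi : AEMeasurable (fun x : Fin n → ℝ => x i) μ := (measurable_pi_apply i).aemeasurable
  have hp : IsProbabilityMeasure (μ.map fun x => x i) := Measure.isProbabilityMeasure_map mi
  have h1 := hC (μ.map fun x => x i) (hpl.map (isAffine_eval i) (continuous_apply i))
    ((integrable_map_measure (g := fun y => y ^ 2) (by fun_prop) mi).2 (hiso.integrable_sq i))
    (by
      rw [integral_map mi (by fun_prop)]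
      have h2 := hiso.2 i i
      simp only [← pow_two, if_true] at h2
      exact h2.le)
  exact (integrable_map_measure (g := fun y => y ^ 6) (by fun_prop) mi).1 h1.1

theorem integrable_of_norm_le_pow_six {n : ℕ} {μ : Measure (Fin n → ℝ)} [IsProbabilityMeasure μ]
    (h6 : ∀ i, Integrable (fun x => x i ^ 6) μ) {g : (Fin n → ℝ) → ℝ} (hg : Continuous g) {K : ℝ}
    (hK : ∀ x, |g x| ≤ K * (1 + ‖x‖) ^ 6) : Integrable g μ := by
  have K0 : 0 ≤ K := by simpa using (abs_nonneg _).trans (hK 0)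
  refine Integrable.mono' (g := fun x => K * (64 * (1 + ∑ i, x i ^ 6))) ?_
    hg.aestronglyMeasurable (Filter.Eventually.of_forall fun x => (hK x).trans ?_)
  · exact (((integrable_const _).add (integrable_finsetSum _ fun i _ => h6 i)).const_mul _).const_mul _
  · refine mul_le_mul_of_nonneg_left ?_ K0
    have h1 : ‖x‖ ^ 6 ≤ ∑ i, x i ^ 6 := by
      have s0 : 0 ≤ ∑ i, x i ^ 6 := Finset.sum_nonneg fun i _ => Even.pow_nonneg (by decide) _
      have h2 : ‖x‖ ≤ (∑ i, x i ^ 6) ^ (1 / 6 : ℝ) := by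
        refine (pi_norm_le_iff_of_nonneg (by positivity)).2 fun i => ?_
        refine le_of_pow_le_pow_left₀ (by norm_num : (6 : ℕ) ≠ 0) (by positivity) ?_
        rw [← Real.rpow_mul_natCast s0]
        norm_num
        rw [Even.pow_abs (by decide)]
        exact Finset.single_le_sum (f := fun i => x i ^ 6)
          (fun i _ => Even.pow_nonneg (by decide) _) (Finset.mem_univ i)
      calc ‖x‖ ^ 6 ≤ ((∑ i, x i ^ 6) ^ (1 / 6 : ℝ)) ^ 6 := by gcongr
        _ = _ := by
          rw [← Real.rpow_mul_natCast s0]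
          norm_num
    have h2 : (1 + ‖x‖) ^ 6 ≤ 64 * (1 + ‖x‖ ^ 6) := by
      have h3 : 0 ≤ ‖x‖ := norm_nonneg x
      rcases le_total ‖x‖ 1 with h | h
      · calc (1 + ‖x‖) ^ 6 ≤ 2 ^ 6 := by gcongr; linarith
          _ ≤ _ := by have := pow_nonneg h3 6; linarith
      · calc (1 + ‖x‖) ^ 6 ≤ (2 * ‖x‖) ^ 6 := by gcongr; linarith
          _ ≤ _ := by rw [mul_pow]; linarith
    linarith

/-- A product of three affine functions with variances at least one has second moment bounded
below. -/
theorem exists_integral_sq_mul_ge : ∃ c : ℝ, 0 < c ∧ ∀ (n : ℕ) (μ : Measure (Fin n → ℝ)),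
    IsProbabilityMeasure μ → IsPL μ → ∀ L : Fin 3 → (Fin n → ℝ) → ℝ,
    (∀ m, IsAffine (L m)) → (∀ m, Continuous (L m)) → (∀ m, Integrable (fun x => L m x ^ 2) μ) →
    (∀ m b, 1 ≤ ∫ x, (L m x - b) ^ 2 ∂μ) → Integrable (fun x => (L 0 x * L 1 x * L 2 x) ^ 2) μ →
    c ≤ ∫ x, (L 0 x * L 1 x * L 2 x) ^ 2 ∂μ := by
  obtain ⟨C, C0, hC⟩ := exists_isPL_small_ball
  set ε : ℝ := 1 / (4 * (1 + C)) with hε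
  have ε0 : 0 < ε := by positivity
  refine ⟨ε ^ 6 / 4, by positivity, fun n μ hp hpl L aL cL iL vL int => ?_⟩
  have small : ∀ m, μ.real {x | |L m x| ≤ ε} ≤ 1 / 4 := fun m => by
    have mm : AEMeasurable (L m) μ := (cL m).measurable.aemeasurable
    have hp : IsProbabilityMeasure (μ.map (L m)) := Measure.isProbabilityMeasure_map mm
    have h1 := hC (μ.map (L m)) (hpl.map (aL m) (cL m))
      ((integrable_map_measure (g := fun y => y ^ 2) (by fun_prop) mm).2 (iL m)) 1
      (fun b => by rw [integral_map mm (by fun_prop)]; exact vL m b) 0 ε ε0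
    rw [map_measureReal_apply (cL m).measurable Metric.isClosed_closedBall.measurableSet] at h1
    have h2 : L m ⁻¹' Metric.closedBall 0 ε = {x | |L m x| ≤ ε} := by
      ext x
      simp
    rw [h2, mul_one] at h1
    refine abs_le_of_sq_le_sq' (h1.trans ?_) (by norm_num) |>.2
    rw [hε, div_pow, one_pow, mul_one_div, div_le_iff₀ (by positivity)]
    nlinarith
  set S := ⋃ m, {x | |L m x| ≤ ε} with hS
  have mS : MeasurableSet S := MeasurableSet.iUnion fun m =>
    measurableSet_le (cL m).measurable.abs measurable_const
  have hSm : μ.real S ≤ 3 / 4 := by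
    refine (measureReal_iUnion_fintype_le _).trans ?_
    calc ∑ m, μ.real {x | |L m x| ≤ ε} ≤ ∑ m : Fin 3, (1 / 4 : ℝ) :=
          Finset.sum_le_sum fun m _ => small m
      _ = _ := by norm_num
  have hSc : 1 / 4 ≤ μ.real Sᶜ := by
    rw [probReal_compl_eq_one_sub mS]
    linarith
  calc ε ^ 6 / 4 ≤ μ.real Sᶜ * ε ^ 6 := by
        have := mul_le_mul_of_nonneg_right hSc (by positivity : 0 ≤ ε ^ 6)
        linarith
    _ = ∫ x in Sᶜ, ε ^ 6 ∂μ := by rw [setIntegral_const, smul_eq_mul]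
    _ ≤ ∫ x in Sᶜ, (L 0 x * L 1 x * L 2 x) ^ 2 ∂μ := by
        refine setIntegral_mono_on (integrable_const _) int.integrableOn mS.compl fun x hx => ?_
        have h1 : ∀ m, ε ≤ |L m x| := fun m => by
          by_contra h
          exact hx (Set.mem_iUnion.2 ⟨m, (not_le.1 h).le⟩)
        calc ε ^ 6 = (ε * ε * ε) ^ 2 := by ring
          _ ≤ (|L 0 x| * |L 1 x| * |L 2 x|) ^ 2 := by
            gcongr
            · exact h1 0
            · exact h1 1
            · exact h1 2
          _ = _ := by rw [← abs_mul, ← abs_mul, sq_abs]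
    _ ≤ _ := setIntegral_le_integral int (Filter.Eventually.of_forall fun x => sq_nonneg _)

theorem measurableEmbedding_mul_pi {n : ℕ} {D : Fin n → ℝ} (hD : ∀ k, D k ≠ 0) :
    MeasurableEmbedding fun (x : Fin n → ℝ) k => D k * x k :=
  (Homeomorph.piCongrRight fun k => Homeomorph.mulLeft₀ (D k) (hD k)).measurableEmbedding

theorem map_mul_pi_volume {n : ℕ} {D : Fin n → ℝ} (hD : ∀ k, D k ≠ 0) :
    (volume : Measure (Fin n → ℝ)).map (fun x k => D k * x k) =
      ENNReal.ofReal |∏ k, D k|⁻¹ • volume := by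
  have h0 : ∏ k, D k ≠ 0 := Finset.prod_ne_zero_iff.2 fun k _ => hD k
  have h1 := Real.smul_map_diagonal_volume_pi (D := D) (by simpa [Matrix.det_diagonal] using h0)
  have h2 : ⇑(Matrix.toLin' (Matrix.diagonal D)) = fun (x : Fin n → ℝ) k => D k * x k := by
    ext x k
    rw [Matrix.toLin'_apply, Matrix.mulVec_diagonal]
  rw [h2, Matrix.det_diagonal] at h1
  conv_rhs => rw [← h1]
  rw [smul_smul, ← ENNReal.ofReal_mul (by positivity), inv_mul_cancel₀ (abs_ne_zero.2 h0),
    ENNReal.ofReal_one, one_smul]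

theorem IsHnInvariant.map_half_le {n : ℕ} {μ : Measure (Fin n → ℝ)} [IsProbabilityMeasure μ]
    (hsym : IsHnInvariant μ) (hlc : IsLogConcave μ) (i : Fin n) :
    μ.map (fun x k => (Function.update 1 i (1 / 2) : Fin n → ℝ) k * x k) ≤ (2 : ENNReal) • μ := by
  obtain ⟨ρ, hρ, hμ⟩ := hlc.exists_logConcave
  set s : Fin n → ℝ := Function.update 1 i (-1) with hs
  set D : Fin n → ℝ := Function.update 1 i (1 / 2) with hDdef
  have hs1 : ∀ k, s k = 1 ∨ s k = -1 := fun k => by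
    by_cases h : k = i
    · right; simp [hs, h]
    · left; simp [hs, h]
  have hs0 : ∀ k, s k ≠ 0 := fun k => by
    rcases hs1 k with h | h <;> rw [h] <;> norm_num
  have hD0 : ∀ k, D k ≠ 0 := fun k => by
    by_cases h : k = i
    · simp [hDdef, h]
    · simp [hDdef, h]
  have es := measurableEmbedding_mul_pi hs0
  have eD := measurableEmbedding_mul_pi hD0
  have hmapD : (volume : Measure (Fin n → ℝ)).map (fun x k => D k * x k) = (2 : ENNReal) • volume := by
    rw [map_mul_pi_volume hD0]
    simp [hDdef, Finset.prod_update_of_mem]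
  have hmaps : (volume : Measure (Fin n → ℝ)).map (fun x k => s k * x k) = volume := by
    rw [map_mul_pi_volume hs0]
    simp [hs, Finset.prod_update_of_mem]
  have hss : ∀ x : Fin n → ℝ, (fun k => s k * (s k * x k)) = x := fun x => by
    ext k
    rcases hs1 k with h | h <;> rw [h] <;> ring
  have heven : (fun x => ρ fun k => s k * x k) =ᵐ[volume] ρ := by
    have h1 : volume.withDensity (fun x => ρ fun k => s k * x k) = volume.withDensity ρ := by
      rw [← hμ]
      conv_rhs => rw [← hsym.2 s hs1]
      ext A hA
      rw [Measure.map_apply es.measurable hA, withDensity_apply _ hA, hμ,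
        withDensity_apply _ (es.measurable hA)]
      conv_lhs => rw [← hmaps, es.restrict_map, es.lintegral_map]
      simp only [hss]
    have qmp : Measure.QuasiMeasurePreserving (fun (x : Fin n → ℝ) k => s k * x k) volume volume :=
      ⟨es.measurable, by rw [hmaps]⟩
    refine (withDensity_eq_iff (hρ.aemeasurable.comp_quasiMeasurePreserving qmp)
      hρ.aemeasurable ?_).1 h1
    have h2 : ∫⁻ x, ρ x = 1 := by
      have := measure_univ (μ := μ)
      rwa [hμ, withDensity_apply _ MeasurableSet.univ, Measure.restrict_univ] at this
    have h3 : ∫⁻ x : Fin n → ℝ, ρ (fun k => s k * x k) = ∫⁻ x, ρ x := by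
      conv_rhs => rw [← hmaps, es.lintegral_map]
    change ∫⁻ x : Fin n → ℝ, ρ (fun k => s k * x k) ≠ ⊤
    rw [h3, h2]
    exact ENNReal.one_ne_top
  refine Measure.le_iff.2 fun A hA => ?_
  rw [Measure.map_apply eD.measurable hA, Measure.smul_apply, hμ, withDensity_apply _ hA,
    withDensity_apply _ (eD.measurable hA)]
  calc ∫⁻ x in (fun (x : Fin n → ℝ) k => D k * x k) ⁻¹' A, ρ x
      ≤ ∫⁻ x in (fun (x : Fin n → ℝ) k => D k * x k) ⁻¹' A, ρ fun k => D k * x k := by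
        refine lintegral_mono_ae (ae_restrict_of_ae ?_)
        filter_upwards [heven] with x hx
        have h1 := hρ x (fun k => s k * x k) (3 / 4) (by norm_num) (by norm_num)
        rw [hx, ← ENNReal.rpow_add_of_nonneg _ _ (by norm_num) (by norm_num)] at h1
        norm_num at h1
        refine h1.trans (le_of_eq (congrArg ρ ?_))
        ext k
        by_cases h : k = i
        · simp [hs, hDdef, h]; ring
        · simp [hs, hDdef, h]; ring
    _ = ∫⁻ x in A, ρ x ∂((2 : ENNReal) • volume) := by
        rw [← hmapD, eD.restrict_map, eD.lintegral_map]
    _ = _ := by rw [Measure.restrict_smul, lintegral_smul_measure]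

theorem integrable_eval {n : ℕ} {μ : Measure (Fin n → ℝ)} [IsProbabilityMeasure μ]
    (h6 : ∀ i, Integrable (fun x => x i ^ 6) μ) {p : MvPolynomial (Fin n) ℝ} {d : ℕ}
    (hp : p.IsHomogeneous d) (hd : d ≤ 6) : Integrable (fun x => MvPolynomial.eval x p) μ := by
  refine integrable_of_norm_le_pow_six h6 (MvPolynomial.continuous_eval p)
    (K := ∑ I ∈ p.support, |p.coeff I|) fun x => ?_
  rw [MvPolynomial.eval_eq', Finset.sum_mul]
  refine (Finset.abs_sum_le_sum_abs _ _).trans (Finset.sum_le_sum fun I hI => ?_)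
  rw [abs_mul]
  refine mul_le_mul_of_nonneg_left ?_ (abs_nonneg _)
  have h1 : ∑ k, I k = d := by
    have := hp (MvPolynomial.mem_support_iff.1 hI)
    rw [Finsupp.weight_apply, Finsupp.sum_fintype _ _ (by simp)] at this
    simpa using this
  have h2 : 1 ≤ 1 + ‖x‖ := by linarith [norm_nonneg x]
  calc |∏ k, x k ^ I k| = ∏ k, |x k| ^ I k := by
        rw [Finset.abs_prod]
        exact Finset.prod_congr rfl fun k _ => abs_pow _ _
    _ ≤ ∏ k, (1 + ‖x‖) ^ I k := by
        refine Finset.prod_le_prod (fun k _ => by positivity) fun k _ => ?_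
        have : |x k| ≤ ‖x‖ := norm_le_pi_norm x k
        gcongr
        linarith
    _ = (1 + ‖x‖) ^ d := by rw [Finset.prod_pow_eq_pow_sum, h1]
    _ ≤ _ := pow_le_pow_right₀ h2 hd

theorem IsHnInvariant.integral_sign {n : ℕ} {μ : Measure (Fin n → ℝ)} (hsym : IsHnInvariant μ)
    {s : Fin n → ℝ} (hs : ∀ k, s k = 1 ∨ s k = -1) {g : (Fin n → ℝ) → ℝ} (hg : Continuous g) :
    ∫ x, g (fun k => s k * x k) ∂μ = ∫ x, g x ∂μ := by
  conv_rhs => rw [← hsym.2 s hs]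
  rw [integral_map (Continuous.aemeasurable (by fun_prop)) hg.aestronglyMeasurable]

theorem IsHnInvariant.integral_perm {n : ℕ} {μ : Measure (Fin n → ℝ)} (hsym : IsHnInvariant μ)
    (σ : Equiv.Perm (Fin n)) {g : (Fin n → ℝ) → ℝ} (hg : Continuous g) :
    ∫ x, g (x ∘ σ) ∂μ = ∫ x, g x ∂μ := by
  conv_rhs => rw [← hsym.1 σ]
  rw [integral_map (Continuous.aemeasurable (by fun_prop)) hg.aestronglyMeasurable]

theorem one_le_integral_sub_sq {X : Type*} [MeasurableSpace X] {μ : Measure X}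
    [IsProbabilityMeasure μ] {L : X → ℝ} (h1 : Integrable L μ) (h2 : Integrable (fun x => L x ^ 2) μ)
    (h0 : ∫ x, L x ∂μ = 0) (hv : 1 ≤ ∫ x, L x ^ 2 ∂μ) (b : ℝ) : 1 ≤ ∫ x, (L x - b) ^ 2 ∂μ := by
  have h3 : Integrable (fun x => L x ^ 2 - 2 * b * L x) μ := h2.sub (h1.const_mul _)
  calc (1 : ℝ) ≤ ∫ x, L x ^ 2 ∂μ + b ^ 2 := by linarith [sq_nonneg b]
    _ = ∫ x, (L x ^ 2 - 2 * b * L x + b ^ 2) ∂μ := by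
      rw [integral_add h3 (integrable_const _),
        integral_sub h2 (h1.const_mul _), integral_const_mul, h0]
      simp
    _ = _ := by
      congr 1
      ext x
      ring

theorem exists_integral_sq_linear_mul_ge : ∃ c : ℝ, 0 < c ∧ ∀ (n : ℕ) (μ : Measure (Fin n → ℝ)),
    IsProbabilityMeasure μ → IsIsotropic μ → IsLogConcave μ → ∀ v : Fin 3 → Fin n → ℝ,
    (∀ m, 1 ≤ ∑ k, v m k ^ 2) →
    c ≤ ∫ x, ((∑ k, v 0 k * x k) * (∑ k, v 1 k * x k) * (∑ k, v 2 k * x k)) ^ 2 ∂μ := by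
  obtain ⟨c, c0, hc⟩ := exists_integral_sq_mul_ge
  refine ⟨c, c0, fun n μ hp hiso hlc v hv => ?_⟩
  have h6 := integrable_pow_six hiso hlc.isPL
  set P : Fin 3 → MvPolynomial (Fin n) ℝ := fun m => ∑ k, MvPolynomial.C (v m k) * MvPolynomial.X k
    with hP
  have hPh : ∀ m, (P m).IsHomogeneous 1 := fun m =>
    MvPolynomial.IsHomogeneous.sum _ _ _ fun k _ => (MvPolynomial.isHomogeneous_X ℝ k).C_mul _
  have hPe : ∀ m x, MvPolynomial.eval x (P m) = ∑ k, v m k * x k := fun m x => by simp [hP]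
  have i1 : ∀ m, Integrable (fun x => ∑ k, v m k * x k) μ := fun m => by
    simpa only [hPe] using integrable_eval h6 (hPh m) (by norm_num)
  have i2 : ∀ m, Integrable (fun x => (∑ k, v m k * x k) ^ 2) μ := fun m => by
    simpa only [hPe, map_pow] using integrable_eval h6 ((hPh m).pow 2) (by norm_num)
  have ix : ∀ k, Integrable (fun x => x k) μ := fun k => by
    simpa using integrable_eval h6 (MvPolynomial.isHomogeneous_X ℝ k) (by norm_num)
  have ixx : ∀ k l, Integrable (fun x => x k * x l) μ := fun k l => by
    simpa using integrable_eval h6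
      ((MvPolynomial.isHomogeneous_X ℝ k).mul (MvPolynomial.isHomogeneous_X ℝ l)) (by norm_num)
  refine hc n μ hp hlc.isPL (fun m x => ∑ k, v m k * x k) (fun m x y l => ?_)
    (fun m => by fun_prop) i2 (fun m => one_le_integral_sub_sq (i1 m) (i2 m) ?_ ?_) ?_
  · simp only [Pi.add_apply, Pi.smul_apply, smul_eq_mul, mul_add, Finset.sum_add_distrib,
      Finset.mul_sum]
    congr 1 <;> exact Finset.sum_congr rfl fun k _ => by ring
  · rw [integral_finsetSum _ fun k _ => (ix k).const_mul _]
    simp [integral_const_mul, hiso.1]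
  · have e : ∀ x : Fin n → ℝ, (∑ k, v m k * x k) ^ 2 =
        ∑ k, ∑ l, v m k * v m l * (x k * x l) := fun x => by
      rw [pow_two, Finset.sum_mul_sum]
      exact Finset.sum_congr rfl fun k _ => Finset.sum_congr rfl fun l _ => by ring
    simp only [e]
    rw [integral_finsetSum _ fun k _ => integrable_finsetSum _ fun l _ => (ixx k l).const_mul _]
    simp only [integral_finsetSum _ fun l _ => (ixx _ l).const_mul _, integral_const_mul, hiso.2]
    simpa [pow_two] using hv m
  · simpa only [hPe, map_pow, map_mul] using
      integrable_eval h6 ((((hPh 0).mul (hPh 1)).mul (hPh 2)).pow 2) (by norm_num)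

theorem exists_perm_map_triple {α : Type*} [DecidableEq α] {i j k i' j' k' : α}
    (hij : i ≠ j) (hik : i ≠ k) (hjk : j ≠ k) (hij' : i' ≠ j') (hik' : i' ≠ k') (hjk' : j' ≠ k') :
    ∃ σ : Equiv.Perm α, σ i = i' ∧ σ j = j' ∧ σ k = k' := by
  have key : ∀ {i j k : α}, i ≠ j → i ≠ k → j ≠ k → Function.Injective ![i, j, k] := by
    intro i j k h1 h2 h3 a b
    fin_cases a <;> fin_cases b <;> simp_all [eq_comm]
  obtain ⟨σ, h⟩ := (Equiv.Perm.isMultiplyPretransitive α 3).exists_smul_eq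
    ⟨_, key hij hik hjk⟩ ⟨_, key hij' hik' hjk'⟩
  exact ⟨σ, congrArg (fun f => f 0) h, congrArg (fun f => f 1) h, congrArg (fun f => f 2) h⟩

theorem sum_sum_mul_eq_of_offDiag {ι : Type*} [Fintype ι] [DecidableEq ι] {b : ι → ℝ}
    {m : ι → ι → ℝ} {B c : ℝ} (hB : 0 ≤ B)
    (hoff : ∀ j k, j ≠ k → b j ≠ 0 → b k ≠ 0 → m j k = B) (hdiag : ∀ j, b j ≠ 0 → c + B ≤ m j j) :
    c * ∑ j, b j ^ 2 ≤ ∑ j, ∑ k, b j * b k * m j k := by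
  have e : ∀ j k, b j * b k * m j k
      = B * (b j * b k) + if j = k then b j ^ 2 * (m j j - B) else 0 := fun j k => by
    by_cases hj : b j = 0
    · simp [hj]
    by_cases hk : b k = 0
    · by_cases h : j = k
      · exact absurd (h ▸ hk) hj
      · simp [hk, h]
    by_cases h : j = k
    · subst h
      simp only [if_true]
      ring
    · rw [hoff j k h hj hk, if_neg h]
      ring
  have e2 : ∑ j, ∑ k, b j * b k * m j k = B * (∑ j, b j) ^ 2 + ∑ j, b j ^ 2 * (m j j - B) := by
    simp only [e, Finset.sum_add_distrib, ← Finset.mul_sum, Finset.sum_ite_eq, Finset.mem_univ,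
      if_true, ← Finset.sum_mul, pow_two]
  rw [e2, Finset.mul_sum]
  refine (Finset.sum_le_sum fun j _ => ?_).trans (le_add_of_nonneg_left (by positivity))
  by_cases hj : b j = 0
  · simp [hj]
  · nlinarith [hdiag j hj, sq_nonneg (b j)]

theorem exists_integral_sq_monomial_ge : ∃ c : ℝ, 0 < c ∧ ∀ (n : ℕ) (μ : Measure (Fin n → ℝ)),
    IsProbabilityMeasure μ → IsIsotropic μ → IsLogConcave μ → ∀ i j k : Fin n,
    c ≤ ∫ x, (x i * x j * x k) ^ 2 ∂μ ∧
    (j ≠ k → c ≤ ∫ x, (x i * (x j ^ 2 - x k ^ 2)) ^ 2 ∂μ) := by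
  obtain ⟨c, c0, hc⟩ := exists_integral_sq_linear_mul_ge
  refine ⟨c, c0, fun n μ hp hiso hlc i j k => ⟨?_, fun hjk => ?_⟩⟩
  · have := hc n μ hp hiso hlc ![Pi.single i 1, Pi.single j 1, Pi.single k 1] (fun m => by
      fin_cases m <;> simp [Pi.single_apply])
    simpa [Pi.single_apply] using this
  · have := hc n μ hp hiso hlc
      ![Pi.single i 1, Pi.single j 1 - Pi.single k 1, Pi.single j 1 + Pi.single k 1] (fun m => by
      fin_cases m
      · simp [Pi.single_apply]
      · refine le_trans ?_ (Finset.single_le_sum (fun _ _ => sq_nonneg _) (Finset.mem_univ j))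
        simp [hjk]
      · refine le_trans ?_ (Finset.single_le_sum (fun _ _ => sq_nonneg _) (Finset.mem_univ j))
        simp [hjk])
    refine this.trans (le_of_eq (integral_congr_ae (Filter.Eventually.of_forall fun x => ?_)))
    simp [Pi.single_apply, sub_mul, add_mul, Finset.sum_sub_distrib, Finset.sum_add_distrib]
    ring

theorem exists_integral_sq_mul_sum_sq_ge : ∃ c : ℝ, 0 < c ∧
    ∀ (n : ℕ) (μ : Measure (Fin n → ℝ)), IsProbabilityMeasure μ → IsHnInvariant μ →
    IsIsotropic μ → IsLogConcave μ → ∀ (i : Fin n) (b : Fin n → ℝ), b i = 0 →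
    c * ∑ j, b j ^ 2 ≤ ∫ x, (x i * ∑ j, b j * x j ^ 2) ^ 2 ∂μ := by
  obtain ⟨c, c0, hc⟩ := exists_integral_sq_monomial_ge
  refine ⟨c / 2, by positivity, fun n μ hp hsym hiso hlc i b hbi => ?_⟩
  have h6 := integrable_pow_six hiso hlc.isPL
  have im : ∀ j k, Integrable (fun x => x i ^ 2 * x j ^ 2 * x k ^ 2) μ := fun j k => by
    have hX := MvPolynomial.isHomogeneous_X (σ := Fin n) ℝ
    simpa using integrable_eval h6 ((((hX i).pow 2).mul ((hX j).pow 2)).mul ((hX k).pow 2))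
      (by norm_num)
  have hsq : ∀ j k, c ≤ ∫ x, x i ^ 2 * x j ^ 2 * x k ^ 2 ∂μ := fun j k => by
    simpa only [mul_pow] using (hc n μ hp hiso hlc i j k).1
  have hexp : ∫ x, (x i * ∑ j, b j * x j ^ 2) ^ 2 ∂μ
      = ∑ j, ∑ k, b j * b k * ∫ x, x i ^ 2 * x j ^ 2 * x k ^ 2 ∂μ := by
    have e : ∀ x : Fin n → ℝ, (x i * ∑ j, b j * x j ^ 2) ^ 2 =
        ∑ j, ∑ k, b j * b k * (x i ^ 2 * x j ^ 2 * x k ^ 2) := fun x => by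
      rw [mul_pow, pow_two (∑ j, b j * x j ^ 2), Finset.sum_mul_sum, Finset.mul_sum]
      refine Finset.sum_congr rfl fun j _ => ?_
      rw [Finset.mul_sum]
      exact Finset.sum_congr rfl fun k _ => by ring
    simp only [e]
    rw [integral_finsetSum _ fun j _ => integrable_finsetSum _ fun k _ => (im j k).const_mul _]
    simp only [integral_finsetSum _ fun k _ => (im _ k).const_mul _, integral_const_mul]
  rw [hexp]
  have hbi' : ∀ j, b j ≠ 0 → i ≠ j := fun j hj h => hj (h ▸ hbi)
  by_cases hex : ∃ j k, j ≠ k ∧ b j ≠ 0 ∧ b k ≠ 0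
  · obtain ⟨j₀, k₀, h₀, hj₀, hk₀⟩ := hex
    have hoff : ∀ j k, j ≠ k → b j ≠ 0 → b k ≠ 0 → ∫ x, x i ^ 2 * x j ^ 2 * x k ^ 2 ∂μ
        = ∫ x, x i ^ 2 * x j₀ ^ 2 * x k₀ ^ 2 ∂μ := fun j k h hj hk => by
      obtain ⟨σ, s1, s2, s3⟩ := exists_perm_map_triple (hbi' _ hj₀) (hbi' _ hk₀) h₀ (hbi' _ hj)
        (hbi' _ hk) h
      rw [← hsym.integral_perm σ (g := fun x => x i ^ 2 * x j₀ ^ 2 * x k₀ ^ 2) (by fun_prop)]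
      simp [s1, s2, s3]
    refine sum_sum_mul_eq_of_offDiag (B := ∫ x, x i ^ 2 * x j₀ ^ 2 * x k₀ ^ 2 ∂μ)
      (c0.le.trans (hsq _ _)) hoff fun j hj => ?_
    obtain ⟨k, hk, hjk⟩ : ∃ k, b k ≠ 0 ∧ j ≠ k := by
      by_cases h : j = j₀
      · exact ⟨k₀, hk₀, h ▸ h₀⟩
      · exact ⟨j₀, hj₀, h⟩
    rw [← hoff j k hjk hj hk]
    have hdiag : ∫ x, x i ^ 2 * x k ^ 2 * x k ^ 2 ∂μ = ∫ x, x i ^ 2 * x j ^ 2 * x j ^ 2 ∂μ := by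
      rw [← hsym.integral_perm (Equiv.swap j k) (g := fun x => x i ^ 2 * x j ^ 2 * x j ^ 2)
        (by fun_prop)]
      simp [Equiv.swap_apply_of_ne_of_ne (hbi' _ hj) (hbi' _ hk)]
    have h1 := (hc n μ hp hiso hlc i j k).2 hjk
    have h2 : ∫ x, (x i * (x j ^ 2 - x k ^ 2)) ^ 2 ∂μ = ∫ x, x i ^ 2 * x j ^ 2 * x j ^ 2 ∂μ
        - 2 * ∫ x, x i ^ 2 * x j ^ 2 * x k ^ 2 ∂μ + ∫ x, x i ^ 2 * x k ^ 2 * x k ^ 2 ∂μ := by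
      have i1 : Integrable (fun x => x i ^ 2 * x j ^ 2 * x j ^ 2
        - 2 * (x i ^ 2 * x j ^ 2 * x k ^ 2)) μ := (im j j).sub ((im j k).const_mul _)
      rw [← integral_const_mul, ← integral_sub (im j j) ((im j k).const_mul _),
        ← integral_add i1 (im k k)]
      congr 1
      ext x
      ring
    linarith
  · refine sum_sum_mul_eq_of_offDiag le_rfl (fun j k h hj hk => absurd ⟨j, k, h, hj, hk⟩ hex)
      fun j _ => ?_
    linarith [hsq j j]

theorem exists_integral_sq_block_ge : ∃ c : ℝ, 0 < c ∧
    ∀ (n : ℕ) (μ : Measure (Fin n → ℝ)), IsProbabilityMeasure μ → IsHnInvariant μ →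
    IsIsotropic μ → IsLogConcave μ → ∀ (i : Fin n) (b : Fin n → ℝ),
    c * ∑ j, b j ^ 2 ≤ ∫ x, (x i * ∑ j, b j * x j ^ 2) ^ 2 ∂μ := by
  obtain ⟨c, c0, hc⟩ := exists_integral_sq_monomial_ge
  obtain ⟨c', c0', hc'⟩ := exists_integral_sq_mul_sum_sq_ge
  refine ⟨min c c' / 98, by positivity, fun n μ hp hsym hiso hlc i b => ?_⟩
  have h6 := integrable_pow_six hiso hlc.isPL
  have hX := MvPolynomial.isHomogeneous_X (σ := Fin n) ℝ
  have ig : ∀ b : Fin n → ℝ, Integrable (fun x => (x i * ∑ j, b j * x j ^ 2) ^ 2) μ := fun b => by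
    simpa using integrable_eval h6 (((hX i).mul (MvPolynomial.IsHomogeneous.sum Finset.univ
      (fun j => MvPolynomial.C (b j) * MvPolynomial.X j ^ 2) 2
      fun j _ => ((hX j).pow 2).C_mul (b j))).pow 2) (by norm_num)
  set g : (Fin n → ℝ) → ℝ := fun x => x i * ∑ j, b j * x j ^ 2 with hg
  set b' : Fin n → ℝ := Function.update b i 0 with hb'
  have hsum : ∀ w : Fin n → ℝ, ∑ j, b j * w j = b i * w i + ∑ j, b' j * w j := fun w => by
    rw [← Finset.add_sum_erase _ _ (Finset.mem_univ i),
      ← Finset.add_sum_erase _ (fun j => b' j * w j) (Finset.mem_univ i)]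
    simp only [hb', Function.update_self, zero_mul, zero_add]
    congr 1
    refine Finset.sum_congr rfl fun j hj => ?_
    rw [Function.update_of_ne (Finset.ne_of_mem_erase hj)]
  set D : (Fin n → ℝ) → Fin n → ℝ :=
    fun x k => (Function.update 1 i (1 / 2) : Fin n → ℝ) k * x k with hD
  have hDm : Measurable D := by
    refine measurable_pi_lambda _ fun k => ?_
    exact (measurable_pi_apply k).const_mul _
  have hle := hsym.map_half_le hlc i
  have igs : Integrable (fun x => g x ^ 2) ((2 : ENNReal) • μ) :=
    (ig b).smul_measure (by norm_num)
  have igD : Integrable (fun x => g (D x) ^ 2) μ := (igs.mono_measure hle).comp_measurable hDm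
  have hgD2 : ∫ x, g (D x) ^ 2 ∂μ ≤ 2 * ∫ x, g x ^ 2 ∂μ := by
    have e : ∫ x, g x ^ 2 ∂(μ.map D) = ∫ x, g (D x) ^ 2 ∂μ :=
      integral_map hDm.aemeasurable (Continuous.aestronglyMeasurable (by fun_prop))
    rw [← e]
    refine (integral_mono_measure hle (Filter.Eventually.of_forall fun x => sq_nonneg _)
      igs).trans (le_of_eq ?_)
    rw [integral_smul_measure]
    simp
  have hgx : ∀ x, g x = b i * x i ^ 3 + x i * ∑ j, b' j * x j ^ 2 := fun x => by
    simp only [hg]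
    rw [hsum fun j => x j ^ 2]
    ring
  have hgD : ∀ x, g (D x) = b i * x i ^ 3 / 8 + x i * (∑ j, b' j * x j ^ 2) / 2 := fun x => by
    rw [hgx]
    have e : ∑ j, b' j * D x j ^ 2 = ∑ j, b' j * x j ^ 2 := Finset.sum_congr rfl fun j _ => by
      by_cases h : j = i
      · simp [hb', h]
      · simp [hD, h]
    rw [e]
    simp only [hD, Function.update_self]
    ring
  have hA : b i ^ 2 * ∫ x, (x i * x i * x i) ^ 2 ∂μ ≤ 32 * ∫ x, g x ^ 2 ∂μ := by
    rw [← integral_const_mul]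
    have i1 : Integrable (fun x => 32 / 9 * g x ^ 2 + 128 / 9 * g (D x) ^ 2) μ :=
      ((ig b).const_mul _).add (igD.const_mul _)
    have i2 : Integrable (fun x => b i ^ 2 * (x i * x i * x i) ^ 2) μ := by
      refine ((h6 i).const_mul (b i ^ 2)).congr (Filter.Eventually.of_forall fun x => ?_)
      ring
    refine (integral_mono i2 i1 fun x => ?_).trans ?_
    · simp only [hgD]
      simp only [hgx]
      set u := b i * x i ^ 3 with hu
      have : b i ^ 2 * (x i * x i * x i) ^ 2 = u ^ 2 := by rw [hu]; ring
      rw [this]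
      nlinarith [sq_nonneg (u * (5 / 4) + 2 * (x i * ∑ j, b' j * x j ^ 2))]
    · rw [integral_add ((ig b).const_mul _) (igD.const_mul _), integral_const_mul,
        integral_const_mul]
      linarith
  have hB : ∫ x, (x i * ∑ j, b' j * x j ^ 2) ^ 2 ∂μ ≤ 66 * ∫ x, g x ^ 2 ∂μ := by
    have i2 : Integrable (fun x => b i ^ 2 * (x i * x i * x i) ^ 2) μ := by
      refine ((h6 i).const_mul (b i ^ 2)).congr (Filter.Eventually.of_forall fun x => ?_)
      ring
    have i1 : Integrable (fun x => 2 * g x ^ 2 + 2 * (b i ^ 2 * (x i * x i * x i) ^ 2)) μ :=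
      ((ig b).const_mul _).add (i2.const_mul _)
    refine (integral_mono (ig b') i1 fun x => ?_).trans ?_
    · simp only [hgx]
      nlinarith [sq_nonneg (2 * (b i * x i ^ 3) + x i * ∑ j, b' j * x j ^ 2)]
    · rw [integral_add ((ig b).const_mul _) (i2.const_mul _), integral_const_mul,
        integral_const_mul, integral_const_mul]
      linarith
  have h1 := (hc n μ hp hiso hlc i i i).1
  have h2 := hc' n μ hp hsym hiso hlc i b' (by simp [hb'])
  have h3 : ∑ j, b j ^ 2 = b i ^ 2 + ∑ j, b' j ^ 2 := by
    rw [← Finset.add_sum_erase _ _ (Finset.mem_univ i),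
      ← Finset.add_sum_erase _ (fun j => b' j ^ 2) (Finset.mem_univ i)]
    simp only [hb', Function.update_self]
    rw [zero_pow two_ne_zero, zero_add]
    congr 1
    refine Finset.sum_congr rfl fun j hj => ?_
    rw [Function.update_of_ne (Finset.ne_of_mem_erase hj)]
  have h4 : min c c' * b i ^ 2 ≤ b i ^ 2 * ∫ x, (x i * x i * x i) ^ 2 ∂μ := by
    rw [mul_comm]
    exact mul_le_mul_of_nonneg_left ((min_le_left _ _).trans h1) (sq_nonneg _)
  have h5 : min c c' * ∑ j, b' j ^ 2 ≤ c' * ∑ j, b' j ^ 2 :=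
    mul_le_mul_of_nonneg_right (min_le_right _ _) (by positivity)
  rw [h3]
  linarith

theorem Finsupp.exists_eq_single_add_single_add_single {α : Type*} {I : α →₀ ℕ}
    (hI : Finsupp.weight 1 I = 3) :
    ∃ a b c, I = Finsupp.single a 1 + Finsupp.single b 1 + Finsupp.single c 1 := by
  classical
  have h : Multiset.card (Finsupp.toMultiset I) = 3 := by
    rw [Finsupp.card_toMultiset, ← hI, Finsupp.weight_apply]
    exact Finsupp.sum_congr fun _ _ => by simp
  obtain ⟨a, b, c, h⟩ := Multiset.card_eq_three.1 h
  refine ⟨a, b, c, Finsupp.orderIsoMultiset.injective ?_⟩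
  rw [Finsupp.coe_orderIsoMultiset, h]
  simp [Finsupp.toMultiset_single]

theorem prod_pow_single_add_single_add_single {n : ℕ} (a b c : Fin n) (x : Fin n → ℝ) :
    ∏ k, x k ^ (Finsupp.single a 1 + Finsupp.single b 1 + Finsupp.single c 1 : Fin n →₀ ℕ) k
      = x a * x b * x c := by
  simp only [Finsupp.add_apply, pow_add, Finset.prod_mul_distrib]
  simp [Finsupp.single_apply, pow_ite]

theorem prod_pow_update_neg_one {n : ℕ} (I : Fin n → ℕ) (i : Fin n) (x : Fin n → ℝ) :
    ∏ k, ((Function.update 1 i (-1) : Fin n → ℝ) k * x k) ^ I k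
      = (-1) ^ I i * ∏ k, x k ^ I k := by
  simp only [mul_pow, Finset.prod_mul_distrib]
  rw [Finset.prod_eq_single i (fun k _ hk => by simp [hk]) (by simp)]
  simp

theorem integrable_prod_pow_mul_prod_pow {n : ℕ} {μ : Measure (Fin n → ℝ)} [IsProbabilityMeasure μ]
    (h6 : ∀ i, Integrable (fun x => x i ^ 6) μ) {I J : Fin n →₀ ℕ}
    (hI : Finsupp.weight 1 I = 3) (hJ : Finsupp.weight 1 J = 3) :
    Integrable (fun x => (∏ k, x k ^ I k) * ∏ k, x k ^ J k) μ := by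
  obtain ⟨a, b, c, rfl⟩ := Finsupp.exists_eq_single_add_single_add_single hI
  obtain ⟨a', b', c', rfl⟩ := Finsupp.exists_eq_single_add_single_add_single hJ
  simp only [prod_pow_single_add_single_add_single]
  have hX := MvPolynomial.isHomogeneous_X (σ := Fin n) ℝ
  simpa using integrable_eval h6 ((((hX a).mul (hX b)).mul (hX c)).mul
    (((hX a').mul (hX b')).mul (hX c'))) (by norm_num)

theorem IsHnInvariant.integral_prod_pow_mul_prod_pow_eq_zero {n : ℕ} {μ : Measure (Fin n → ℝ)}
    (hsym : IsHnInvariant μ) {I J : Fin n → ℕ} {i : Fin n} (h : I i % 2 ≠ J i % 2) :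
    ∫ x, (∏ k, x k ^ I k) * ∏ k, x k ^ J k ∂μ = 0 := by
  have h1 := hsym.integral_sign (s := Function.update 1 i (-1))
    (fun k => by by_cases hk : k = i <;> simp [hk])
    (g := fun x => (∏ k, x k ^ I k) * ∏ k, x k ^ J k) (by fun_prop)
  have h2 : (-1 : ℝ) ^ I i * (-1) ^ J i = -1 := by
    rw [← pow_add]
    exact Odd.neg_one_pow (Nat.odd_iff.2 (by omega))
  have h3 : ∀ x : Fin n → ℝ, ((-1) ^ I i * ∏ k, x k ^ I k) * ((-1) ^ J i * ∏ k, x k ^ J k)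
      = -((∏ k, x k ^ I k) * ∏ k, x k ^ J k) := fun x => by
    rw [mul_mul_mul_comm, h2, neg_one_mul]
  simp only [prod_pow_update_neg_one, h3, integral_neg] at h1
  linarith

theorem integral_sq_sum_eq {X ι : Type*} [MeasurableSpace X] {μ : Measure X} {s : Finset ι}
    {F : ι → X → ℝ} (hF : ∀ i ∈ s, ∀ j ∈ s, Integrable (fun x => F i x * F j x) μ) (a : ι → ℝ) :
    ∫ x, (∑ i ∈ s, a i * F i x) ^ 2 ∂μ = ∑ i ∈ s, ∑ j ∈ s, a i * a j * ∫ x, F i x * F j x ∂μ := by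
  have e : ∀ x, (∑ i ∈ s, a i * F i x) ^ 2 = ∑ i ∈ s, ∑ j ∈ s, a i * a j * (F i x * F j x) :=
    fun x => by
      rw [pow_two, Finset.sum_mul_sum]
      exact Finset.sum_congr rfl fun i _ => Finset.sum_congr rfl fun j _ => by ring
  simp only [e]
  rw [integral_finsetSum _ fun i hi => integrable_finsetSum _ fun j hj =>
    (hF i hi j hj).const_mul _]
  refine Finset.sum_congr rfl fun i hi => ?_
  rw [integral_finsetSum _ fun j hj => (hF i hi j hj).const_mul _]
  simp only [integral_const_mul]

/-- If functions with distinct labels are orthogonal, the second moment of a combination is the sum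
of the second moments of its parts with a given label. -/
theorem integral_sq_sum_eq_sum_fiber {X ι κ : Type*} [MeasurableSpace X] [DecidableEq κ]
    {μ : Measure X} {s : Finset ι} {F : ι → X → ℝ} (P : ι → κ)
    (hF : ∀ i ∈ s, ∀ j ∈ s, Integrable (fun x => F i x * F j x) μ)
    (h0 : ∀ i ∈ s, ∀ j ∈ s, P i ≠ P j → ∫ x, F i x * F j x ∂μ = 0) (a : ι → ℝ) :
    ∫ x, (∑ i ∈ s, a i * F i x) ^ 2 ∂μ
      = ∑ S ∈ s.image P, ∫ x, (∑ i ∈ s with P i = S, a i * F i x) ^ 2 ∂μ := by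
  rw [integral_sq_sum_eq hF, ← Finset.sum_fiberwise_of_maps_to
    (fun i hi => Finset.mem_image_of_mem P hi)]
  refine Finset.sum_congr rfl fun S _ => ?_
  rw [integral_sq_sum_eq fun i hi j hj =>
    hF i (Finset.mem_of_mem_filter i hi) j (Finset.mem_of_mem_filter j hj)]
  refine Finset.sum_congr rfl fun i hi => ?_
  rw [Finset.mem_filter] at hi
  refine (Finset.sum_subset (Finset.filter_subset _ _) fun j hj hj' => ?_).symm
  rw [h0 i hi.1 j hj fun h => hj' (Finset.mem_filter.2 ⟨hj, h ▸ hi.2⟩), mul_zero]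

/-- The degree three exponents with the same parities as a given one either form the family
`x_i x_j ^ 2` for a fixed `i`, or reduce to a single exponent. -/
theorem Finsupp.eq_of_mod_two_or {α : Type*} {I : α →₀ ℕ} (hI : Finsupp.weight 1 I = 3) :
    (∃ i, (∀ k, I k % 2 = Finsupp.single i 1 k) ∧
      ∀ J : α →₀ ℕ, Finsupp.weight 1 J = 3 → (∀ k, J k % 2 = I k % 2) →
        ∃ j, J = Finsupp.single i 1 + Finsupp.single j 1 + Finsupp.single j 1) ∨
    ∀ J : α →₀ ℕ, Finsupp.weight 1 J = 3 → (∀ k, J k % 2 = I k % 2) → J = I := by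
  classical
  have key : ∀ i j : α, ∀ J : α →₀ ℕ, Finsupp.weight 1 J = 3 → (∀ k, J k % 2 =
      (Finsupp.single i 1 + Finsupp.single j 1 + Finsupp.single j 1 : α →₀ ℕ) k % 2) →
      ∃ j, J = Finsupp.single i 1 + Finsupp.single j 1 + Finsupp.single j 1 := by
    intro i j J hJ h
    obtain ⟨a, b, c, rfl⟩ := Finsupp.exists_eq_single_add_single_add_single hJ
    have ha := h a
    have hb := h b
    have hc := h c
    have hi := h i
    simp only [Finsupp.add_apply, Finsupp.single_apply] at ha hb hc hi
    by_cases hia : i = a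
    · subst hia
      refine ⟨b, ?_⟩
      have : b = c := by
        by_contra hbc
        grind
      rw [this]
    by_cases hib : i = b
    · subst hib
      refine ⟨a, ?_⟩
      have : a = c := by grind
      rw [this]
      abel
    · refine ⟨a, ?_⟩
      have h1 : i = c := by grind
      have h2 : a = b := by grind
      rw [h1, h2]
      abel
  have block : ∀ i j, I = Finsupp.single i 1 + Finsupp.single j 1 + Finsupp.single j 1 →
      ∃ i, (∀ k, I k % 2 = Finsupp.single i 1 k) ∧
      ∀ J : α →₀ ℕ, Finsupp.weight 1 J = 3 → (∀ k, J k % 2 = I k % 2) →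
        ∃ j, J = Finsupp.single i 1 + Finsupp.single j 1 + Finsupp.single j 1 := by
    rintro i j rfl
    refine ⟨i, fun k => ?_, fun J hJ h => key i j J hJ h⟩
    simp only [Finsupp.add_apply, Finsupp.single_apply]
    grind
  obtain ⟨a, b, c, habc⟩ := Finsupp.exists_eq_single_add_single_add_single hI
  by_cases hbc : b = c
  · exact Or.inl (block a b (by rw [habc, hbc]))
  by_cases hab : a = b
  · exact Or.inl (block c a (by rw [habc, hab]; abel))
  by_cases hac : a = c
  · exact Or.inl (block b a (by rw [habc, hac]; abel))
  refine Or.inr fun J hJ h => ?_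
  obtain ⟨a', b', c', rfl⟩ := Finsupp.exists_eq_single_add_single_add_single hJ
  have ha := h a
  have hb := h b
  have hc := h c
  rw [habc] at ha hb hc ⊢
  ext k
  simp only [Finsupp.add_apply, Finsupp.single_apply] at ha hb hc ⊢
  grind

theorem exists_integral_sq_eval_ge : ∃ c : ℝ, 0 < c ∧
    ∀ (n : ℕ) (μ : Measure (Fin n → ℝ)), IsProbabilityMeasure μ → IsHnInvariant μ →
    IsIsotropic μ → IsLogConcave μ → ∀ f : MvPolynomial (Fin n) ℝ, f.IsHomogeneous 3 →
    c * ∑ I ∈ f.support, f.coeff I ^ 2 ≤ ∫ x, MvPolynomial.eval x f ^ 2 ∂μ := by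
  obtain ⟨c, c0, hc⟩ := exists_integral_sq_monomial_ge
  obtain ⟨c', c0', hc'⟩ := exists_integral_sq_block_ge
  refine ⟨min c c', by positivity, fun n μ hp hsym hiso hlc f hf => ?_⟩
  have h6 := integrable_pow_six hiso hlc.isPL
  have hw : ∀ I ∈ f.support, Finsupp.weight 1 I = 3 :=
    fun I hI => hf (MvPolynomial.mem_support_iff.1 hI)
  set P : (Fin n →₀ ℕ) → Fin n → ℕ := fun I k => I k % 2 with hP
  simp only [MvPolynomial.eval_eq']
  rw [integral_sq_sum_eq_sum_fiber (F := fun (I : Fin n →₀ ℕ) (x : Fin n → ℝ) => ∏ k, x k ^ I k) P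
    (fun I hI J hJ => integrable_prod_pow_mul_prod_pow h6 (hw I hI) (hw J hJ))
    (fun I _ J _ hIJ => by
      obtain ⟨i, hi⟩ := Function.ne_iff.1 hIJ
      exact hsym.integral_prod_pow_mul_prod_pow_eq_zero hi) fun I => f.coeff I]
  rw [← Finset.sum_fiberwise_of_maps_to (fun I hI => Finset.mem_image_of_mem P hI), Finset.mul_sum]
  refine Finset.sum_le_sum fun S hS => ?_
  obtain ⟨I, hI, rfl⟩ := Finset.mem_image.1 hS
  rcases Finsupp.eq_of_mod_two_or (hw I hI) with ⟨i, hi, hJ⟩ | hJ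
  · set φ : Fin n → Fin n →₀ ℕ :=
      fun j => Finsupp.single i 1 + Finsupp.single j 1 + Finsupp.single j 1 with hφ
    have hφi : Function.Injective φ := fun j k hjk => by
      have := DFunLike.congr_fun hjk j
      simp only [hφ, Finsupp.add_apply, Finsupp.single_apply] at this
      grind
    have hsum : ∀ G : (Fin n →₀ ℕ) → ℝ, (∀ J, f.coeff J = 0 → G J = 0) →
        ∑ J ∈ f.support with P J = P I, G J = ∑ j, G (φ j) := fun G hG => by
      rw [← Finset.sum_image (f := G) (fun j _ k _ h => hφi h)]
      refine Finset.sum_subset (fun J hJs => ?_) fun J hJs hJs' => hG J ?_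
      · rw [Finset.mem_filter] at hJs
        obtain ⟨j, rfl⟩ := hJ J (hw J hJs.1) fun k => congrFun hJs.2 k
        exact Finset.mem_image_of_mem _ (Finset.mem_univ j)
      · obtain ⟨j, -, rfl⟩ := Finset.mem_image.1 hJs
        by_contra h
        refine hJs' (Finset.mem_filter.2 ⟨MvPolynomial.mem_support_iff.2 h, ?_⟩)
        ext k
        simp only [hP, hi k, hφ, Finsupp.add_apply, Finsupp.single_apply]
        grind
    rw [hsum _ fun J h => by simp [h]]
    have e : ∀ x : Fin n → ℝ, ∑ J ∈ f.support with P J = P I, f.coeff J * ∏ k, x k ^ J k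
        = x i * ∑ j, f.coeff (φ j) * x j ^ 2 := fun x => by
      rw [hsum _ fun J h => by simp [h], Finset.mul_sum]
      refine Finset.sum_congr rfl fun j _ => ?_
      rw [prod_pow_single_add_single_add_single]
      ring
    simp only [e]
    exact (mul_le_mul_of_nonneg_right (min_le_right _ _) (by positivity)).trans
      (hc' n μ hp hsym hiso hlc i fun j => f.coeff (φ j))
  · have hfil : (f.support.filter fun J => P J = P I) = {I} := by
      ext J
      rw [Finset.mem_filter, Finset.mem_singleton]
      constructor
      · exact fun h => hJ J (hw J h.1) fun k => congrFun h.2 k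
      · rintro rfl
        exact ⟨hI, rfl⟩
    obtain ⟨a, b, d, habd⟩ := Finsupp.exists_eq_single_add_single_add_single (hw I hI)
    have e : ∀ x : Fin n → ℝ, ∏ k, x k ^ I k = x a * x b * x d := fun x => by
      rw [habd, prod_pow_single_add_single_add_single]
    rw [hfil]
    simp only [Finset.sum_singleton, e, mul_pow _ (_ * _ * _), integral_const_mul]
    rw [mul_comm]
    exact mul_le_mul_of_nonneg_left ((min_le_left _ _).trans (hc n μ hp hiso hlc a b d).1)
      (sq_nonneg _)

theorem eval_neg_of_isHomogeneous_three {n : ℕ} {f : MvPolynomial (Fin n) ℝ}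
    (hf : f.IsHomogeneous 3) (x : Fin n → ℝ) :
    MvPolynomial.eval (fun k => -1 * x k) f = -MvPolynomial.eval x f := by
  rw [MvPolynomial.eval_eq', MvPolynomial.eval_eq', ← Finset.sum_neg_distrib]
  refine Finset.sum_congr rfl fun I hI => ?_
  obtain ⟨a, b, c, rfl⟩ := Finsupp.exists_eq_single_add_single_add_single
    (hf (MvPolynomial.mem_support_iff.1 hI))
  simp only [prod_pow_single_add_single_add_single]
  ring

theorem IsHnInvariant.integral_eval_eq_zero {n : ℕ} {μ : Measure (Fin n → ℝ)}
    (hsym : IsHnInvariant μ) {f : MvPolynomial (Fin n) ℝ} (hf : f.IsHomogeneous 3) :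
    ∫ x, MvPolynomial.eval x f ∂μ = 0 := by
  have h := hsym.integral_sign (s := fun _ => -1) (fun _ => Or.inr rfl)
    (MvPolynomial.continuous_eval f)
  simp only [eval_neg_of_isHomogeneous_three hf, integral_neg] at h
  linarith

theorem isCubicOnLines_eval {n : ℕ} {f : MvPolynomial (Fin n) ℝ} (hf : f.IsHomogeneous 3) :
    IsCubicOnLines fun x => MvPolynomial.eval x f := by
  intro x₀ v
  have h : ∀ I ∈ f.support, ∃ r : Fin 4 → ℝ, ∀ s : ℝ,
      f.coeff I * ∏ k, (x₀ + s • v) k ^ I k = r 0 + r 1 * s + r 2 * s ^ 2 + r 3 * s ^ 3 := by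
    intro I hI
    obtain ⟨a, b, c, rfl⟩ := Finsupp.exists_eq_single_add_single_add_single
      (hf (MvPolynomial.mem_support_iff.1 hI))
    simp only [prod_pow_single_add_single_add_single]
    generalize f.coeff _ = w
    refine ⟨![w * (x₀ a * x₀ b * x₀ c),
      w * (v a * x₀ b * x₀ c + x₀ a * v b * x₀ c + x₀ a * x₀ b * v c),
      w * (v a * v b * x₀ c + v a * x₀ b * v c + x₀ a * v b * v c),
      w * (v a * v b * v c)], fun s => ?_⟩
    simp
    ring
  choose! r hr using h
  refine ⟨∑ I ∈ f.support, r I 0, ∑ I ∈ f.support, r I 1, ∑ I ∈ f.support, r I 2,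
    ∑ I ∈ f.support, r I 3, fun s => ?_⟩
  beta_reduce
  rw [MvPolynomial.eval_eq', Finset.sum_congr rfl fun I hI => hr I hI s]
  simp only [Finset.sum_add_distrib, Finset.sum_mul]

theorem le_rpow_of_pow_six_mul_sq_le {z t c C : ℝ} (ht : t ≠ 0) (hc : 0 < c)
    (hC : 0 < C) (h : z ^ 6 * (t ^ 2 * c) ≤ C) :
    z ≤ (C / c) ^ (1 / (6 : ℝ)) * |t| ^ (-(1 / (3 : ℝ))) := by
  have ht' : 0 < |t| := abs_pos.2 ht
  refine le_of_pow_le_pow_left₀ (n := 6) (by norm_num) (by positivity) ?_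
  rw [mul_pow, ← Real.rpow_natCast ((C / c) ^ _), ← Real.rpow_natCast (|t| ^ _),
    ← Real.rpow_mul (by positivity), ← Real.rpow_mul ht'.le]
  norm_num
  rw [← div_eq_mul_inv, div_div, le_div_iff₀ (by positivity)]
  linarith

/-- Theorem 1.5, cubic case: there are universal constants `c, C > 0` such that every
`H_n`-invariant isotropic log-concave probability measure `μ` on ℝ^n and every degree-3
homogeneous polynomial with `coeff_3(f) = 1` satisfy `Var_μ(f) ≥ c` and Fourier decay
`|t|^{-1/3}`. -/
theorem symmetric_cubic_variance_and_fourier_decay :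
    ∃ c C : ℝ, 0 < c ∧ 0 < C ∧
      ∀ (n : ℕ), 1 ≤ n → ∀ μ : Measure (Fin n → ℝ),
        IsProbabilityMeasure μ → IsHnInvariant μ → IsIsotropic μ → IsLogConcave μ →
        ∀ f : MvPolynomial (Fin n) ℝ,
          f.IsHomogeneous 3 → coeffNorm 3 f = 1 →
          c ≤ mVar μ (fun x => MvPolynomial.eval x f) ∧
          ∀ t : ℝ, t ≠ 0 →
            ‖∫ x, Complex.exp (Complex.I * (t : ℂ) * (MvPolynomial.eval x f : ℂ)) ∂μ‖
              ≤ C * |t| ^ (-(1 / (3 : ℝ))) := by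
  obtain ⟨c, c0, hc⟩ := exists_integral_sq_eval_ge
  obtain ⟨C, C0, hC⟩ := exists_cubic_decay_of_logConcave
  refine ⟨c, (C / c) ^ (1 / (6 : ℝ)), c0, by positivity,
    fun n _ μ hp hsym hiso hlc f hf hf1 => ?_⟩
  have h6 := integrable_pow_six hiso hlc.isPL
  have hsum : ∑ I ∈ f.support, f.coeff I ^ 2 = 1 := by
    rw [coeffNorm, Real.sqrt_eq_one, Finset.filter_true_of_mem fun I hI => ?_] at hf1
    · exact hf1
    · rw [← hf (MvPolynomial.mem_support_iff.1 hI), Finsupp.weight_apply]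
      exact Finsupp.sum_congr fun _ _ => by simp
  have hvar : c ≤ mVar μ fun x => MvPolynomial.eval x f := by
    rw [mVar, hsym.integral_eval_eq_zero hf]
    linarith [hc n μ hp hsym hiso hlc f hf, hsum ▸ mul_one c]
  refine ⟨hvar, fun t ht => le_rpow_of_pow_six_mul_sq_le ht c0 C0 ?_⟩
  obtain ⟨ρ, hρ, hμ⟩ := hlc.exists_logConcave
  refine le_trans ?_ (hC n ρ hρ μ hμ hp (fun x => MvPolynomial.eval x f)
    (MvPolynomial.continuous_eval f) (isCubicOnLines_eval hf)
    (integrable_eval h6 hf (by norm_num))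
    (by simpa only [map_pow] using integrable_eval h6 (hf.pow 2) (by norm_num)) t)
  have h := hvar
  rw [mVar] at h
  gcongr
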